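/- Let r > 0, θ ∈ ℝ, σ > 0, and let h : ℝ → ℝ be Lipschitz with constant L ≥ 0. Let f_h be the solution of the VG(r,θ,σ,0) Stein equation with test function h. Then for every x ≠ 0 and every d ∈ ℝ such that f_h has derivative d at x, |x·d| ≤ (1 + 6/(r+1) + B(r+1,θ,σ))·{1 + (2 + θ²/σ²)·C(r,θ,σ)}·L. -/

import Mathlib

open MeasureTheory Real Filter

/-- Modified Bessel function of the second kind. -/
noncomputable def besselK (ν x : ℝ) : ℝ :=
  ∫ t in Set.Ioi (0:ℝ), Real.exp (-x * Real.cosh t) * Real.cosh (ν * t)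

/-- Modified Bessel function of the first kind. -/
noncomputable def besselI (ν x : ℝ) : ℝ :=
  ∑' k : ℕ, (x / 2) ^ (ν + 2 * (k : ℝ)) / (Real.Gamma (ν + (k : ℝ) + 1) * (Nat.factorial k))

/-- The VG(r,θ,σ,0) density. -/
noncomputable def vgDensity (r θ σ x : ℝ) : ℝ :=
  (σ * Real.sqrt Real.pi * Real.Gamma (r / 2))⁻¹ * Real.exp (θ * x / σ ^ 2) *
    (|x| / (2 * Real.sqrt (θ ^ 2 + σ ^ 2))) ^ ((r - 1) / 2) *
    besselK ((r - 1) / 2) (Real.sqrt (θ ^ 2 + σ ^ 2) * |x| / σ ^ 2)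

/-- The centred test function h̃(x) = h(x) − E h(Z). -/
noncomputable def htilde (r θ σ : ℝ) (h : ℝ → ℝ) (x : ℝ) : ℝ :=
  h x - ∫ t, h t * vgDensity r θ σ t

/-- The solution of the VG(r,θ,σ,0) Stein equation with test function h. -/
noncomputable def steinSolution (r θ σ : ℝ) (h : ℝ → ℝ) (x : ℝ) : ℝ :=
  -(Real.exp (-(θ / σ ^ 2) * x) *
      besselK ((r - 1) / 2) (Real.sqrt (θ ^ 2 + σ ^ 2) / σ ^ 2 * |x|) /
      (σ ^ 2 * |x| ^ ((r - 1) / 2))) *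
    (∫ t in (0:ℝ)..x, Real.exp ((θ / σ ^ 2) * t) * |t| ^ ((r - 1) / 2) *
      besselI ((r - 1) / 2) (Real.sqrt (θ ^ 2 + σ ^ 2) / σ ^ 2 * |t|) * htilde r θ σ h t) -
  (Real.exp (-(θ / σ ^ 2) * x) *
      besselI ((r - 1) / 2) (Real.sqrt (θ ^ 2 + σ ^ 2) / σ ^ 2 * |x|) /
      (σ ^ 2 * |x| ^ ((r - 1) / 2))) *
    (∫ t in Set.Ioi x, Real.exp ((θ / σ ^ 2) * t) * |t| ^ ((r - 1) / 2) *
      besselK ((r - 1) / 2) (Real.sqrt (θ ^ 2 + σ ^ 2) / σ ^ 2 * |t|) * htilde r θ σ h t)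

/-- The constant A(r,θ,σ). -/
noncomputable def Aconst (r θ σ : ℝ) : ℝ :=
  if 2 ≤ r then 2 * Real.sqrt Real.pi / Real.sqrt (2 * r - 1) * (1 + θ ^ 2 / σ ^ 2) ^ (r / 2)
  else 12 * Real.Gamma (r / 2) * (1 + θ ^ 2 / σ ^ 2)

/-- The constant B(r,θ,σ). -/
noncomputable def Bconst (r θ σ : ℝ) : ℝ :=
  if 2 ≤ r then Real.sqrt (Real.pi * (r - 1) / 2) * (1 + θ ^ 2 / σ ^ 2) ^ (r / 2 - 1)
  else 2

/-- The constant C(r,θ,σ). -/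
noncomputable def Cconst (r θ σ : ℝ) : ℝ :=
  6 + 2 * Real.sqrt 2 / Real.sqrt r +
    2 * Real.sqrt (2 * Real.pi * (r + 1)) * (|θ| / σ) * (1 + θ ^ 2 / σ ^ 2) ^ ((r - 1) / 2) +
    2 * (Real.sqrt (2 * r) + r) * Aconst r θ σ


noncomputable def vgPhi (ν y : ℝ) : ℝ :=
  ∑' k : ℕ, y ^ k / (Real.Gamma (ν + (k : ℝ) + 1) * (Nat.factorial k))

lemma vgPhi_gamma_pos {ν : ℝ} (hν : -1 < ν) (k : ℕ) :
    0 < Real.Gamma (ν + (k : ℝ) + 1) * (Nat.factorial k) := by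
  have h1 : 0 < ν + (k : ℝ) + 1 := by have := Nat.cast_nonneg (α := ℝ) k; linarith
  have := Real.Gamma_pos_of_pos h1
  have h2 : (0 : ℝ) < (Nat.factorial k : ℝ) := by exact_mod_cast Nat.factorial_pos k
  positivity

lemma vgPhi_coeff_succ {ν : ℝ} (hν : -1 < ν) (k : ℕ) :
    Real.Gamma (ν + ((k + 1 : ℕ) : ℝ) + 1) * (Nat.factorial (k + 1)) =
      (ν + k + 1) * (k + 1) * (Real.Gamma (ν + (k : ℝ) + 1) * (Nat.factorial k)) := by
  have h1 : 0 < ν + (k : ℝ) + 1 := by have := Nat.cast_nonneg (α := ℝ) k; linarith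
  have : ν + ((k + 1 : ℕ) : ℝ) + 1 = (ν + k + 1) + 1 := by push_cast; ring
  rw [this, Real.Gamma_add_one h1.ne', Nat.factorial_succ]
  push_cast; ring

lemma vgPhi_summable {ν : ℝ} (hν : -1 < ν) (y : ℝ) :
    Summable (fun k : ℕ => y ^ k / (Real.Gamma (ν + (k : ℝ) + 1) * (Nat.factorial k))) := by
  by_cases hy : y = 0
  · subst hy
    apply summable_of_ne_finset_zero (s := {0})
    intro b hb
    have : b ≠ 0 := by simpa using hb
    simp [this]
  refine summable_of_ratio_test_tendsto_lt_one (l := 0) zero_lt_one ?_ ?_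
  · exact Eventually.of_forall fun k => div_ne_zero (pow_ne_zero _ hy) (vgPhi_gamma_pos hν k).ne'
  · have key : ∀ k : ℕ, ‖y ^ (k + 1) / (Real.Gamma (ν + ((k + 1 : ℕ) : ℝ) + 1) * (Nat.factorial (k + 1)))‖ /
        ‖y ^ k / (Real.Gamma (ν + (k : ℝ) + 1) * (Nat.factorial k))‖ =
          (|y| / (ν + k + 1)) * (1 / ((k : ℝ) + 1)) := by
      intro k
      have h0 := vgPhi_gamma_pos hν k
      have h1 : 0 < ν + (k : ℝ) + 1 := by have := Nat.cast_nonneg (α := ℝ) k; linarith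
      have h2 : 0 < (k : ℝ) + 1 := by positivity
      have hya : 0 < |y| := abs_pos.mpr hy
      rw [vgPhi_coeff_succ hν]
      generalize Real.Gamma (ν + (k : ℝ) + 1) * (Nat.factorial k) = G at h0
      generalize ν + (k : ℝ) + 1 = q at h1
      have hp : 0 < q * ((k : ℝ) + 1) * G := by positivity
      rw [Real.norm_eq_abs, Real.norm_eq_abs, abs_div, abs_div, abs_pow, abs_pow,
        abs_of_pos h0, abs_of_pos hp]
      field_simp
      rw [pow_succ]
    simp_rw [key]
    have t1 : Tendsto (fun k : ℕ => |y| / (ν + k + 1)) atTop (nhds 0) := by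
      apply Tendsto.div_atTop tendsto_const_nhds
      apply tendsto_atTop_add_const_right
      exact tendsto_atTop_add_const_left _ _ tendsto_natCast_atTop_atTop
    have t2 : Tendsto (fun k : ℕ => (1 : ℝ) / ((k : ℝ) + 1)) atTop (nhds 0) :=
      tendsto_one_div_add_atTop_nhds_zero_nat
    simpa using t1.mul t2

lemma vgPhi_hasDerivAt {ν : ℝ} (hν : -1 < ν) (y : ℝ) :
    HasDerivAt (vgPhi ν) (vgPhi (ν + 1) y) y := by
  have hν1 : -1 < ν + 1 := by linarith
  set R : ℝ := |y| + 1
  -- derivative terms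
  let g' : ℕ → ℝ → ℝ := fun k z => (k * z ^ (k - 1)) / (Real.Gamma (ν + (k : ℝ) + 1) * (Nat.factorial k))
  have hshift : ∀ (k : ℕ) (z : ℝ), g' (k + 1) z =
      z ^ k / (Real.Gamma ((ν + 1) + (k : ℝ) + 1) * (Nat.factorial k)) := by
    intro k z
    have : (ν + 1) + (k : ℝ) + 1 = ν + ((k + 1 : ℕ) : ℝ) + 1 := by push_cast; ring
    simp only [g']
    rw [this, Nat.factorial_succ]
    have h2 : ((k : ℝ) + 1) ≠ 0 := by positivity
    have h0 := (vgPhi_gamma_pos hν (k+1)).ne'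
    have h3 : Real.Gamma (ν + ((k + 1 : ℕ) : ℝ) + 1) ≠ 0 := left_ne_zero_of_mul h0
    have h4 : (Nat.factorial k : ℝ) ≠ 0 := by exact_mod_cast Nat.factorial_ne_zero k
    push_cast at *
    field_simp
    try simp
  have hsum : Summable (fun k => g' k R) := by
    rw [← summable_nat_add_iff 1]
    simp_rw [hshift]
    exact vgPhi_summable hν1 R
  have hd := hasDerivAt_tsum_of_isPreconnected (u := fun k => g' k R) (t := Metric.ball 0 R)
    (g := fun (k : ℕ) z => z ^ k / (Real.Gamma (ν + (k : ℝ) + 1) * (Nat.factorial k))) (g' := g')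
    (y₀ := 0) (y := y) hsum Metric.isOpen_ball (convex_ball _ _).isPreconnected
    (by
      intro n z hz
      exact (hasDerivAt_pow n z).div_const _)
    (by
      intro n z hz
      have h0 := vgPhi_gamma_pos hν n
      have hz' : |z| ≤ R := by
        have := Metric.mem_ball.mp hz
        rw [Real.dist_eq, sub_zero] at this
        exact this.le
      simp only [g']
      rw [Real.norm_eq_abs, abs_div, abs_mul, abs_pow, abs_of_pos h0, Nat.abs_cast]
      gcongr)
    (by simp [R]; positivity) (vgPhi_summable hν 0)
    (by rw [Metric.mem_ball, Real.dist_eq, sub_zero]; simp [R])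
  have e : ∑' n, g' n y = vgPhi (ν + 1) y := by
    have hs : Summable (fun k => g' k y) := by
      rw [← summable_nat_add_iff 1]
      simp_rw [hshift]
      exact vgPhi_summable hν1 y
    rw [hs.tsum_eq_zero_add]
    simp_rw [hshift]
    simp [g', vgPhi]
  rw [e] at hd
  exact hd

lemma vgPhi_rec {ν : ℝ} (hν : -1 < ν) (y : ℝ) :
    (ν + 1) * vgPhi (ν + 1) y + y * vgPhi (ν + 2) y = vgPhi ν y := by
  have s0 := vgPhi_summable hν y
  have s1 := vgPhi_summable (ν := ν + 1) (by linarith) y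
  have s2 := vgPhi_summable (ν := ν + 2) (by linarith) y
  unfold vgPhi
  rw [s0.tsum_eq_zero_add, s1.tsum_eq_zero_add, mul_add, ← tsum_mul_left, ← tsum_mul_left, add_assoc,
    ← ((summable_nat_add_iff 1).mpr s1 |>.mul_left (ν+1)).tsum_add (s2.mul_left y)]
  congr 1
  · have : ν + 1 ≠ 0 := by linarith
    have e : ν + 1 + ((0 : ℕ) : ℝ) + 1 = (ν + 1) + 1 := by simp
    have e2 : ν + ((0 : ℕ) : ℝ) + 1 = (ν + 1) := by simp
    rw [e, e2, Real.Gamma_add_one this]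
    have := (Real.Gamma_pos_of_pos (show 0 < ν + 1 by linarith)).ne'
    field_simp
  · congr 1
    ext k
    have h1 : 0 < ν + (k : ℝ) + 1 := by have := Nat.cast_nonneg (α := ℝ) k; linarith
    have e1 : ν + 1 + ((k + 1 : ℕ) : ℝ) + 1 = (ν + k + 1) + 1 + 1 := by push_cast; ring
    have e2 : ν + 2 + (k : ℝ) + 1 = (ν + k + 1) + 1 + 1 := by ring
    have e3 : ν + ((k + 1 : ℕ) : ℝ) + 1 = (ν + k + 1) + 1 := by push_cast; ring
    rw [e1, e2, e3, Real.Gamma_add_one (show ν + k + 1 + 1 ≠ 0 by linarith), Nat.factorial_succ]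
    have h3 := (Real.Gamma_pos_of_pos (show 0 < ν + k + 1 + 1 by linarith)).ne'
    have h4 : (Nat.factorial k : ℝ) ≠ 0 := by exact_mod_cast Nat.factorial_ne_zero k
    have h5 : ν + k + 1 + 1 ≠ 0 := by linarith
    have h2 : ((k : ℝ) + 1) ≠ 0 := by positivity
    push_cast
    field_simp
    ring

lemma vgPhi_ge {ν : ℝ} (hν : -1 < ν) {y : ℝ} (hy : 0 ≤ y) :
    1 / Real.Gamma (ν + 1) ≤ vgPhi ν y := by
  have := (vgPhi_summable hν y).le_tsum 0 (fun k _ => div_nonneg (pow_nonneg hy _) (vgPhi_gamma_pos hν k).le)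
  simpa [vgPhi] using this

lemma vgPhi_pos {ν : ℝ} (hν : -1 < ν) {y : ℝ} (hy : 0 ≤ y) : 0 < vgPhi ν y :=
  lt_of_lt_of_le (one_div_pos.mpr (Real.Gamma_pos_of_pos (by linarith))) (vgPhi_ge hν hy)

lemma vgPhi_zero (ν : ℝ) : vgPhi ν 0 = 1 / Real.Gamma (ν + 1) := by
  unfold vgPhi
  rw [tsum_eq_single 0]
  · simp
  · intro b hb; simp [hb]

lemma besselI_eq_vgPhi (ν : ℝ) {x : ℝ} (hx : 0 < x) :
    besselI ν x = (x / 2) ^ ν * vgPhi ν (x ^ 2 / 4) := by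
  unfold besselI vgPhi
  rw [← tsum_mul_left]
  congr 1
  ext k
  have h2 : 0 < x / 2 := by positivity
  rw [Real.rpow_add h2, mul_div_assoc]
  congr 2
  rw [show (2 : ℝ) * (k : ℝ) = ((2 * k : ℕ) : ℝ) by push_cast; ring, Real.rpow_natCast, pow_mul]
  congr 1
  ring



noncomputable def vgPsi (ν y : ℝ) : ℝ :=
  ∫ s in Set.Ioi (0:ℝ), s ^ (-ν - 1) * Real.exp (-s - y / s)

lemma vgKer_bound (μ : ℝ) {p q : ℝ} (hq : 0 < q) (n : ℕ) {s : ℝ} (hs : 0 < s) :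
    s ^ μ * Real.exp (-p * s - q / s) ≤
      ((Nat.factorial n : ℝ) / q ^ n) * (s ^ (μ + n) * Real.exp (-p * s)) := by
  have h1 := Real.pow_div_factorial_le_exp (q / s) (by positivity) n
  have hf : (0 : ℝ) < (Nat.factorial n : ℝ) := by exact_mod_cast Nat.factorial_pos n
  have h2 : Real.exp (-(q / s)) ≤ ((Nat.factorial n : ℝ) / q ^ n) * s ^ n := by
    rw [Real.exp_neg]
    calc (Real.exp (q / s))⁻¹ ≤ ((q / s) ^ n / (Nat.factorial n : ℝ))⁻¹ := by
          apply inv_anti₀ (by positivity) h1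
      _ = _ := by rw [div_pow]; field_simp
  rw [sub_eq_add_neg, Real.exp_add, Real.rpow_add hs, Real.rpow_natCast]
  calc s ^ μ * (Real.exp (-p * s) * Real.exp (-(q / s)))
      ≤ s ^ μ * (Real.exp (-p * s) * (((Nat.factorial n : ℝ) / q ^ n) * s ^ n)) := by gcongr
    _ = _ := by ring

lemma vgKer_cont (μ p q : ℝ) :
    ContinuousOn (fun s : ℝ => s ^ μ * Real.exp (-p * s - q / s)) (Set.Ioi 0) := by
  intro s hs
  have hs' : s ≠ 0 := ne_of_gt hs
  apply ContinuousAt.continuousWithinAt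
  have h1 : ContinuousAt (fun s : ℝ => s ^ μ) s := Real.continuousAt_rpow_const _ _ (Or.inl hs')
  have h2 : ContinuousAt (fun s : ℝ => Real.exp (-p * s - q / s)) s := by
    apply Real.continuous_exp.continuousAt.comp
    exact (continuousAt_const.mul continuousAt_id).sub (continuousAt_const.div continuousAt_id hs')
  exact h1.mul h2

lemma vgKer_int (μ : ℝ) {p q : ℝ} (hp : 0 < p) (hq : 0 < q) :
    IntegrableOn (fun s : ℝ => s ^ μ * Real.exp (-p * s - q / s)) (Set.Ioi 0) := by
  obtain ⟨n, hn⟩ := exists_nat_gt (-μ)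
  have h0 := (integrableOn_rpow_mul_exp_neg_mul_rpow (p := 1) (s := μ + n) (b := p) (by linarith)
    one_pos hp).const_mul ((Nat.factorial n : ℝ) / q ^ n)
  refine Integrable.mono' h0 ((vgKer_cont μ p q).aestronglyMeasurable measurableSet_Ioi) ?_
  refine (ae_restrict_iff' measurableSet_Ioi).mpr (Eventually.of_forall fun s hs => ?_)
  have hs' : (0:ℝ) < s := hs
  rw [Real.norm_of_nonneg (by positivity)]
  simpa using vgKer_bound μ (p := p) hq n hs'

lemma vgPsi_int (ν : ℝ) {y : ℝ} (hy : 0 < y) :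
    IntegrableOn (fun s : ℝ => s ^ (-ν - 1) * Real.exp (-s - y / s)) (Set.Ioi 0) := by
  have := vgKer_int (-ν - 1) one_pos hy
  simpa using this

lemma vgPsi_pos (ν : ℝ) {y : ℝ} (hy : 0 < y) : 0 < vgPsi ν y := by
  unfold vgPsi
  rw [setIntegral_pos_iff_support_of_nonneg_ae]
  · have : Function.support (fun s : ℝ => s ^ (-ν - 1) * Real.exp (-s - y / s)) ∩ Set.Ioi 0 = Set.Ioi 0 := by
      apply Set.inter_eq_right.mpr
      intro s hs
      have hs' : (0:ℝ) < s := hs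
      rw [Function.mem_support]
      positivity
    rw [this]
    simp
  · refine (ae_restrict_iff' measurableSet_Ioi).mpr (Eventually.of_forall fun s hs => ?_)
    have hs' : (0:ℝ) < s := hs
    simp only [Pi.zero_apply]; positivity
  · exact vgPsi_int ν hy

lemma vgPsi_hasDerivAt (ν : ℝ) {y : ℝ} (hy : 0 < y) :
    HasDerivAt (vgPsi ν) (-vgPsi (ν + 1) y) y := by
  have hmem : Set.Ioi (y / 2) ∈ nhds y := Ioi_mem_nhds (by linarith)
  have key := hasDerivAt_integral_of_dominated_loc_of_deriv_le (μ := volume.restrict (Set.Ioi (0:ℝ)))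
    (F := fun y s => s ^ (-ν - 1) * Real.exp (-s - y / s))
    (F' := fun y s => -(s ^ (-(ν + 1) - 1) * Real.exp (-s - y / s)))
    (bound := fun s => s ^ (-(ν + 1) - 1) * Real.exp (-s - (y / 2) / s))
    (x₀ := y) (s := Set.Ioi (y / 2)) hmem ?_ ?_ ?_ ?_ ?_ ?_
  · have := key.2
    rw [integral_neg] at this
    exact this
  · filter_upwards [hmem] with z hz
    have hz' : 0 < z := lt_trans (by linarith) hz
    exact (vgPsi_int ν hz').aestronglyMeasurable
  · exact vgPsi_int ν hy
  · exact (vgPsi_int (ν + 1) hy).aestronglyMeasurable.neg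
  · refine (ae_restrict_iff' measurableSet_Ioi).mpr (Eventually.of_forall fun s hs z hz => ?_)
    have hs' : (0:ℝ) < s := hs
    have hz' : y / 2 < z := hz
    rw [norm_neg, Real.norm_of_nonneg (by positivity)]
    gcongr
  · exact vgPsi_int (ν + 1) (by linarith)
  · refine (ae_restrict_iff' measurableSet_Ioi).mpr (Eventually.of_forall fun s hs z hz => ?_)
    have hs' : (0:ℝ) < s := hs
    have h1 : HasDerivAt (fun z : ℝ => -s - z / s) (-(1 / s)) z := by
      simpa using ((hasDerivAt_id z).div_const s).const_sub (-s)
    have h2 := (h1.exp).const_mul (s ^ (-ν - 1))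
    refine h2.congr_deriv ?_
    rw [show -(ν + 1) - 1 = (-ν - 1) - 1 by ring, Real.rpow_sub_one hs'.ne' (-ν - 1)]
    field_simp

lemma vgKer_tendsto_atTop (μ : ℝ) {q : ℝ} (hq : 0 < q) :
    Tendsto (fun s : ℝ => s ^ μ * Real.exp (-s - q / s)) atTop (nhds 0) := by
  have h := tendsto_rpow_mul_exp_neg_mul_atTop_nhds_zero μ 1 one_pos
  refine squeeze_zero' ?_ ?_ h
  · filter_upwards [eventually_gt_atTop 0] with s hs
    positivity
  · filter_upwards [eventually_gt_atTop 0] with s hs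
    have : 0 < q / s := by positivity
    gcongr
    linarith

lemma vgKer_tendsto_zero (μ : ℝ) {q : ℝ} (hq : 0 < q) :
    Tendsto (fun s : ℝ => s ^ μ * Real.exp (-s - q / s)) (nhdsWithin 0 (Set.Ioi 0)) (nhds 0) := by
  obtain ⟨n, hn⟩ := exists_nat_gt (-μ)
  have hc : Tendsto (fun s : ℝ => ((Nat.factorial n : ℝ) / q ^ n) * (s ^ (μ + n) * Real.exp (-1 * s)))
      (nhdsWithin 0 (Set.Ioi 0)) (nhds 0) := by
    have : ContinuousAt (fun s : ℝ => ((Nat.factorial n : ℝ) / q ^ n) * (s ^ (μ + n) * Real.exp (-1 * s))) 0 := by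
      have h1 : ContinuousAt (fun s : ℝ => s ^ (μ + n)) 0 :=
        Real.continuousAt_rpow_const _ _ (Or.inr (by linarith))
      exact continuousAt_const.mul (h1.mul (by fun_prop))
    have h2 := this.tendsto
    simp only [Real.zero_rpow (show μ + (n:ℝ) ≠ 0 by linarith), zero_mul, mul_zero] at h2
    exact h2.mono_left nhdsWithin_le_nhds
  refine squeeze_zero' ?_ ?_ hc
  · filter_upwards [self_mem_nhdsWithin] with s hs
    have hs' : (0:ℝ) < s := hs
    positivity
  · filter_upwards [self_mem_nhdsWithin] with s hs
    have := vgKer_bound μ (p := 1) hq n hs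
    simpa using this

lemma vgPsi_rec (ν : ℝ) {y : ℝ} (hy : 0 < y) :
    y * vgPsi (ν + 2) y = vgPsi ν y + (ν + 1) * vgPsi (ν + 1) y := by
  have i0 := vgPsi_int ν hy
  have i1 := vgPsi_int (ν + 1) hy
  have i2 := vgPsi_int (ν + 2) hy
  have hd : ∀ s ∈ Set.Ioi (0:ℝ), HasDerivAt (fun s : ℝ => s ^ (-ν - 1) * Real.exp (-s - y / s))
      (y * (s ^ (-(ν + 2) - 1) * Real.exp (-s - y / s)) - (s ^ (-ν - 1) * Real.exp (-s - y / s))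
        - (ν + 1) * (s ^ (-(ν + 1) - 1) * Real.exp (-s - y / s))) s := by
    intro s hs
    have hs' : (0:ℝ) < s := hs
    have h1 : HasDerivAt (fun s : ℝ => s ^ (-ν - 1)) ((-ν - 1) * s ^ (-ν - 1 - 1)) s :=
      Real.hasDerivAt_rpow_const (Or.inl hs'.ne')
    have h2 : HasDerivAt (fun s : ℝ => -s - y / s) (-1 + y / s ^ 2) s := by
      have := ((hasDerivAt_id s).neg).sub ((hasDerivAt_const s y).div (hasDerivAt_id s) hs'.ne')
      refine this.congr_deriv ?_
      simp only [id]
      field_simp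
      ring
    refine (h1.mul h2.exp).congr_deriv ?_
    rw [show -(ν + 2) - 1 = (-ν - 1) - 1 - 1 by ring, show -(ν + 1) - 1 = (-ν - 1) - 1 by ring,
      Real.rpow_sub_one hs'.ne' (-ν - 1 - 1), Real.rpow_sub_one hs'.ne' (-ν - 1)]
    field_simp
    ring
  have hIntg : IntegrableOn (fun s => y * (s ^ (-(ν + 2) - 1) * Real.exp (-s - y / s)) - (s ^ (-ν - 1) * Real.exp (-s - y / s))
        - (ν + 1) * (s ^ (-(ν + 1) - 1) * Real.exp (-s - y / s))) (Set.Ioi (0:ℝ)) :=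
    ((i2.const_mul y).sub i0).sub (i1.const_mul _)
  have key := integral_Ioi_deriv_mul_eq_sub (A := ℝ) (a := 0) (u := fun _ => 1) (u' := fun _ => 0)
    (v := fun s : ℝ => s ^ (-ν - 1) * Real.exp (-s - y / s)) (a' := 0) (b' := 0)
    (fun x _ => hasDerivAt_const x 1) hd
    (by refine hIntg.congr_fun (fun s hs => ?_) measurableSet_Ioi; simp)
    (by
      have := vgKer_tendsto_zero (-ν - 1) hy
      refine this.congr (fun s => ?_); simp)
    (by
      have := vgKer_tendsto_atTop (-ν - 1) hy
      refine this.congr (fun s => ?_); simp)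
  simp only [zero_mul, one_mul, zero_add, sub_zero] at key
  have e1 := integral_sub ((i2.const_mul y).sub i0) (i1.const_mul (ν + 1))
  have e2 := integral_sub (i2.const_mul y) i0
  simp only [Pi.sub_apply] at e1
  rw [e1, e2, integral_const_mul, integral_const_mul] at key
  unfold vgPsi
  linarith

lemma besselK_neg (ν x : ℝ) : besselK (-ν) x = besselK ν x := by
  unfold besselK
  congr 1
  ext t
  rw [show -ν * t = -(ν * t) by ring, Real.cosh_neg]

lemma besselK_eq_vgPsi (ν : ℝ) {z : ℝ} (hz : 0 < z) :
    besselK ν z = 1 / 2 * (z / 2) ^ ν * vgPsi ν (z ^ 2 / 4) := by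
  have hz2 : 0 < z / 2 := by positivity
  have himg : (fun t : ℝ => z / 2 * Real.exp t) '' Set.univ = Set.Ioi 0 := by
    ext s
    simp only [Set.image_univ, Set.mem_range, Set.mem_Ioi]
    constructor
    · rintro ⟨t, rfl⟩; positivity
    · intro hs
      refine ⟨Real.log (s / (z / 2)), ?_⟩
      rw [Real.exp_log (by positivity)]
      field_simp
  have hder : ∀ t ∈ (Set.univ : Set ℝ), HasDerivWithinAt (fun t : ℝ => z / 2 * Real.exp t)
      (z / 2 * Real.exp t) Set.univ t := fun t _ => ((Real.hasDerivAt_exp t).const_mul _).hasDerivWithinAt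
  have hinj : Set.InjOn (fun t : ℝ => z / 2 * Real.exp t) Set.univ := by
    intro a _ b _ hab
    exact Real.exp_injective (mul_left_cancel₀ hz2.ne' hab)
  have hcov := integral_image_eq_integral_abs_deriv_smul MeasurableSet.univ hder hinj
    (fun s => s ^ (-ν - 1) * Real.exp (-s - (z ^ 2 / 4) / s))
  rw [himg, setIntegral_univ] at hcov
  have hpt : ∀ t : ℝ, |z / 2 * Real.exp t| • ((z / 2 * Real.exp t) ^ (-ν - 1) *
      Real.exp (-(z / 2 * Real.exp t) - (z ^ 2 / 4) / (z / 2 * Real.exp t))) =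
      (z / 2) ^ (-ν) * (Real.exp (-z * Real.cosh t) * Real.exp (-ν * t)) := by
    intro t
    have hp : 0 < z / 2 * Real.exp t := by positivity
    rw [abs_of_pos hp, smul_eq_mul, Real.rpow_sub_one hp.ne', Real.mul_rpow hz2.le (Real.exp_pos t).le,
      ← Real.exp_mul]
    have e1 : -(z / 2 * Real.exp t) - (z ^ 2 / 4) / (z / 2 * Real.exp t) = -z * Real.cosh t := by
      rw [Real.cosh_eq, Real.exp_neg]
      field_simp
      ring
    rw [e1, mul_comm t (-ν)]
    field_simp
  have hintR : Integrable (fun t : ℝ => Real.exp (-z * Real.cosh t) * Real.exp (-ν * t)) := by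
    have h1 := (integrableOn_image_iff_integrableOn_abs_deriv_smul MeasurableSet.univ hder hinj
      (fun s => s ^ (-ν - 1) * Real.exp (-s - (z ^ 2 / 4) / s))).mp
      (by rw [himg]; exact vgPsi_int ν (by positivity))
    rw [integrableOn_univ] at h1
    simp_rw [hpt] at h1
    have h2 := h1.const_mul ((z / 2) ^ ν)
    refine h2.congr (Eventually.of_forall fun t => ?_)
    simp only
    rw [← mul_assoc, ← Real.rpow_add hz2]
    simp
  simp_rw [hpt] at hcov
  rw [integral_const_mul] at hcov
  have hsym : ∫ t : ℝ, Real.exp (-z * Real.cosh t) * Real.exp (-ν * t) =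
      ∫ t : ℝ, Real.exp (-z * Real.cosh t) * Real.exp (ν * t) := by
    rw [← integral_neg_eq_self]
    congr 1; ext t; rw [Real.cosh_neg]; simp
  have hintR' : Integrable (fun t : ℝ => Real.exp (-z * Real.cosh t) * Real.exp (ν * t)) := by
    have := hintR.comp_neg
    simpa using this
  have hcosh : ∫ t : ℝ, Real.exp (-z * Real.cosh t) * Real.exp (-ν * t) =
      ∫ t : ℝ, Real.exp (-z * Real.cosh |t|) * Real.cosh (ν * |t|) := by
    have : ∫ t : ℝ, Real.exp (-z * Real.cosh |t|) * Real.cosh (ν * |t|) =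
        ∫ t : ℝ, ((1/2) * (Real.exp (-z * Real.cosh t) * Real.exp (-ν * t)) +
          (1/2) * (Real.exp (-z * Real.cosh t) * Real.exp (ν * t))) := by
      congr 1; ext t
      have e : Real.cosh (ν * |t|) = Real.cosh (ν * t) := by
        rcases abs_choice t with h | h <;> rw [h]
        rw [mul_neg, Real.cosh_neg]
      rw [Real.cosh_abs, e, Real.cosh_eq (ν * t)]
      rw [← neg_mul]
      ring
    rw [this, integral_add (hintR.const_mul _) (hintR'.const_mul _), integral_const_mul, integral_const_mul, ← hsym]
    ring
  rw [hcosh, integral_comp_abs (f := fun t => Real.exp (-z * Real.cosh t) * Real.cosh (ν * t))] at hcov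
  unfold besselK vgPsi
  rw [hcov, Real.rpow_neg hz2.le]
  have : (z / 2) ^ ν ≠ 0 := (Real.rpow_pos_of_pos hz2 _).ne'
  field_simp

lemma vgPsi_symm (ν : ℝ) {y : ℝ} (hy : 0 < y) : y ^ ν * vgPsi ν y = vgPsi (-ν) y := by
  have hz : 0 < 2 * Real.sqrt y := by positivity
  have e : (2 * Real.sqrt y) ^ 2 / 4 = y := by rw [mul_pow, Real.sq_sqrt hy.le]; ring
  have h1 := besselK_eq_vgPsi ν hz
  have h2 := besselK_eq_vgPsi (-ν) hz
  have e2 : 2 * Real.sqrt y / 2 = Real.sqrt y := by ring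
  rw [besselK_neg, h1, e, e2, Real.rpow_neg (Real.sqrt_nonneg y)] at h2
  have hs : 0 < Real.sqrt y := by positivity
  have hp := Real.rpow_pos_of_pos hs ν
  have e3 : y ^ ν = Real.sqrt y ^ ν * Real.sqrt y ^ ν := by
    rw [← Real.mul_rpow hs.le hs.le, Real.mul_self_sqrt hy.le]
  rw [e3]
  field_simp at h2
  linarith



lemma besselK_pos (ν : ℝ) {z : ℝ} (hz : 0 < z) : 0 < besselK ν z := by
  rw [besselK_eq_vgPsi ν hz]
  have := vgPsi_pos ν (y := z ^ 2 / 4) (by positivity)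
  positivity

lemma besselK_integrable (ν : ℝ) {z : ℝ} (hz : 0 < z) :
    IntegrableOn (fun t => Real.exp (-z * Real.cosh t) * Real.cosh (ν * t)) (Set.Ioi 0) :=
  Integrable.of_integral_ne_zero (besselK_pos ν hz).ne'

lemma besselK_mono {μ ν : ℝ} (h : |μ| ≤ |ν|) {z : ℝ} (hz : 0 < z) : besselK μ z ≤ besselK ν z := by
  unfold besselK
  apply integral_mono (besselK_integrable μ hz) (besselK_integrable ν hz)
  intro t
  simp only
  gcongr 1
  rw [Real.cosh_le_cosh, abs_mul, abs_mul]
  gcongr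

lemma vgPsi_neg_tendsto {μ : ℝ} (hμ : 0 < μ) :
    Tendsto (vgPsi (-μ)) (nhdsWithin 0 (Set.Ioi 0)) (nhds (Real.Gamma μ)) := by
  rw [Real.Gamma_eq_integral hμ]
  unfold vgPsi
  refine tendsto_integral_filter_of_dominated_convergence
    (bound := fun s => Real.exp (-s) * s ^ (μ - 1)) ?_ ?_ ?_ ?_
  · filter_upwards [self_mem_nhdsWithin] with y hy
    exact (vgPsi_int (-μ) hy).aestronglyMeasurable
  · filter_upwards [self_mem_nhdsWithin] with y hy
    have hy' : (0:ℝ) < y := hy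
    refine (ae_restrict_iff' measurableSet_Ioi).mpr (Eventually.of_forall fun s hs => ?_)
    have hs' : (0:ℝ) < s := hs
    rw [Real.norm_of_nonneg (by positivity), neg_neg, mul_comm]
    have : 0 ≤ y / s := by positivity
    gcongr
    linarith
  · exact Real.GammaIntegral_convergent hμ
  · refine (ae_restrict_iff' measurableSet_Ioi).mpr (Eventually.of_forall fun s hs => ?_)
    have : ContinuousAt (fun y : ℝ => s ^ (- -μ - 1) * Real.exp (-s - y / s)) 0 := by fun_prop
    have h2 := this.tendsto
    rw [zero_div, sub_zero, neg_neg, mul_comm] at h2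
    rw [neg_neg]
    exact h2.mono_left nhdsWithin_le_nhds

lemma vgPsi_decay (ν : ℝ) {α γ : ℝ} (hγ : 0 ≤ γ) (h : γ < α) :
    ∃ D, 0 ≤ D ∧ ∀ x, 1 ≤ x → vgPsi ν (α ^ 2 * x ^ 2 / 4) ≤ D * Real.exp (-γ * x) := by
  have hα : 0 < α := lt_of_le_of_lt hγ h
  have hq : 0 < 1 - γ ^ 2 / α ^ 2 := by
    rw [sub_pos, div_lt_one (by positivity)]; nlinarith
  obtain ⟨η, hη⟩ : ∃ η, η = (1 - γ ^ 2 / α ^ 2) / 2 := ⟨_, rfl⟩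
  have hη0 : 0 < η := by rw [hη]; positivity
  have hη1 : η < 1 := by
    have : 0 ≤ γ ^ 2 / α ^ 2 := by positivity
    rw [hη]; linarith
  obtain ⟨p, hp⟩ : ∃ p, p = 1 - γ ^ 2 / (α ^ 2 * (1 - η)) := ⟨_, rfl⟩
  have h1η : 0 < 1 - η := by linarith
  have hp0 : 0 < p := by
    rw [hp, sub_pos, div_lt_one (by positivity)]
    have : γ ^ 2 = α ^ 2 * (1 - 2 * η) := by rw [hη]; field_simp; ring
    rw [this]
    have : 0 < α ^ 2 := by positivity
    nlinarith
  have hq0 : 0 < η * α ^ 2 / 4 := by positivity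
  have hI := vgKer_int (-ν - 1) hp0 hq0
  refine ⟨∫ s in Set.Ioi (0:ℝ), s ^ (-ν - 1) * Real.exp (-p * s - (η * α ^ 2 / 4) / s), ?_, ?_⟩
  · apply setIntegral_nonneg measurableSet_Ioi
    intro s hs
    have hs' : (0:ℝ) < s := hs
    positivity
  · intro x hx
    unfold vgPsi
    rw [← integral_mul_const]
    have hx0 : 0 < x := by linarith
    apply setIntegral_mono_on (vgPsi_int ν (by positivity)) (hI.mul_const _) measurableSet_Ioi
    intro s hs
    have hs' : (0:ℝ) < s := hs
    rw [mul_assoc, ← Real.exp_add]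
    gcongr
    have e1 : γ * x ≤ γ ^ 2 / (α ^ 2 * (1 - η)) * s + (1 - η) * (α ^ 2 * x ^ 2 / 4) / s := by
      have : γ ^ 2 / (α ^ 2 * (1 - η)) * s + (1 - η) * (α ^ 2 * x ^ 2 / 4) / s - γ * x
          = (γ / (α ^ 2 * (1 - η)) * s - x / 2) ^ 2 * (α ^ 2 * (1 - η)) / s := by
        field_simp
        ring
      have h2 : 0 ≤ (γ / (α ^ 2 * (1 - η)) * s - x / 2) ^ 2 * (α ^ 2 * (1 - η)) / s := by positivity
      linarith
    have e2 : η * α ^ 2 / 4 / s ≤ η * (α ^ 2 * x ^ 2 / 4) / s := by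
      gcongr
      have : 1 ≤ x ^ 2 := by nlinarith
      have h3 : 0 ≤ η * α ^ 2 / 4 := hq0.le
      nlinarith
    have e3 : α ^ 2 * x ^ 2 / 4 / s = (1 - η) * (α ^ 2 * x ^ 2 / 4) / s + η * (α ^ 2 * x ^ 2 / 4) / s := by
      ring
    rw [hp]
    linarith

lemma gauss_shift_int {b : ℝ} (hb : 0 < b) (β : ℝ) :
    Integrable (fun t : ℝ => Real.exp (β * t - b * t ^ 2)) := by
  have h := ((integrable_exp_neg_mul_sq hb).comp_sub_right (β / (2 * b))).const_mul (Real.exp (β ^ 2 / (4 * b)))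
  refine h.congr (Eventually.of_forall fun t => ?_)
  simp only
  rw [← Real.exp_add]
  congr 1
  field_simp
  ring

lemma gauss_shift {b : ℝ} (hb : 0 < b) (β : ℝ) :
    ∫ t : ℝ, Real.exp (β * t - b * t ^ 2) = Real.exp (β ^ 2 / (4 * b)) * Real.sqrt (Real.pi / b) := by
  rw [← integral_gaussian, ← integral_const_mul,
    ← integral_sub_right_eq_self (fun t => Real.exp (β ^ 2 / (4 * b)) * Real.exp (-b * t ^ 2)) (β / (2 * b))]
  congr 1
  ext t
  rw [← Real.exp_add]
  congr 1
  field_simp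
  ring

/-- the total mass computation -/
lemma vgTot {ν α β : ℝ} (hν : -(1/2) < ν) (hα : 0 < α) (hβ : |β| < α) :
    Integrable (fun t : ℝ => Real.exp (β * t) * vgPsi (-ν) (α ^ 2 * t ^ 2 / 4)) ∧
    ∫ t : ℝ, Real.exp (β * t) * vgPsi (-ν) (α ^ 2 * t ^ 2 / 4) =
      2 * Real.sqrt Real.pi / α * (Real.Gamma (ν + 1/2) * (1 - β ^ 2 / α ^ 2) ^ (-(ν + 1/2))) := by
  have hd : 0 < 1 - β ^ 2 / α ^ 2 := by
    rw [sub_pos, div_lt_one (by positivity)]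
    exact sq_lt_sq' (by linarith [(abs_lt.mp hβ).1]) (abs_lt.mp hβ).2
  obtain ⟨d, hdd⟩ : ∃ d, d = 1 - β ^ 2 / α ^ 2 := ⟨_, rfl⟩
  rw [← hdd] at hd ⊢
  let F : ℝ × ℝ → ℝ := fun p => p.2 ^ (ν - 1) * Real.exp (-p.2) * Real.exp (β * p.1 - α ^ 2 / (4 * p.2) * p.1 ^ 2)
  have hFm : Measurable F := by
    fun_prop
  have hF0 : ∀ t s : ℝ, 0 < s → 0 ≤ F (t, s) := by
    intro t s hs
    simp only [F]
    positivity
  have hin : ∀ s : ℝ, 0 < s → ∫ t, F (t, s) = 2 * Real.sqrt Real.pi / α * (s ^ ((ν + 1/2) - 1) * Real.exp (-(d * s))) := by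
    intro s hs
    simp only [F]
    rw [integral_const_mul, gauss_shift (by positivity)]
    have e1 : Real.sqrt (Real.pi / (α ^ 2 / (4 * s))) = 2 * Real.sqrt Real.pi / α * s ^ (1/2 : ℝ) := by
      rw [← Real.sqrt_eq_rpow, show Real.pi / (α ^ 2 / (4 * s)) = (2 / α) ^ 2 * (Real.pi * s) by field_simp; ring,
        Real.sqrt_mul (by positivity), Real.sqrt_sq (by positivity), Real.sqrt_mul Real.pi_pos.le]
      ring
    have e2 : Real.exp (-(d * s)) = Real.exp (-s) * Real.exp (β ^ 2 / (4 * (α ^ 2 / (4 * s)))) := by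
      rw [← Real.exp_add]
      congr 1
      rw [hdd]
      field_simp
      ring
    rw [e1, e2, show ν + 1/2 - 1 = (ν - 1) + 1/2 by ring, Real.rpow_add hs]
    ring
  have hG : IntegrableOn (fun s : ℝ => 2 * Real.sqrt Real.pi / α * (s ^ ((ν + 1/2) - 1) * Real.exp (-(d * s)))) (Set.Ioi 0) := by
    have h0 := (integrableOn_rpow_mul_exp_neg_mul_rpow (p := 1) (s := (ν + 1/2) - 1) (b := d) (by linarith)
      one_pos hd).const_mul (2 * Real.sqrt Real.pi / α)
    unfold IntegrableOn
    simpa using h0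
  have hFint : Integrable F (volume.prod (volume.restrict (Set.Ioi 0))) := by
    rw [integrable_prod_iff' hFm.aestronglyMeasurable]
    constructor
    · refine (ae_restrict_iff' measurableSet_Ioi).mpr (Eventually.of_forall fun s hs => ?_)
      have hs' : (0:ℝ) < s := hs
      simp only [F]
      exact (gauss_shift_int (by positivity) β).const_mul _
    · refine hG.congr ?_
      refine (ae_restrict_iff' measurableSet_Ioi).mpr (Eventually.of_forall fun s hs => ?_)
      have hs' : (0:ℝ) < s := hs
      simp only
      rw [← hin s hs']
      congr 1
      ext t
      rw [Real.norm_of_nonneg (hF0 t s hs')]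
  have hinner : ∀ t : ℝ, ∫ s in Set.Ioi (0:ℝ), F (t, s) = Real.exp (β * t) * vgPsi (-ν) (α ^ 2 * t ^ 2 / 4) := by
    intro t
    unfold vgPsi
    rw [← integral_const_mul]
    apply setIntegral_congr_fun measurableSet_Ioi
    intro s hs
    have hs' : (0:ℝ) < s := hs
    simp only [F]
    rw [neg_neg, mul_assoc, ← Real.exp_add, mul_left_comm, ← Real.exp_add]
    congr 2
    field_simp
    ring
  constructor
  · have := hFint.integral_prod_left
    simp_rw [hinner] at this
    exact this
  · have h1 := integral_integral_swap (f := fun t s => F (t, s)) hFint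
    simp_rw [hinner] at h1
    rw [h1, setIntegral_congr_fun measurableSet_Ioi (fun s hs => hin s hs), integral_const_mul,
      Real.integral_rpow_mul_exp_neg_mul_Ioi (by linarith) hd, one_div, Real.inv_rpow hd.le, Real.rpow_neg hd.le]
    ring



noncomputable def vi (α ν x : ℝ) : ℝ := (α / 2) ^ ν * vgPhi ν (α ^ 2 * x ^ 2 / 4)
noncomputable def viD (α ν x : ℝ) : ℝ := (α / 2) ^ ν * (α ^ 2 * x / 2) * vgPhi (ν + 1) (α ^ 2 * x ^ 2 / 4)
noncomputable def vk (α ν x : ℝ) : ℝ := 1 / 2 * (α / 2) ^ ν * vgPsi ν (α ^ 2 * x ^ 2 / 4)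
noncomputable def vkD (α ν x : ℝ) : ℝ :=
  1 / 2 * (α / 2) ^ ν * (α ^ 2 * x / 2) * vgPsi (ν + 1) (α ^ 2 * x ^ 2 / 4)

lemma vy_hasDerivAt (α x : ℝ) : HasDerivAt (fun x : ℝ => α ^ 2 * x ^ 2 / 4) (α ^ 2 * x / 2) x := by
  have := ((hasDerivAt_pow 2 x).const_mul (α ^ 2)).div_const 4
  refine this.congr_deriv ?_
  norm_num
  ring

lemma vi_hasDerivAt {ν : ℝ} (hν : -1 < ν) (α x : ℝ) : HasDerivAt (vi α ν) (viD α ν x) x := by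
  have h := ((vgPhi_hasDerivAt hν (α ^ 2 * x ^ 2 / 4)).comp x (vy_hasDerivAt α x)).const_mul ((α / 2) ^ ν)
  refine h.congr_deriv ?_
  unfold viD
  ring

lemma viD_hasDerivAt {ν : ℝ} (hν : -1 < ν) (α : ℝ) {x : ℝ} (hx : 0 < x) :
    HasDerivAt (viD α ν) (α ^ 2 * vi α ν x - (2 * ν + 1) / x * viD α ν x) x := by
  have h1 : HasDerivAt (fun x : ℝ => (α / 2) ^ ν * (α ^ 2 * x / 2)) ((α / 2) ^ ν * (α ^ 2 / 2)) x := by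
    have := (((hasDerivAt_id x).const_mul (α ^ 2)).div_const 2).const_mul ((α / 2) ^ ν)
    refine this.congr_deriv ?_
    ring
  have h2 := (vgPhi_hasDerivAt (ν := ν + 1) (by linarith) (α ^ 2 * x ^ 2 / 4)).comp x (vy_hasDerivAt α x)
  refine (h1.mul h2).congr_deriv ?_
  unfold vi viD
  rw [← vgPhi_rec hν, show ν + 1 + 1 = ν + 2 by ring]
  simp only [Function.comp]
  field_simp
  ring

lemma vk_hasDerivAt (ν : ℝ) {α : ℝ} (hα : 0 < α) {x : ℝ} (hx : 0 < x) :
    HasDerivAt (vk α ν) (-vkD α ν x) x := by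
  have h := ((vgPsi_hasDerivAt ν (y := α ^ 2 * x ^ 2 / 4) (by positivity)).comp x (vy_hasDerivAt α x)).const_mul
    (1 / 2 * (α / 2) ^ ν)
  refine h.congr_deriv ?_
  unfold vkD
  ring

lemma vkD_hasDerivAt (ν : ℝ) {α : ℝ} (hα : 0 < α) {x : ℝ} (hx : 0 < x) :
    HasDerivAt (vkD α ν) (-(α ^ 2 * vk α ν x) - (2 * ν + 1) / x * vkD α ν x) x := by
  have h1 : HasDerivAt (fun x : ℝ => 1 / 2 * (α / 2) ^ ν * (α ^ 2 * x / 2)) (1 / 2 * (α / 2) ^ ν * (α ^ 2 / 2)) x := by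
    have := (((hasDerivAt_id x).const_mul (α ^ 2)).div_const 2).const_mul (1 / 2 * (α / 2) ^ ν)
    refine this.congr_deriv ?_
    ring
  have hy : 0 < α ^ 2 * x ^ 2 / 4 := by positivity
  have h2 := (vgPsi_hasDerivAt (ν + 1) hy).comp x (vy_hasDerivAt α x)
  refine (h1.mul h2).congr_deriv ?_
  unfold vk vkD
  have := vgPsi_rec ν hy
  rw [show vgPsi ν (α ^ 2 * x ^ 2 / 4) = (α ^ 2 * x ^ 2 / 4) * vgPsi (ν + 2) (α ^ 2 * x ^ 2 / 4)
    - (ν + 1) * vgPsi (ν + 1) (α ^ 2 * x ^ 2 / 4) by linarith, show ν + 1 + 1 = ν + 2 by ring]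
  simp only [Function.comp]
  field_simp
  ring

lemma vi_eq (ν : ℝ) {α : ℝ} (hα : 0 < α) {x : ℝ} (hx : 0 < x) :
    besselI ν (α * x) = x ^ ν * vi α ν x := by
  rw [besselI_eq_vgPhi ν (by positivity)]
  unfold vi
  rw [show α * x / 2 = (α / 2) * x by ring, Real.mul_rpow (by positivity) hx.le, mul_pow]
  ring

lemma vk_eq (ν : ℝ) {α : ℝ} (hα : 0 < α) {x : ℝ} (hx : 0 < x) :
    besselK ν (α * x) = x ^ ν * vk α ν x := by
  rw [besselK_eq_vgPsi ν (by positivity)]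
  unfold vk
  rw [show α * x / 2 = (α / 2) * x by ring, Real.mul_rpow (by positivity) hx.le, mul_pow]
  ring

lemma vkD_eq (ν : ℝ) {α : ℝ} (hα : 0 < α) {x : ℝ} (hx : 0 < x) :
    α * besselK (ν + 1) (α * x) = x ^ ν * vkD α ν x := by
  rw [besselK_eq_vgPsi (ν + 1) (by positivity)]
  unfold vkD
  rw [show α * x / 2 = (α / 2) * x by ring, Real.rpow_add_one (by positivity), Real.mul_rpow (by positivity) hx.le, mul_pow]
  ring

lemma vk_pos (ν : ℝ) {α : ℝ} (hα : 0 < α) {x : ℝ} (hx : 0 < x) : 0 < vk α ν x := by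
  have := vgPsi_pos ν (y := α ^ 2 * x ^ 2 / 4) (by positivity)
  unfold vk
  positivity

lemma vkD_ge {ν : ℝ} (hν : -(1/2) < ν) {α : ℝ} (hα : 0 < α) {x : ℝ} (hx : 0 < x) :
    α * vk α ν x ≤ vkD α ν x := by
  have h1 := vk_eq ν hα hx
  have h2 := vkD_eq ν hα hx
  have h3 : besselK ν (α * x) ≤ besselK (ν + 1) (α * x) := by
    apply besselK_mono _ (by positivity)
    rw [abs_of_pos (show 0 < ν + 1 by linarith), abs_le]
    constructor <;> linarith
  have hp : 0 < x ^ ν := by positivity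
  have h4 : x ^ ν * (α * vk α ν x) ≤ x ^ ν * vkD α ν x := by
    rw [← h2, mul_left_comm, ← h1]
    gcongr
  exact le_of_mul_le_mul_left h4 hp

lemma vkD_pos {ν : ℝ} (hν : -(1/2) < ν) {α : ℝ} (hα : 0 < α) {x : ℝ} (hx : 0 < x) : 0 < vkD α ν x := by
  have := vgPsi_pos (ν + 1) (y := α ^ 2 * x ^ 2 / 4) (by positivity)
  unfold vkD
  positivity

noncomputable def vi0 (α ν : ℝ) : ℝ := (α / 2) ^ ν / Real.Gamma (ν + 1)

lemma vi0_pos {ν : ℝ} (hν : -(1/2) < ν) {α : ℝ} (hα : 0 < α) : 0 < vi0 α ν := by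
  have := Real.Gamma_pos_of_pos (show 0 < ν + 1 by linarith)
  unfold vi0
  positivity

lemma vi_zero (α ν : ℝ) : vi α ν 0 = vi0 α ν := by
  unfold vi vi0
  have : α ^ 2 * (0:ℝ) ^ 2 / 4 = 0 := by ring
  rw [this, vgPhi_zero]
  ring

lemma vi_ge {ν : ℝ} (hν : -(1/2) < ν) {α : ℝ} (hα : 0 < α) (x : ℝ) : vi0 α ν ≤ vi α ν x := by
  unfold vi vi0
  have := vgPhi_ge (ν := ν) (by linarith) (y := α ^ 2 * x ^ 2 / 4) (by positivity)
  rw [div_eq_mul_one_div]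
  gcongr

lemma vi_pos {ν : ℝ} (hν : -(1/2) < ν) {α : ℝ} (hα : 0 < α) (x : ℝ) : 0 < vi α ν x :=
  lt_of_lt_of_le (vi0_pos hν hα) (vi_ge hν hα x)

lemma viD_nonneg {ν : ℝ} (hν : -(1/2) < ν) {α : ℝ} (hα : 0 < α) {x : ℝ} (hx : 0 ≤ x) : 0 ≤ viD α ν x := by
  unfold viD
  have := vgPhi_pos (ν := ν + 1) (by linarith) (y := α ^ 2 * x ^ 2 / 4) (by positivity)
  positivity

lemma vi_cont {ν : ℝ} (hν : -(1/2) < ν) (α : ℝ) : Continuous (vi α ν) :=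
  continuous_iff_continuousAt.mpr fun x => (vi_hasDerivAt (by linarith) α x).continuousAt

lemma viD_cont {ν : ℝ} (hν : -(1/2) < ν) (α : ℝ) : Continuous (viD α ν) := by
  unfold viD
  have h : Continuous (vgPhi (ν + 1)) :=
    continuous_iff_continuousAt.mpr fun x => (vgPhi_hasDerivAt (by linarith) x).continuousAt
  fun_prop

lemma viD_zero (α ν : ℝ) : viD α ν 0 = 0 := by
  unfold viD; simp

lemma vk_contOn (ν : ℝ) {α : ℝ} (hα : 0 < α) : ContinuousOn (vk α ν) (Set.Ioi 0) :=
  fun _ hx => (vk_hasDerivAt ν hα hx).continuousAt.continuousWithinAt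

lemma vkD_contOn (ν : ℝ) {α : ℝ} (hα : 0 < α) : ContinuousOn (vkD α ν) (Set.Ioi 0) :=
  fun _ hx => (vkD_hasDerivAt ν hα hx).continuousAt.continuousWithinAt

/-- `t^(2ν) k(t)` in terms of `Ψ_{-ν}` -/
lemma vk_symm (ν : ℝ) {α : ℝ} (hα : 0 < α) {x : ℝ} (hx : 0 < x) :
    x ^ (2 * ν) * vk α ν x = 1 / 2 * (α / 2) ^ (-ν) * vgPsi (-ν) (α ^ 2 * x ^ 2 / 4) := by
  rw [← vgPsi_symm ν (show 0 < α ^ 2 * x ^ 2 / 4 by positivity)]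
  unfold vk
  have e : (α ^ 2 * x ^ 2 / 4) ^ ν = (α / 2) ^ ν * (α / 2) ^ ν * x ^ (2 * ν) := by
    rw [show α ^ 2 * x ^ 2 / 4 = (α / 2) * (α / 2) * x ^ 2 by ring, Real.mul_rpow (by positivity) (by positivity),
      Real.mul_rpow (by positivity) (by positivity), ← Real.rpow_natCast_mul hx.le]
    norm_num
  rw [e, Real.rpow_neg (by positivity)]
  have : (α / 2) ^ ν ≠ 0 := by positivity
  field_simp

lemma vkD_symm (ν : ℝ) {α : ℝ} (hα : 0 < α) {x : ℝ} (hx : 0 < x) :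
    x ^ (2 * ν + 1) * vkD α ν x = (α / 2) ^ (-ν) * vgPsi (-(ν + 1)) (α ^ 2 * x ^ 2 / 4) := by
  rw [← vgPsi_symm (ν + 1) (show 0 < α ^ 2 * x ^ 2 / 4 by positivity)]
  unfold vkD
  have e : (α ^ 2 * x ^ 2 / 4) ^ (ν + 1) = (α / 2) ^ ν * (α / 2) ^ ν * (α ^ 2 / 4) * x ^ (2 * ν + 1) * x := by
    rw [Real.rpow_add_one (by positivity), show α ^ 2 * x ^ 2 / 4 = (α / 2) * (α / 2) * x ^ 2 by ring, Real.mul_rpow (by positivity) (by positivity),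
      Real.mul_rpow (by positivity) (by positivity), ← Real.rpow_natCast_mul hx.le, Real.rpow_add_one hx.ne']
    push_cast
    ring
  rw [e, Real.rpow_neg (by positivity)]
  have : (α / 2) ^ ν ≠ 0 := by positivity
  field_simp
  ring

lemma vkD_limit {ν : ℝ} (hν : -(1/2) < ν) {α : ℝ} (hα : 0 < α) :
    Tendsto (fun x => x ^ (2 * ν + 1) * vkD α ν x) (nhdsWithin 0 (Set.Ioi 0)) (nhds (1 / vi0 α ν)) := by
  have h1 : Tendsto (fun x : ℝ => α ^ 2 * x ^ 2 / 4) (nhdsWithin 0 (Set.Ioi 0)) (nhdsWithin 0 (Set.Ioi 0)) := by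
    apply tendsto_nhdsWithin_of_tendsto_nhds_of_eventually_within
    · have : ContinuousAt (fun x : ℝ => α ^ 2 * x ^ 2 / 4) 0 := by fun_prop
      have h := this.tendsto
      simp only [ne_eq, OfNat.ofNat_ne_zero, not_false_eq_true, zero_pow, mul_zero, zero_div] at h
      exact h.mono_left nhdsWithin_le_nhds
    · filter_upwards [self_mem_nhdsWithin] with x hx
      have hx' : (0:ℝ) < x := hx
      exact Set.mem_Ioi.mpr (by positivity)
  have h2 := ((vgPsi_neg_tendsto (show 0 < ν + 1 by linarith)).comp h1).const_mul ((α / 2) ^ (-ν))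
  have e : (α / 2) ^ (-ν) * Real.Gamma (ν + 1) = 1 / vi0 α ν := by
    unfold vi0
    rw [Real.rpow_neg (by positivity)]
    field_simp
  rw [e] at h2
  refine h2.congr' ?_
  filter_upwards [self_mem_nhdsWithin] with x hx
  rw [vkD_symm ν hα hx]
  rfl

/-- `x^r k(x) → 0`-type statement: bounded times small. -/
lemma vk_limit {ν : ℝ} (hν : -(1/2) < ν) {α : ℝ} (hα : 0 < α) {g : ℝ → ℝ}
    (hg : Tendsto g (nhdsWithin 0 (Set.Ioi 0)) (nhds 0)) :
    Tendsto (fun x => g x * (x ^ (2 * ν + 1) * vk α ν x)) (nhdsWithin 0 (Set.Ioi 0)) (nhds 0) := by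
  have h1 := (hg.abs.mul ((vkD_limit hν hα).mul_const (1 / α)))
  rw [abs_zero, zero_mul] at h1
  refine squeeze_zero_norm' ?_ h1
  filter_upwards [self_mem_nhdsWithin] with x hx
  have hx' : (0:ℝ) < x := hx
  have hk := vk_pos ν hα hx'
  have h2 := vkD_ge hν hα hx'
  rw [norm_mul, Real.norm_eq_abs, Real.norm_of_nonneg (by positivity)]
  have h3 : vk α ν x ≤ vkD α ν x * (1 / α) := by
    rw [mul_one_div, le_div_iff₀ hα]
    linarith
  have h4 : x ^ (2 * ν + 1) * vk α ν x ≤ x ^ (2 * ν + 1) * vkD α ν x * (1 / α) := by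
    rw [mul_assoc]
    gcongr
  gcongr

/-- The Wronskian. -/
lemma vWronsk {ν : ℝ} (hν : -(1/2) < ν) {α : ℝ} (hα : 0 < α) {x : ℝ} (hx : 0 < x) :
    x ^ (2 * ν + 1) * (viD α ν x * vk α ν x + vi α ν x * vkD α ν x) = 1 := by
  let W : ℝ → ℝ := fun x => x ^ (2 * ν + 1) * (viD α ν x * vk α ν x + vi α ν x * vkD α ν x)
  have hd : ∀ z ∈ Set.Ioi (0:ℝ), HasDerivAt W 0 z := by
    intro z hz
    have hz' : (0:ℝ) < z := hz
    have hn : -1 < ν := by linarith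
    have h1 : HasDerivAt (fun x : ℝ => x ^ (2 * ν + 1)) ((2 * ν + 1) * z ^ (2 * ν + 1 - 1)) z :=
      Real.hasDerivAt_rpow_const (Or.inl hz'.ne')
    have h2 := ((viD_hasDerivAt hn α hz').mul (vk_hasDerivAt ν hα hz')).add
      ((vi_hasDerivAt hn α z).mul (vkD_hasDerivAt ν hα hz'))
    refine (h1.mul h2).congr_deriv ?_
    rw [Real.rpow_sub_one hz'.ne']
    simp only [Pi.add_apply, Pi.mul_apply]
    field_simp
    ring
  have hconst : ∀ z ∈ Set.Ioi (0:ℝ), W z = W x := by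
    intro z hz
    exact (isOpen_Ioi.is_const_of_deriv_eq_zero isPreconnected_Ioi
      (fun w hw => (hd w hw).differentiableAt.differentiableWithinAt)
      (fun w hw => (hd w hw).deriv)) hz hx
  have hl : Tendsto W (nhdsWithin 0 (Set.Ioi 0)) (nhds 1) := by
    have a1 : Tendsto (viD α ν) (nhdsWithin 0 (Set.Ioi 0)) (nhds 0) := by
      have := (viD_cont hν α).tendsto 0
      rw [viD_zero] at this
      exact this.mono_left nhdsWithin_le_nhds
    have a2 : Tendsto (vi α ν) (nhdsWithin 0 (Set.Ioi 0)) (nhds (vi0 α ν)) := by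
      have := (vi_cont hν α).tendsto 0
      rw [vi_zero] at this
      exact this.mono_left nhdsWithin_le_nhds
    have h := (vk_limit hν hα a1).add (a2.mul (vkD_limit hν hα))
    rw [zero_add, mul_one_div_cancel (vi0_pos hν hα).ne'] at h
    refine h.congr (fun z => ?_)
    simp only [W]
    ring
  have hl2 : Tendsto W (nhdsWithin 0 (Set.Ioi 0)) (nhds (W x)) := by
    refine tendsto_const_nhds.congr' ?_
    filter_upwards [self_mem_nhdsWithin] with z hz
    exact (hconst z hz).symm
  exact tendsto_nhds_unique hl2 hl



noncomputable def vP (α ν β x : ℝ) (g : ℝ → ℝ) : ℝ :=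
  ∫ t in (0:ℝ)..x, t ^ (2 * ν) * (Real.exp (β * t) * vi α ν t * g t)
noncomputable def vQ (α ν β x : ℝ) (g : ℝ → ℝ) : ℝ :=
  ∫ t in Set.Ioi x, t ^ (2 * ν) * (Real.exp (β * t) * vk α ν t * g t)

lemma rpow_int {ν : ℝ} (hν : -(1/2) < ν) {G : ℝ → ℝ} (hG : Continuous G) (a x : ℝ) :
    IntervalIntegrable (fun t => t ^ (2 * ν) * G t) volume a x :=
  (intervalIntegral.intervalIntegrable_rpow' (by linarith)).mul_continuousOn hG.continuousOn

lemma vP_int {ν : ℝ} (hν : -(1/2) < ν) (α β a x : ℝ) {g : ℝ → ℝ} (hg : Continuous g) :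
    IntervalIntegrable (fun t => t ^ (2 * ν) * (Real.exp (β * t) * vi α ν t * g t)) volume a x := by
  have := vi_cont hν α
  exact rpow_int hν (by fun_prop) a x

lemma vP_ftc {ν : ℝ} (hν : -(1/2) < ν) {x : ℝ} (hx : 0 < x) {G g : ℝ → ℝ} (hG : Continuous G) (hg : Continuous g)
    (hd : ∀ t, 0 < t → HasDerivAt (fun t => t ^ (2 * ν + 1) * G t) (t ^ (2 * ν) * g t) t) :
    ∫ t in (0:ℝ)..x, t ^ (2 * ν) * g t = x ^ (2 * ν + 1) * G x := by
  rw [intervalIntegral.integral_eq_sub_of_hasDerivAt_of_le hx.le (f := fun t => t ^ (2 * ν + 1) * G t) ?_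
    (fun t ht => hd t ht.1) (rpow_int hν hg 0 x)]
  · rw [Real.zero_rpow (by linarith)]
    ring
  · apply Continuous.continuousOn
    exact (Real.continuous_rpow_const (by linarith)).mul hG

lemma vP_add {ν : ℝ} (hν : -(1/2) < ν) (α β x : ℝ) {g₁ g₂ : ℝ → ℝ} (h1 : Continuous g₁) (h2 : Continuous g₂) :
    vP α ν β x (fun t => g₁ t + g₂ t) = vP α ν β x g₁ + vP α ν β x g₂ := by
  unfold vP
  rw [← intervalIntegral.integral_add (vP_int hν α β 0 x h1) (vP_int hν α β 0 x h2)]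
  congr 1; ext t; ring

lemma vP_smul (α ν β x c : ℝ) (g : ℝ → ℝ) :
    vP α ν β x (fun t => c * g t) = c * vP α ν β x g := by
  unfold vP
  rw [← intervalIntegral.integral_const_mul]
  congr 1; ext t; ring

lemma vP_mono {ν : ℝ} (hν : -(1/2) < ν) {α : ℝ} (hα : 0 < α) (β : ℝ) {x : ℝ} (hx : 0 < x) {g₁ g₂ : ℝ → ℝ}
    (h1 : Continuous g₁) (h2 : Continuous g₂) (h : ∀ t, 0 < t → t ≤ x → g₁ t ≤ g₂ t) :
    vP α ν β x g₁ ≤ vP α ν β x g₂ := by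
  unfold vP
  apply intervalIntegral.integral_mono_on_of_le_Ioo hx.le (vP_int hν α β 0 x h1) (vP_int hν α β 0 x h2)
  intro t ht
  have := vi_pos hν hα t
  have h0 := ht.1
  have := h t ht.1 ht.2.le
  gcongr

lemma vP_abs {ν : ℝ} (hν : -(1/2) < ν) {α : ℝ} (hα : 0 < α) (β : ℝ) {x : ℝ} (hx : 0 < x) {g₁ g₂ : ℝ → ℝ}
    (h1 : Continuous g₁) (h2 : Continuous g₂) (h : ∀ t, 0 < t → t ≤ x → |g₁ t| ≤ g₂ t) :
    |vP α ν β x g₁| ≤ vP α ν β x g₂ := by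
  rw [abs_le]
  constructor
  · have := vP_mono hν hα β hx (g₁ := fun t => (-1) * g₂ t) (by fun_prop) h1
      (fun t ht htx => by have := (abs_le.mp (h t ht htx)).1; linarith)
    rw [vP_smul] at this
    linarith
  · exact vP_mono hν hα β hx h1 h2 (fun t ht htx => (abs_le.mp (h t ht htx)).2)

lemma vk_decay (ν : ℝ) {α γ : ℝ} (hγ : 0 ≤ γ) (h : γ < α) :
    ∃ D, 0 ≤ D ∧ ∀ x, 1 ≤ x → vk α ν x ≤ D * Real.exp (-γ * x) := by
  obtain ⟨D, hD, hD2⟩ := vgPsi_decay ν hγ h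
  have hα : 0 < α := lt_of_le_of_lt hγ h
  refine ⟨1 / 2 * (α / 2) ^ ν * D, by positivity, fun x hx => ?_⟩
  unfold vk
  rw [mul_assoc _ D]
  gcongr
  exact hD2 x hx

lemma vkD_decay (ν : ℝ) {α γ : ℝ} (hγ : 0 ≤ γ) (h : γ < α) :
    ∃ D, 0 ≤ D ∧ ∀ x, 1 ≤ x → vkD α ν x ≤ D * (x * Real.exp (-γ * x)) := by
  obtain ⟨D, hD, hD2⟩ := vgPsi_decay (ν + 1) hγ h
  have hα : 0 < α := lt_of_le_of_lt hγ h
  refine ⟨1 / 2 * (α / 2) ^ ν * (α ^ 2 / 2) * D, by positivity, fun x hx => ?_⟩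
  unfold vkD
  have := hD2 x hx
  have hx0 : 0 < x := by linarith
  calc 1 / 2 * (α / 2) ^ ν * (α ^ 2 * x / 2) * vgPsi (ν + 1) (α ^ 2 * x ^ 2 / 4)
      ≤ 1 / 2 * (α / 2) ^ ν * (α ^ 2 * x / 2) * (D * Real.exp (-γ * x)) := by gcongr
    _ = _ := by ring

lemma vk_atTop (ν p : ℝ) {α β : ℝ} (hβ : |β| < α) :
    Tendsto (fun t => t ^ p * (Real.exp (β * t) * vk α ν t)) atTop (nhds 0) := by
  have hα : 0 < α := lt_of_le_of_lt (abs_nonneg β) hβ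
  have hb := le_abs_self β
  have hb0 := abs_nonneg β
  obtain ⟨D, hD, hD2⟩ := vk_decay ν (show 0 ≤ (|β| + α) / 2 by positivity) (show (|β| + α) / 2 < α by linarith)
  have h := (tendsto_rpow_mul_exp_neg_mul_atTop_nhds_zero p ((|β| + α) / 2 - β) (by linarith)).const_mul D
  rw [mul_zero] at h
  refine squeeze_zero' ?_ ?_ h
  · filter_upwards [eventually_ge_atTop 1] with t ht
    have := vk_pos ν hα (show 0 < t by linarith)
    positivity
  · filter_upwards [eventually_ge_atTop 1] with t ht
    have h0 : 0 < t := by linarith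
    calc t ^ p * (Real.exp (β * t) * vk α ν t) ≤ t ^ p * (Real.exp (β * t) * (D * Real.exp (-((|β| + α) / 2) * t))) := by
          gcongr; exact hD2 t ht
      _ = _ := by
          rw [show -((|β| + α) / 2 - β) * t = β * t + -((|β| + α) / 2) * t by ring, Real.exp_add]; ring

lemma vkD_atTop {ν : ℝ} (hν : -(1/2) < ν) (p : ℝ) {α β : ℝ} (hβ : |β| < α) :
    Tendsto (fun t => t ^ p * (Real.exp (β * t) * vkD α ν t)) atTop (nhds 0) := by
  have hα : 0 < α := lt_of_le_of_lt (abs_nonneg β) hβ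
  have hb := le_abs_self β
  have hb0 := abs_nonneg β
  obtain ⟨D, hD, hD2⟩ := vkD_decay ν (show 0 ≤ (|β| + α) / 2 by positivity) (show (|β| + α) / 2 < α by linarith)
  have h := (tendsto_rpow_mul_exp_neg_mul_atTop_nhds_zero (p + 1) ((|β| + α) / 2 - β) (by linarith)).const_mul D
  rw [mul_zero] at h
  refine squeeze_zero' ?_ ?_ h
  · filter_upwards [eventually_ge_atTop 1] with t ht
    have := vkD_pos hν hα (show 0 < t by linarith)
    positivity
  · filter_upwards [eventually_ge_atTop 1] with t ht
    have h0 : 0 < t := by linarith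
    calc t ^ p * (Real.exp (β * t) * vkD α ν t) ≤ t ^ p * (Real.exp (β * t) * (D * (t * Real.exp (-((|β| + α) / 2) * t)))) := by
          gcongr; exact hD2 t ht
      _ = _ := by
          rw [show -((|β| + α) / 2 - β) * t = β * t + -((|β| + α) / 2) * t by ring, Real.exp_add, Real.rpow_add_one h0.ne']; ring

lemma vQ_int0 {ν : ℝ} (hν : -(1/2) < ν) {α β : ℝ} (hβ : |β| < α) {g : ℝ → ℝ} (hg : Continuous g) {c : ℝ}
    (hc : ∀ t, 0 < t → |g t| ≤ c * (1 + t) ^ 2) :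
    IntegrableOn (fun t => t ^ (2 * ν) * (Real.exp (β * t) * vk α ν t * g t)) (Set.Ioi 0) := by
  have hα : 0 < α := lt_of_le_of_lt (abs_nonneg β) hβ
  have hb := le_abs_self β
  have hb0 := abs_nonneg β
  have hc0 : 0 ≤ c := by
    have := (abs_nonneg _).trans (hc 1 one_pos)
    norm_num at this
    linarith
  obtain ⟨γ, hγ⟩ : ∃ γ, γ = (|β| + α) / 2 := ⟨_, rfl⟩
  have hγα : |γ| < α := by rw [hγ, abs_of_nonneg (by positivity)]; linarith
  have hδ : 0 < γ - β := by rw [hγ]; linarith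
  have h1 := ((vgTot hν hα hγα).1.const_mul (c * (1 + 2 / (γ - β)) ^ 2 * (1 / 2 * (α / 2) ^ (-ν)))).integrableOn (s := Set.Ioi 0)
  refine Integrable.mono' h1 ?_ ?_
  · apply ContinuousOn.aestronglyMeasurable _ measurableSet_Ioi
    have hr : ContinuousOn (fun t : ℝ => t ^ (2 * ν)) (Set.Ioi 0) := fun t ht =>
      (Real.continuousAt_rpow_const _ _ (Or.inl (ne_of_gt ht))).continuousWithinAt
    have hk := vk_contOn ν hα
    exact hr.mul (((by fun_prop : ContinuousOn (fun t : ℝ => Real.exp (β * t)) (Set.Ioi 0)).mul hk).mul hg.continuousOn)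
  · refine (ae_restrict_iff' measurableSet_Ioi).mpr (Eventually.of_forall fun t ht => ?_)
    have ht' : (0:ℝ) < t := ht
    have hk := vk_pos ν hα ht'
    rw [norm_mul, norm_mul, Real.norm_of_nonneg (by positivity), Real.norm_of_nonneg (by positivity), Real.norm_eq_abs]
    have e1 : t ^ (2 * ν) * (Real.exp (β * t) * vk α ν t * |g t|)
      = (t ^ (2 * ν) * vk α ν t) * (Real.exp (β * t) * |g t|) := by ring
    rw [e1, vk_symm ν hα ht']
    have hp := vgPsi_pos (-ν) (show 0 < α ^ 2 * t ^ 2 / 4 by positivity)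
    have e2 : Real.exp (β * t) * |g t| ≤ Real.exp (γ * t) * (c * (1 + 2 / (γ - β)) ^ 2) := by
      have : 1 + t ≤ (1 + 2 / (γ - β)) * Real.exp ((γ - β) * t / 2) := by
        have a1 := Real.add_one_le_exp ((γ - β) * t / 2)
        have a2 : 0 ≤ (γ - β) * t / 2 := by positivity
        have a3 : t = 2 / (γ - β) * ((γ - β) * t / 2) := by field_simp
        have a4 : 0 < 2 / (γ - β) := by positivity
        have a5 : 2 / (γ - β) * ((γ - β) * t / 2) ≤ 2 / (γ - β) * Real.exp ((γ - β) * t / 2) := by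
          apply mul_le_mul_of_nonneg_left _ a4.le
          linarith
        linarith
      calc Real.exp (β * t) * |g t| ≤ Real.exp (β * t) * (c * ((1 + 2 / (γ - β)) * Real.exp ((γ - β) * t / 2)) ^ 2) := by
            gcongr
            exact (hc t ht').trans (by gcongr)
        _ = _ := by
            rw [show γ * t = β * t + ((γ - β) * t / 2 + (γ - β) * t / 2) by ring, Real.exp_add, Real.exp_add]; ring
    calc 1 / 2 * (α / 2) ^ (-ν) * vgPsi (-ν) (α ^ 2 * t ^ 2 / 4) * (Real.exp (β * t) * |g t|)
        ≤ 1 / 2 * (α / 2) ^ (-ν) * vgPsi (-ν) (α ^ 2 * t ^ 2 / 4) * (Real.exp (γ * t) * (c * (1 + 2 / (γ - β)) ^ 2)) := by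
          gcongr
      _ = _ := by ring

def LinGrowth (g : ℝ → ℝ) : Prop := Continuous g ∧ ∃ c, ∀ t, 0 < t → |g t| ≤ c * (1 + t) ^ 2

lemma LinGrowth.add {g₁ g₂ : ℝ → ℝ} (h1 : LinGrowth g₁) (h2 : LinGrowth g₂) : LinGrowth (fun t => g₁ t + g₂ t) := by
  obtain ⟨a, c, ha⟩ := h1
  obtain ⟨b, d, hb⟩ := h2
  refine ⟨a.add b, c + d, fun t ht => ?_⟩
  have := abs_add_le (g₁ t) (g₂ t)
  linarith [ha t ht, hb t ht]

lemma LinGrowth.smul {g : ℝ → ℝ} (h1 : LinGrowth g) (k : ℝ) : LinGrowth (fun t => k * g t) := by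
  obtain ⟨a, c, ha⟩ := h1
  refine ⟨by fun_prop, |k| * c, fun t ht => ?_⟩
  rw [abs_mul, mul_assoc]
  have := ha t ht
  gcongr

lemma linGrowth_one : LinGrowth (fun _ => 1) := ⟨by fun_prop, 1, fun t ht => by rw [abs_one]; nlinarith⟩
lemma linGrowth_id : LinGrowth (fun t => t) :=
  ⟨by fun_prop, 1, fun t ht => by rw [abs_of_pos ht]; nlinarith⟩
lemma linGrowth_sq : LinGrowth (fun t => t ^ 2) :=
  ⟨by fun_prop, 1, fun t ht => by rw [abs_of_pos (by positivity)]; nlinarith⟩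

lemma vQ_int {ν : ℝ} (hν : -(1/2) < ν) {α β : ℝ} (hβ : |β| < α) {g : ℝ → ℝ} (hg : LinGrowth g) {x : ℝ} (hx : 0 ≤ x) :
    IntegrableOn (fun t => t ^ (2 * ν) * (Real.exp (β * t) * vk α ν t * g t)) (Set.Ioi x) := by
  obtain ⟨c, hc⟩ := hg.2
  exact (vQ_int0 hν hβ hg.1 hc).mono_set (Set.Ioi_subset_Ioi hx)

lemma vQ_add {ν : ℝ} (hν : -(1/2) < ν) {α β : ℝ} (hβ : |β| < α) {g₁ g₂ : ℝ → ℝ} (h1 : LinGrowth g₁) (h2 : LinGrowth g₂)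
    {x : ℝ} (hx : 0 ≤ x) :
    vQ α ν β x (fun t => g₁ t + g₂ t) = vQ α ν β x g₁ + vQ α ν β x g₂ := by
  unfold vQ
  rw [← integral_add (vQ_int hν hβ h1 hx) (vQ_int hν hβ h2 hx)]
  congr 1; ext t; ring

lemma vQ_smul (α ν β x c : ℝ) (g : ℝ → ℝ) :
    vQ α ν β x (fun t => c * g t) = c * vQ α ν β x g := by
  unfold vQ
  rw [← integral_const_mul]
  congr 1; ext t; ring

lemma vQ_mono {ν : ℝ} (hν : -(1/2) < ν) {α β : ℝ} (hβ : |β| < α) {g₁ g₂ : ℝ → ℝ} (h1 : LinGrowth g₁) (h2 : LinGrowth g₂)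
    {x : ℝ} (hx : 0 ≤ x) (h : ∀ t, x < t → g₁ t ≤ g₂ t) :
    vQ α ν β x g₁ ≤ vQ α ν β x g₂ := by
  have hα : 0 < α := lt_of_le_of_lt (abs_nonneg β) hβ
  unfold vQ
  apply setIntegral_mono_on (vQ_int hν hβ h1 hx) (vQ_int hν hβ h2 hx) measurableSet_Ioi
  intro t ht
  have h0 : 0 < t := lt_of_le_of_lt hx ht
  have := vk_pos ν hα h0
  have := h t ht
  gcongr

lemma vQ_abs {ν : ℝ} (hν : -(1/2) < ν) {α β : ℝ} (hβ : |β| < α) {g₁ g₂ : ℝ → ℝ} (h1 : LinGrowth g₁) (h2 : LinGrowth g₂)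
    {x : ℝ} (hx : 0 ≤ x) (h : ∀ t, x < t → |g₁ t| ≤ g₂ t) :
    |vQ α ν β x g₁| ≤ vQ α ν β x g₂ := by
  rw [abs_le]
  constructor
  · have := vQ_mono hν hβ (h2.smul (-1)) h1 hx
      (fun t ht => by have := (abs_le.mp (h t ht)).1; linarith)
    rw [vQ_smul] at this
    linarith
  · exact vQ_mono hν hβ h1 h2 hx (fun t ht => (abs_le.mp (h t ht)).2)



lemma mulrpow_hasDerivAt (ν : ℝ) {t : ℝ} (ht : 0 < t) {G : ℝ → ℝ} {G' g : ℝ} (hG : HasDerivAt G G' t)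
    (hg : (2 * ν + 1) * G t + t * G' = g) :
    HasDerivAt (fun t => t ^ (2 * ν + 1) * G t) (t ^ (2 * ν) * g) t := by
  have h1 : HasDerivAt (fun x : ℝ => x ^ (2 * ν + 1)) ((2 * ν + 1) * t ^ (2 * ν + 1 - 1)) t :=
    Real.hasDerivAt_rpow_const (Or.inl ht.ne')
  refine (h1.mul hG).congr_deriv ?_
  rw [← hg, show 2 * ν + 1 - 1 = 2 * ν by ring, Real.rpow_add_one ht.ne']
  ring

lemma hasDerivAt_expmul (c t : ℝ) : HasDerivAt (fun t : ℝ => Real.exp (c * t)) (c * Real.exp (c * t)) t := by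
  have := ((hasDerivAt_id t).const_mul c).exp
  refine this.congr_deriv ?_
  simp only [id, mul_one]
  ring

/-- identity (A) for arbitrary exponent, in integral form -/
lemma vP_A' {ν : ℝ} (hν : -(1/2) < ν) (α c : ℝ) {x : ℝ} (hx : 0 < x) :
    vP α ν c x (fun t => (2 * ν + 1) * c - (α ^ 2 - c ^ 2) * t) =
      x ^ (2 * ν + 1) * (Real.exp (c * x) * (c * vi α ν x - viD α ν x)) := by
  have ci := vi_cont hν α
  have cd := viD_cont hν α
  unfold vP
  refine vP_ftc hν hx (G := fun t => Real.exp (c * t) * (c * vi α ν t - viD α ν t)) (by fun_prop) (by fun_prop) ?_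
  intro t ht
  have h := (hasDerivAt_expmul c t).mul (((vi_hasDerivAt (by linarith : -1 < ν) α t).const_mul c).sub
    (viD_hasDerivAt (by linarith : -1 < ν) α ht))
  refine mulrpow_hasDerivAt ν ht h ?_
  simp only [Pi.sub_apply]
  field_simp
  ring

lemma vP_C' {ν : ℝ} (hν : -(1/2) < ν) (α c : ℝ) {x : ℝ} (hx : 0 < x) :
    vP α ν c x (fun t => (2 * ν + 1) + 2 * c * t + ((2 * ν + 1) * c - (α ^ 2 - c ^ 2) * t) * (t - x)) =
      x ^ (2 * ν + 1) * (Real.exp (c * x) * vi α ν x) := by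
  have ci := vi_cont hν α
  have cd := viD_cont hν α
  unfold vP
  rw [vP_ftc hν hx (G := fun t => Real.exp (c * t) * (vi α ν t + (t - x) * (c * vi α ν t - viD α ν t))) (by fun_prop) (by fun_prop)]
  · ring
  intro t ht
  have h := (hasDerivAt_expmul c t).mul ((vi_hasDerivAt (by linarith : -1 < ν) α t).add
    (((hasDerivAt_id t).sub_const x).mul (((vi_hasDerivAt (by linarith : -1 < ν) α t).const_mul c).sub
    (viD_hasDerivAt (by linarith : -1 < ν) α ht))))
  refine mulrpow_hasDerivAt ν ht h ?_
  simp only [Pi.sub_apply, Pi.add_apply, Pi.mul_apply, id]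
  field_simp
  ring

lemma vP_E' {ν : ℝ} (hν : -(1/2) < ν) {α : ℝ} (hα : 0 < α) (c : ℝ) {x : ℝ} (hx : 0 < x) :
    vP α ν c x (fun t => (2 * ν + 1) + c * t) ≤ x ^ (2 * ν + 1) * (Real.exp (c * x) * vi α ν x) := by
  have ci := vi_cont hν α
  have cd := viD_cont hν α
  have h := vP_ftc hν hx (G := fun t => Real.exp (c * t) * vi α ν t)
    (g := fun t => Real.exp (c * t) * ((2 * ν + 1 + c * t) * vi α ν t + t * viD α ν t)) (by fun_prop) (by fun_prop) ?_
  · rw [← h]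
    unfold vP
    apply intervalIntegral.integral_mono_on_of_le_Ioo hx.le (vP_int hν α c 0 x (by fun_prop)) (rpow_int hν (by fun_prop) 0 x)
    intro t ht
    have h0 := ht.1
    have := viD_nonneg hν hα h0.le
    rw [mul_assoc]
    gcongr
    have : 0 ≤ t * viD α ν t := by positivity
    linarith
  · intro t ht
    have h := (hasDerivAt_expmul c t).mul (vi_hasDerivAt (by linarith : -1 < ν) α t)
    refine mulrpow_hasDerivAt ν ht h ?_
    ring

lemma vP_F' {ν : ℝ} (hν : -(1/2) < ν) {α : ℝ} (hα : 0 < α) (c : ℝ) {x : ℝ} (hx : 0 < x) :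
    vP α ν c x (fun t => (2 * ν + 1) * (x - t) - t + c * (t * (x - t))) ≤ 0 := by
  have ci := vi_cont hν α
  have cd := viD_cont hν α
  have h := vP_ftc hν hx (G := fun t => (x - t) * (Real.exp (c * t) * vi α ν t))
    (g := fun t => Real.exp (c * t) * (((2 * ν + 1) * (x - t) - t + c * (t * (x - t))) * vi α ν t + t * (x - t) * viD α ν t)) (by fun_prop) (by fun_prop) ?_
  · have e : x ^ (2 * ν + 1) * ((x - x) * (Real.exp (c * x) * vi α ν x)) = 0 := by ring
    rw [← e, ← h]
    unfold vP
    apply intervalIntegral.integral_mono_on_of_le_Ioo hx.le (vP_int hν α c 0 x (by fun_prop)) (rpow_int hν (by fun_prop) 0 x)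
    intro t ht
    have h0 := ht.1
    have h1 : 0 < x - t := by linarith [ht.2]
    have := viD_nonneg hν hα h0.le
    rw [mul_assoc]
    gcongr
    have : 0 ≤ t * (x - t) * viD α ν t := by positivity
    linarith
  · intro t ht
    have h := ((hasDerivAt_id t).const_sub x).mul ((hasDerivAt_expmul c t).mul (vi_hasDerivAt (by linarith : -1 < ν) α t))
    refine mulrpow_hasDerivAt ν ht h ?_
    simp only [id, Pi.mul_apply]
    ring

lemma vQ_ftc {ν : ℝ} {x : ℝ} (hx : 0 < x) {G g : ℝ → ℝ}
    (hd : ∀ t, 0 < t → HasDerivAt (fun t => t ^ (2 * ν + 1) * G t) (t ^ (2 * ν) * g t) t)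
    (hIntg : IntegrableOn (fun t => t ^ (2 * ν) * g t) (Set.Ioi x))
    (hlim : Tendsto (fun t => t ^ (2 * ν + 1) * G t) atTop (nhds 0)) :
    ∫ t in Set.Ioi x, t ^ (2 * ν) * g t = -(x ^ (2 * ν + 1) * G x) := by
  rw [integral_Ioi_of_hasDerivAt_of_tendsto' (fun t ht => hd t (lt_of_lt_of_le hx ht)) hIntg hlim]
  ring

lemma vQ_B' {ν : ℝ} (hν : -(1/2) < ν) {α β : ℝ} (hβ : |β| < α) {x : ℝ} (hx : 0 < x) :
    vQ α ν β x (fun t => (2 * ν + 1) * β - (α ^ 2 - β ^ 2) * t) =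
      -(x ^ (2 * ν + 1) * (Real.exp (β * x) * (β * vk α ν x + vkD α ν x))) := by
  have hα : 0 < α := lt_of_le_of_lt (abs_nonneg β) hβ
  have hg : LinGrowth (fun t => (2 * ν + 1) * β - (α ^ 2 - β ^ 2) * t) := by
    have := (linGrowth_one.smul ((2 * ν + 1) * β)).add (linGrowth_id.smul (-(α ^ 2 - β ^ 2)))
    convert this using 2
    ring
  unfold vQ
  refine vQ_ftc hx (G := fun t => Real.exp (β * t) * (β * vk α ν t + vkD α ν t)) ?_ (vQ_int hν hβ hg hx.le) ?_
  · intro t ht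
    have h := (hasDerivAt_expmul β t).mul (((vk_hasDerivAt ν hα ht).const_mul β).add (vkD_hasDerivAt ν hα ht))
    refine mulrpow_hasDerivAt ν ht h ?_
    simp only [Pi.add_apply]
    field_simp
    ring
  · have h := ((vk_atTop ν (2 * ν + 1) hβ).const_mul β).add (vkD_atTop hν (2 * ν + 1) hβ)
    rw [mul_zero, zero_add] at h
    refine h.congr (fun t => ?_)
    ring

lemma vQ_D' {ν : ℝ} (hν : -(1/2) < ν) {α β : ℝ} (hβ : |β| < α) {x : ℝ} (hx : 0 < x) :
    vQ α ν β x (fun t => (2 * ν + 1) + 2 * β * t + ((2 * ν + 1) * β - (α ^ 2 - β ^ 2) * t) * (t - x)) =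
      -(x ^ (2 * ν + 1) * (Real.exp (β * x) * vk α ν x)) := by
  have hα : 0 < α := lt_of_le_of_lt (abs_nonneg β) hβ
  have hg : LinGrowth (fun t => (2 * ν + 1) + 2 * β * t + ((2 * ν + 1) * β - (α ^ 2 - β ^ 2) * t) * (t - x)) := by
    have := ((linGrowth_one.smul ((2 * ν + 1) - (2 * ν + 1) * β * x)).add
      (linGrowth_id.smul (2 * β + (2 * ν + 1) * β + (α ^ 2 - β ^ 2) * x))).add (linGrowth_sq.smul (-(α ^ 2 - β ^ 2)))
    convert this using 2
    ring
  unfold vQ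
  rw [vQ_ftc hx (G := fun t => Real.exp (β * t) * (vk α ν t + (t - x) * (β * vk α ν t + vkD α ν t))) ?_ (vQ_int hν hβ hg hx.le) ?_]
  · ring
  · intro t ht
    have h := (hasDerivAt_expmul β t).mul ((vk_hasDerivAt ν hα ht).add (((hasDerivAt_id t).sub_const x).mul
      (((vk_hasDerivAt ν hα ht).const_mul β).add (vkD_hasDerivAt ν hα ht))))
    refine mulrpow_hasDerivAt ν ht h ?_
    simp only [Pi.add_apply, Pi.sub_apply, Pi.mul_apply, id]
    field_simp
    ring
  · have h := (((vk_atTop ν (2 * ν + 1) hβ).const_mul (1 - x * β)).add ((vk_atTop ν (2 * ν + 1 + 1) hβ).const_mul β)).add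
      (((vkD_atTop hν (2 * ν + 1) hβ).const_mul (-x)).add (vkD_atTop hν (2 * ν + 1 + 1) hβ))
    simp only [mul_zero, add_zero] at h
    refine h.congr' ?_
    filter_upwards [eventually_gt_atTop 0] with t ht
    rw [Real.rpow_add_one ht.ne' (2 * ν + 1)]
    ring

/-- `iD ≤ c i` criterion -/
lemma viD_le {ν : ℝ} (hν : -(1/2) < ν) {α : ℝ} (hα : 0 < α) (c : ℝ) {x : ℝ} (hx : 0 < x)
    (h : ∀ t, 0 < t → t ≤ x → 0 ≤ (2 * ν + 1) * c - (α ^ 2 - c ^ 2) * t) : viD α ν x ≤ c * vi α ν x := by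
  have h1 := vP_A' hν α c hx
  have h2 := vP_mono hν hα c hx (g₁ := fun _ => 0) (g₂ := fun t => (2 * ν + 1) * c - (α ^ 2 - c ^ 2) * t)
    (by fun_prop) (by fun_prop) h
  rw [h1] at h2
  have h3 : vP α ν c x (fun _ => 0) = 0 := by unfold vP; simp
  rw [h3] at h2
  have h4 : 0 < x ^ (2 * ν + 1) := by positivity
  have h5 := Real.exp_pos (c * x)
  rw [← mul_assoc] at h2
  have := nonneg_of_mul_nonneg_right h2 (by positivity)
  linarith

/-- in the subcase `iD ≤ β i` at `x`, `e^{-βt} i(t)` is decreasing on `[0,x]`. -/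
lemma vi_exp_le {ν : ℝ} (hν : -(1/2) < ν) {α β : ℝ} (hb : 0 < β) (hβ : |β| < α) {x : ℝ} (hx : 0 < x)
    (h : viD α ν x ≤ β * vi α ν x) : Real.exp (-β * x) * vi α ν x ≤ vi0 α ν := by
  have hα : 0 < α := lt_of_le_of_lt (abs_nonneg β) hβ
  have hl : 0 < α ^ 2 - β ^ 2 := by
    have := abs_lt.mp hβ
    nlinarith
  have key : ∀ t, 0 < t → t < x → viD α ν t ≤ β * vi α ν t := by
    intro t ht htx
    by_cases hc : (α ^ 2 - β ^ 2) * t ≤ (2 * ν + 1) * β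
    · apply viD_le hν hα β ht
      intro s hs hst
      have : (α ^ 2 - β ^ 2) * s ≤ (α ^ 2 - β ^ 2) * t := by gcongr
      linarith
    · push Not at hc
      have a1 := vP_A' hν α β hx
      have a2 := vP_A' hν α β ht
      have hx0 : 0 ≤ vP α ν β x (fun t => (2 * ν + 1) * β - (α ^ 2 - β ^ 2) * t) := by
        rw [a1]
        have : 0 ≤ β * vi α ν x - viD α ν x := by linarith
        positivity
      have ht0 : vP α ν β x (fun t => (2 * ν + 1) * β - (α ^ 2 - β ^ 2) * t) ≤
          vP α ν β t (fun t => (2 * ν + 1) * β - (α ^ 2 - β ^ 2) * t) := by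
        have hg : Continuous (fun t : ℝ => (2 * ν + 1) * β - (α ^ 2 - β ^ 2) * t) := by fun_prop
        unfold vP
        rw [← intervalIntegral.integral_add_adjacent_intervals (vP_int hν α β 0 t hg) (vP_int hν α β t x hg)]
        have : ∫ u in t..x, u ^ (2 * ν) * (Real.exp (β * u) * vi α ν u * ((2 * ν + 1) * β - (α ^ 2 - β ^ 2) * u)) ≤
            ∫ u in t..x, (0:ℝ) := by
          apply intervalIntegral.integral_mono_on htx.le (vP_int hν α β t x hg) (by simp)
          intro u hu
          have hu0 : 0 < u := lt_of_lt_of_le ht hu.1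
          have := vi_pos hν hα u
          have h5 : (α ^ 2 - β ^ 2) * t ≤ (α ^ 2 - β ^ 2) * u := by
            have := hu.1
            gcongr
          have h6 : 0 ≤ u ^ (2 * ν) * (Real.exp (β * u) * vi α ν u * -((2 * ν + 1) * β - (α ^ 2 - β ^ 2) * u)) := by
            have : 0 ≤ -((2 * ν + 1) * β - (α ^ 2 - β ^ 2) * u) := by linarith
            positivity
          linarith
        simp only [intervalIntegral.integral_zero] at this
        linarith
      have h7 := hx0.trans ht0
      rw [a2, ← mul_assoc] at h7
      have h4 : 0 < t ^ (2 * ν + 1) := by positivity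
      have h5 := Real.exp_pos (β * t)
      have := nonneg_of_mul_nonneg_right h7 (by positivity)
      linarith
  have hanti : AntitoneOn (fun t => Real.exp (-β * t) * vi α ν t) (Set.Icc 0 x) := by
    have hd : ∀ t, HasDerivAt (fun t => Real.exp (-β * t) * vi α ν t)
        (Real.exp (-β * t) * (viD α ν t - β * vi α ν t)) t := by
      intro t
      refine ((hasDerivAt_expmul (-β) t).mul (vi_hasDerivAt (by linarith : -1 < ν) α t)).congr_deriv ?_
      ring
    apply antitoneOn_of_deriv_nonpos (convex_Icc 0 x)
    · exact fun t _ => (hd t).continuousAt.continuousWithinAt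
    · exact fun t _ => (hd t).differentiableAt.differentiableWithinAt
    · intro t ht
      rw [interior_Icc] at ht
      rw [(hd t).deriv]
      have := key t ht.1 ht.2
      apply mul_nonpos_of_nonneg_of_nonpos (by positivity)
      linarith
  have := hanti (Set.left_mem_Icc.mpr hx.le) (Set.right_mem_Icc.mpr hx.le) hx.le
  simp only [mul_zero, Real.exp_zero, one_mul, vi_zero] at this
  exact this


open Real

set_option maxHeartbeats 4000000 in
/-- Algebraic part, nonpositive drift. -/
lemma alg_neg {r α b lam x w i iD k kD p0 p1 p2 q0 q1 q2 : ℝ}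
    (hr : 0 < r) (hα : 0 < α) (hb : 0 ≤ b) (hbα : b < α) (hlam : lam = α ^ 2 - b ^ 2) (hl : 0 < lam)
    (hx : 0 < x) (hw : 0 < w) (hi : 0 < i) (hiD : 0 ≤ iD) (hk : 0 < k) (hkD : α * k ≤ kD)
    (hW : w * (iD * k + i * kD) = 1) (hiDα : iD ≤ α * i) (hiDx : r * iD ≤ α ^ 2 * x * i)
    (hA : r * (-b) * p0 - lam * p1 = w * ((-b) * i - iD))
    (hB : r * (-b) * q0 - lam * q1 = -(w * ((-b) * k + kD)))
    (hC : r * p0 + 2 * (-b) * p1 + r * (-b) * (p1 - x * p0) - lam * (p2 - x * p1) = w * i)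
    (hD : r * q0 + 2 * (-b) * q1 + r * (-b) * (q1 - x * q0) - lam * (q2 - x * q1) = -(w * k))
    (hF : r * (x * p0 - p1) - p1 + (-b) * (x * p1 - p2) ≤ 0)
    (hp0 : 0 ≤ p0) (hp1 : 0 ≤ p1) (hV : 0 ≤ x * p0 - p1) (hS : 0 ≤ x * p1 - p2)
    (hq0 : 0 ≤ q0) (hU : 0 ≤ q1 - x * q0) (hZ : x * (q1 - x * q0) ≤ q2 - x * q1) :
    |lam * x * (((-b) * k + kD) * p0 - (iD - (-b) * i) * q0)| ≤ α / r * (2 * r + 3 + 4 * (b ^ 2 / lam)) ∧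
    4 * lam * ((-b) * k + kD) * (x * p1 - p2) ≤ 4 + 16 * (b * α / lam) ∧
    2 * lam * x * |iD - (-b) * i| * (q1 - x * q0) ≤ 2 * (3 + α ^ 2 / lam) := by
  have hkD0 : 0 < kD := lt_of_lt_of_le (by positivity) hkD
  have w1 : w * (iD * k) + w * (i * kD) = 1 := by linarith
  have n1 : 0 ≤ w * (iD * k) := by positivity
  have n2 : 0 ≤ w * (i * kD) := by positivity
  have f1 : w * (i * kD) ≤ 1 := by linarith
  have f2 : w * (iD * k) ≤ 1 := by linarith
  have f3 : w * (iD * kD) ≤ α := by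
    have : w * (iD * kD) ≤ w * ((α * i) * kD) := by gcongr
    have h9 : α * (w * (i * kD)) ≤ α * 1 := by gcongr
    linarith
  have f4 : α * (w * (i * k)) ≤ 1 := by
    have : w * (i * (α * k)) ≤ w * (i * kD) := by gcongr
    linarith
  have hkk : 0 ≤ (-b) * k + kD := by
    have : b * k ≤ α * k := by gcongr
    linarith
  have hq1 : 0 ≤ q1 := by
    have : 0 ≤ x * q0 := by positivity
    linarith
  -- p1
  have g1 : lam * p1 ≤ w * (iD + b * i) := by
    have : 0 ≤ r * b * p0 := by positivity
    linarith
  have g2 : lam * (kD * p1) ≤ 2 * α := by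
    have : kD * (lam * p1) ≤ kD * (w * (iD + b * i)) := by gcongr
    have h2 : b * (w * (i * kD)) ≤ b * 1 := by gcongr
    linarith
  have g3 : lam * (x * p1 - p2) ≤ w * i + 2 * b * p1 := by
    have : 0 ≤ r * b * (x * p0 - p1) := by positivity
    have : 0 ≤ r * p0 := by positivity
    linarith
  have g4 : kD * (lam * (x * p1 - p2)) ≤ 1 + 2 * b * (kD * p1) := by
    have : kD * (lam * (x * p1 - p2)) ≤ kD * (w * i + 2 * b * p1) := by gcongr
    linarith
  have g5 : kD * p1 ≤ 2 * α / lam := by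
    rw [le_div_iff₀ hl]; linarith
  -- q
  have j1 : lam * q1 ≤ w * kD := by
    have : 0 ≤ r * b * q0 := by positivity
    have : 0 ≤ w * (b * k) := by positivity
    linarith
  have j2 : r * b * q0 ≤ w * kD := by
    have : 0 ≤ lam * q1 := by positivity
    have : 0 ≤ w * (b * k) := by positivity
    linarith
  have j3 : lam * (x * q0) ≤ w * kD := by
    have : lam * (x * q0) ≤ lam * q1 := by
      apply mul_le_mul_of_nonneg_left _ hl.le; linarith
    linarith
  refine ⟨?_, ?_, ?_⟩
  · have X1 : lam * x * (((-b) * k + kD) * p0) ≤ α / r * (2 * r + 3 + 4 * (b ^ 2 / lam)) := by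
      have a1 : lam * x * (((-b) * k + kD) * p0) ≤ lam * x * (kD * p0) := by
        have : 0 ≤ b * k := by positivity
        gcongr
        linarith
      have a2 : r * (kD * (x * p0)) ≤ (r + 1) * (kD * p1) + b * (kD * (x * p1 - p2)) := by
        have : kD * (r * (x * p0 - p1) - p1 + (-b) * (x * p1 - p2)) ≤ kD * 0 := by gcongr
        linarith
      have a3 : r * (lam * x * (kD * p0)) ≤ (r + 1) * (2 * α) + b * (1 + 2 * b * (2 * α / lam)) := by
        have e1 : (r + 1) * (lam * (kD * p1)) ≤ (r + 1) * (2 * α) := by gcongr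
        have e2 : b * (kD * (lam * (x * p1 - p2))) ≤ b * (1 + 2 * b * (kD * p1)) := by gcongr
        have e3 : b * (1 + 2 * b * (kD * p1)) ≤ b * (1 + 2 * b * (2 * α / lam)) := by gcongr
        have e4 := mul_le_mul_of_nonneg_left a2 hl.le
        linarith
      have a4 : b * (1 + 2 * b * (2 * α / lam)) ≤ α + 4 * α * (b ^ 2 / lam) := by
        have : b * (2 * b * (2 * α / lam)) = 4 * α * (b ^ 2 / lam) := by ring
        linarith
      have a5 : lam * x * (kD * p0) ≤ ((r + 1) * (2 * α) + (α + 4 * α * (b ^ 2 / lam))) / r := by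
        rw [le_div_iff₀ hr]; linarith
      calc _ ≤ _ := a1
        _ ≤ _ := a5
        _ = _ := by ring
    have X1' : 0 ≤ lam * x * (((-b) * k + kD) * p0) := by positivity
    have X2' : 0 ≤ lam * x * ((iD - (-b) * i) * q0) := by
      have : 0 ≤ iD - (-b) * i := by
        have : 0 ≤ b * i := by positivity
        linarith
      positivity
    have X2 : lam * x * ((iD - (-b) * i) * q0) ≤ α / r * (2 * r + 3 + 4 * (b ^ 2 / lam)) := by
      have a1 : (iD + b * i) * (lam * (x * q0)) ≤ (iD + b * i) * (w * kD) := by gcongr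
      have h2 : b * (w * (i * kD)) ≤ b * 1 := by gcongr
      have a2 : 2 * α ≤ α / r * (2 * r + 3 + 4 * (b ^ 2 / lam)) := by
        have : α / r * (2 * r + 3 + 4 * (b ^ 2 / lam)) = 2 * α + α / r * (3 + 4 * (b ^ 2 / lam)) := by
          field_simp
          ring
        have h3 : 0 ≤ α / r * (3 + 4 * (b ^ 2 / lam)) := by positivity
        linarith
      linarith
    rw [abs_le]
    constructor <;> linarith
  · have a1 : ((-b) * k + kD) * (lam * (x * p1 - p2)) ≤ kD * (lam * (x * p1 - p2)) := by
      have : 0 ≤ b * k := by positivity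
      gcongr
      linarith
    have a2 : 2 * b * (kD * p1) ≤ 2 * b * (2 * α / lam) := by gcongr
    have a3 : 2 * b * (2 * α / lam) = 4 * (b * α / lam) := by ring
    linarith
  · have hab : |iD - (-b) * i| = iD + b * i := by
      have : 0 ≤ b * i := by positivity
      rw [abs_of_nonneg] <;> linarith
    rw [hab]
    have a1 : lam * (x * (q1 - x * q0)) ≤ w * k + r * q0 := by
      have : lam * (x * (q1 - x * q0)) ≤ lam * (q2 - x * q1) := by gcongr
      have h2 : 0 ≤ b * q1 := by positivity
      have h3 : 0 ≤ r * b * (q1 - x * q0) := by positivity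
      linarith
    have a2 : (iD + b * i) * (lam * (x * (q1 - x * q0))) ≤ (iD + b * i) * (w * k + r * q0) := by gcongr
    have a3 : b * (w * (i * k)) ≤ 1 := by
      have : b * (w * (i * k)) ≤ α * (w * (i * k)) := by gcongr
      linarith
    have a4 : i * (r * b * q0) ≤ i * (w * kD) := by gcongr
    have a5 : (r * iD) * q0 ≤ (α ^ 2 * x * i) * q0 := by gcongr
    have a6 : (α ^ 2 * x * i) * q0 ≤ α ^ 2 / lam := by
      rw [le_div_iff₀ hl]
      have : α ^ 2 * i * (lam * (x * q0)) ≤ α ^ 2 * i * (w * kD) := by gcongr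
      have h3 : α ^ 2 * (w * (i * kD)) ≤ α ^ 2 * 1 := by gcongr
      linarith
    linarith

set_option maxHeartbeats 4000000 in
/-- Algebraic part, positive drift. `W` bounds `J` in the subcase `iD ≤ β i`. -/
lemma alg_pos {r α b lam x w i iD k kD p0 p1 p2 q0 q1 q2 W : ℝ}
    (hr : 0 < r) (hα : 0 < α) (hb : 0 < b) (hbα : b < α) (hlam : lam = α ^ 2 - b ^ 2) (hl : 0 < lam)
    (hx : 0 < x) (hw : 0 < w) (hi : 0 < i) (hiD : 0 ≤ iD) (hk : 0 < k) (hkD : α * k ≤ kD)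
    (hW : w * (iD * k + i * kD) = 1) (hiDα : iD ≤ α * i) (hiDx : r * iD ≤ α ^ 2 * x * i)
    (hiDl : r * b ≤ lam * x → r * iD ≤ lam * x * i)
    (hA : r * b * p0 - lam * p1 = w * (b * i - iD))
    (hB : r * b * q0 - lam * q1 = -(w * (b * k + kD)))
    (hC : r * p0 + 2 * b * p1 + r * b * (p1 - x * p0) - lam * (p2 - x * p1) = w * i)
    (hD : r * q0 + 2 * b * q1 + r * b * (q1 - x * q0) - lam * (q2 - x * q1) = -(w * k))
    (hE : r * p0 + b * p1 ≤ w * i)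
    (hF : r * (x * p0 - p1) - p1 + b * (x * p1 - p2) ≤ 0)
    (hp0 : 0 ≤ p0) (hp1 : 0 ≤ p1) (hV : 0 ≤ x * p0 - p1) (hS : 0 ≤ x * p1 - p2)
    (hq0 : 0 ≤ q0) (hU : 0 ≤ q1 - x * q0) (hZ : x * (q1 - x * q0) ≤ q2 - x * q1)
    (hW0 : 0 ≤ W) (hJ : iD ≤ b * i → lam * i * q0 ≤ W) :
    |lam * x * ((b * k + kD) * p0 - (iD - b * i) * q0)| ≤ α * (6 + 2 / r) + r * (b ^ 2 / lam) * W ∧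
    4 * lam * (b * k + kD) * (x * p1 - p2) ≤ 8 ∧
    2 * lam * x * |iD - b * i| * (q1 - x * q0) ≤
      8 * r * (b ^ 2 / lam) + 2 * r * (b ^ 2 / lam) * (r * (b / lam) * W) + 4 * (1 + 4 * (α ^ 2 / lam) + 8 * (b * α / lam)) := by
  have hkD0 : 0 < kD := lt_of_lt_of_le (by positivity) hkD
  have w1 : w * (iD * k) + w * (i * kD) = 1 := by linarith
  have n1 : 0 ≤ w * (iD * k) := by positivity
  have n2 : 0 ≤ w * (i * kD) := by positivity
  have f1 : w * (i * kD) ≤ 1 := by linarith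
  have f3 : w * (iD * kD) ≤ α := by
    have : w * (iD * kD) ≤ w * ((α * i) * kD) := by gcongr
    have h9 : α * (w * (i * kD)) ≤ α * 1 := by gcongr
    linarith
  have f4 : α * (w * (i * k)) ≤ 1 := by
    have : w * (i * (α * k)) ≤ w * (i * kD) := by gcongr
    linarith
  have hbk : b * k ≤ kD := by
    have : b * k ≤ α * k := by gcongr
    linarith
  have hq1 : 0 ≤ q1 := by
    have : 0 ≤ x * q0 := by positivity
    linarith
  obtain ⟨E, hE'⟩ : ∃ E, E = w * (b * k + kD) := ⟨_, rfl⟩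
  have hE0 : 0 ≤ E := by rw [hE']; positivity
  have hE2 : E ≤ 2 * (w * kD) := by
    rw [hE']
    have : w * (b * k + kD) ≤ w * (kD + kD) := by gcongr
    linarith
  have hiE : i * E ≤ 2 := by
    have : i * E ≤ i * (2 * (w * kD)) := by gcongr
    linarith
  rw [← hE'] at hB
  have hae : 0 ≤ b ^ 2 / lam := by positivity
  have g1 : lam * p1 ≤ w * iD := by
    have : b * (r * p0 + b * p1) ≤ b * (w * i) := by gcongr
    have : 0 ≤ b * (b * p1) := by positivity
    linarith
  have g2 : lam * (kD * p1) ≤ α := by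
    have : kD * (lam * p1) ≤ kD * (w * iD) := by gcongr
    linarith
  have g3 : lam * (x * p1 - p2) ≤ w * i := by
    have h1 : 0 ≤ r * p0 := by positivity
    have h2 : b * (r * (x * p0 - p1) - p1 + b * (x * p1 - p2)) ≤ b * 0 := by gcongr
    have h3 : 0 ≤ b * (b * (x * p1 - p2)) := by positivity
    have h4 : 0 ≤ b * p1 := by positivity
    linarith
  have hxq : lam * (x * q0) - r * b * q0 ≤ E := by
    have : lam * (x * q0) ≤ lam * q1 := by
      apply mul_le_mul_of_nonneg_left _ hl.le; linarith
    linarith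
  have hcrude : |iD - b * i| ≤ α * i := by
    have : b * i ≤ α * i := by gcongr
    have : 0 ≤ b * i := by positivity
    rw [abs_le]; constructor <;> linarith
  have X1 : lam * x * ((b * k + kD) * p0) ≤ α * (2 + 2 / r) := by
    have a1 : r * (x * p0) ≤ (r + 1) * p1 := by
      have : 0 ≤ b * (x * p1 - p2) := by positivity
      linarith
    have a2 : (b * k + kD) * (lam * (r * (x * p0))) ≤ (kD + kD) * (lam * ((r + 1) * p1)) := by gcongr
    have a3 : (r + 1) * (lam * (kD * p1)) ≤ (r + 1) * α := by gcongr
    have a4 : lam * x * ((b * k + kD) * p0) ≤ (2 * ((r + 1) * α)) / r := by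
      rw [le_div_iff₀ hr]; linarith
    have a5 : (2 * ((r + 1) * α)) / r = α * (2 + 2 / r) := by field_simp
    linarith
  have X1' : 0 ≤ lam * x * ((b * k + kD) * p0) := by positivity
  have hfin : ∀ X2, |lam * x * ((iD - b * i) * q0)| ≤ X2 → X2 ≤ 4 * α + r * (b ^ 2 / lam) * W →
      |lam * x * ((b * k + kD) * p0 - (iD - b * i) * q0)| ≤ α * (6 + 2 / r) + r * (b ^ 2 / lam) * W := by
    intro X2 h1 h2
    rw [abs_le] at h1 ⊢
    have : 0 ≤ r * (b ^ 2 / lam) * W := by positivity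
    constructor <;> linarith [h1.1, h1.2]
  have hIII : 4 * lam * (b * k + kD) * (x * p1 - p2) ≤ 8 := by
    have a1 : (b * k + kD) * (lam * (x * p1 - p2)) ≤ (kD + kD) * (w * i) := by gcongr
    linarith
  have hIVfin : ∀ IV, IV ≤ 8 * r * (b ^ 2 / lam) + 2 * r * (b ^ 2 / lam) * (r * (b / lam) * W) ∨
      IV ≤ 4 * (1 + 4 * (α ^ 2 / lam) + 8 * (b * α / lam)) → IV ≤
      8 * r * (b ^ 2 / lam) + 2 * r * (b ^ 2 / lam) * (r * (b / lam) * W) + 4 * (1 + 4 * (α ^ 2 / lam) + 8 * (b * α / lam)) := by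
    intro IV h
    have h1 : 0 ≤ 8 * r * (b ^ 2 / lam) + 2 * r * (b ^ 2 / lam) * (r * (b / lam) * W) := by positivity
    have h2 : 0 ≤ 4 * (1 + 4 * (α ^ 2 / lam) + 8 * (b * α / lam)) := by positivity
    rcases h with h | h <;> linarith
  have habs : |lam * x * ((iD - b * i) * q0)| = |iD - b * i| * (lam * (x * q0)) := by
    rw [abs_mul, abs_mul (iD - b * i), abs_of_nonneg hq0, abs_of_pos (by positivity : 0 < lam * x)]; ring
  have hrW : 0 ≤ r * (b ^ 2 / lam) * W := by positivity
  by_cases hc : 2 * (r * b) ≤ lam * x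
  · -- case (c)
    have c1 : 2 * (r * b) * q0 ≤ lam * x * q0 := by gcongr
    have c2 : lam * (x * q0) ≤ 2 * E := by linarith
    have c3 : lam * q1 ≤ 2 * E := by linarith
    have c4 : |iD - b * i| * E ≤ 2 * α := by
      have : |iD - b * i| * E ≤ (α * i) * E := by gcongr
      have h2 : α * (i * E) ≤ α * 2 := by gcongr
      linarith
    refine ⟨hfin (4 * α) ?_ (by linarith), hIII, hIVfin _ (Or.inr ?_)⟩
    · rw [habs]
      have : |iD - b * i| * (lam * (x * q0)) ≤ |iD - b * i| * (2 * E) := by gcongr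
      linarith
    · have d1 : lam * (x * (q1 - x * q0)) ≤ 2 * (w * k + r * q0 + 2 * b * q1) := by
        have h1 : lam * (x * (q1 - x * q0)) ≤ lam * (q2 - x * q1) := by gcongr
        have h2 : 2 * (r * b) * (q1 - x * q0) ≤ lam * x * (q1 - x * q0) := by gcongr
        linarith
      have d2 : |iD - b * i| * (lam * (x * (q1 - x * q0))) ≤ |iD - b * i| * (2 * (w * k + r * q0 + 2 * b * q1)) := by
        gcongr
      have d3 : |iD - b * i| * (w * k) ≤ 1 := by
        have : |iD - b * i| * (w * k) ≤ (α * i) * (w * k) := by gcongr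
        linarith
      have d5 : (r * iD) * q0 ≤ 4 * (α ^ 2 / lam) := by
        have : (r * iD) * q0 ≤ (α ^ 2 * x * i) * q0 := by gcongr
        have h6 : (α ^ 2 * x * i) * q0 ≤ 4 * (α ^ 2) / lam := by
          rw [le_div_iff₀ hl]
          have : α ^ 2 * i * (lam * (x * q0)) ≤ α ^ 2 * i * (2 * E) := by gcongr
          have h3 : α ^ 2 * (i * E) ≤ α ^ 2 * 2 := by gcongr
          linarith
        have : 4 * (α ^ 2) / lam = 4 * (α ^ 2 / lam) := by ring
        linarith
      have d6 : (b * i) * (r * q0) ≤ 4 * (α ^ 2 / lam) := by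
        have h1 : i * (r * b * q0) ≤ i * E := by
          gcongr; linarith
        have h2 : 1 ≤ α ^ 2 / lam := by
          rw [le_div_iff₀ hl, hlam]; nlinarith
        linarith
      have d4 : |iD - b * i| * (r * q0) ≤ 4 * (α ^ 2 / lam) := by
        have h1 : |iD - b * i| ≤ max iD (b * i) := by
          have : 0 ≤ b * i := by positivity
          rw [abs_le]; constructor
          · linarith [le_max_right iD (b * i)]
          · linarith [le_max_left iD (b * i)]
        have h2 : |iD - b * i| * (r * q0) ≤ max iD (b * i) * (r * q0) := by gcongr
        rcases max_choice iD (b * i) with h | h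
        · rw [h] at h2; linarith
        · rw [h] at h2; linarith
      have d7 : |iD - b * i| * (2 * b * q1) ≤ 8 * (b * α / lam) := by
        have h1 : |iD - b * i| * (2 * b * q1) ≤ (α * i) * (2 * b * q1) := by gcongr
        have h2 : (α * i) * (2 * b * q1) ≤ (8 * (b * α)) / lam := by
          rw [le_div_iff₀ hl]
          have h3 : 2 * α * b * i * (lam * q1) ≤ 2 * α * b * i * (2 * E) := by gcongr
          have h4 : 4 * α * b * (i * E) ≤ 4 * α * b * 2 := by gcongr
          linarith
        have : (8 * (b * α)) / lam = 8 * (b * α / lam) := by ring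
        linarith
      have : 2 * lam * x * |iD - b * i| * (q1 - x * q0) = 2 * (|iD - b * i| * (lam * (x * (q1 - x * q0)))) := by ring
      rw [this]
      linarith
  · push Not at hc
    by_cases hs : iD ≤ b * i
    · -- case (a)
      have J := hJ hs
      have hab : |iD - b * i| = b * i - iD := by rw [abs_of_nonpos] <;> linarith
      have hab2 : |iD - b * i| ≤ b * i := by rw [hab]; linarith
      have c1 : i * (lam * (x * q0) - r * b * q0) ≤ i * E := by gcongr
      refine ⟨hfin (2 * b + r * (b ^ 2 / lam) * W) ?_ (by linarith), hIII, hIVfin _ (Or.inl ?_)⟩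
      · rw [habs]
        have h1 : |iD - b * i| * (lam * (x * q0)) ≤ (b * i) * (lam * (x * q0)) := by gcongr
        have h2 : b * (i * (lam * (x * q0) - r * b * q0)) ≤ b * 2 := by gcongr; linarith
        have h3 : r * (b ^ 2 / lam) * (lam * i * q0) ≤ r * (b ^ 2 / lam) * W := by gcongr
        have h4 : r * (b ^ 2 / lam) * (lam * i * q0) = b * (i * (r * b * q0)) := by field_simp
        linarith
      · have h1 : 2 * lam * x * |iD - b * i| * (q1 - x * q0) ≤ 2 * lam * x * (b * i) * (q1 - x * q0) := by gcongr
        have h2 : lam * (q1 - x * q0) ≤ E + r * b * q0 := by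
          have : 0 ≤ lam * (x * q0) := by positivity
          linarith
        have hJ' : r * b * (i * q0) ≤ r * (b / lam) * W := by
          have h3 : r * (b / lam) * (lam * i * q0) ≤ r * (b / lam) * W := by gcongr
          have h4 : r * (b / lam) * (lam * i * q0) = r * b * (i * q0) := by field_simp
          linarith
        by_cases hz : r * b ≤ lam * x
        · have h3 : lam * (q1 - x * q0) ≤ E := by
            have : r * b * q0 ≤ lam * x * q0 := by gcongr
            linarith
          have h4 : 2 * x * b * (i * (lam * (q1 - x * q0))) ≤ 2 * x * b * (i * E) := by gcongr
          have h5 : 2 * x * b * (i * E) ≤ 2 * x * b * 2 := by gcongr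
          have h6 : 4 * b * x ≤ 8 * r * (b ^ 2 / lam) := by
            have : x ≤ 2 * (r * b) / lam := by rw [le_div_iff₀ hl]; linarith
            have h7 : 4 * b * x ≤ 4 * b * (2 * (r * b) / lam) := by gcongr
            have h8 : 4 * b * (2 * (r * b) / lam) = 8 * r * (b ^ 2 / lam) := by ring
            linarith
          have h9 : 0 ≤ 2 * r * (b ^ 2 / lam) * (r * (b / lam) * W) := by positivity
          linarith
        · push Not at hz
          have hx2 : x ≤ (r * b) / lam := by rw [le_div_iff₀ hl]; linarith
          have h4 : 2 * x * b * (i * (lam * (q1 - x * q0))) ≤ 2 * x * b * (i * (E + r * b * q0)) := by gcongr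
          have h5 : i * (E + r * b * q0) ≤ 2 + r * (b / lam) * W := by linarith
          have h6 : 2 * x * b * (i * (E + r * b * q0)) ≤ 2 * ((r * b) / lam) * b * (2 + r * (b / lam) * W) := by
            have : 0 ≤ i * (E + r * b * q0) := by positivity
            gcongr
          have h7 : 2 * ((r * b) / lam) * b * (2 + r * (b / lam) * W) =
            4 * r * (b ^ 2 / lam) + 2 * r * (b ^ 2 / lam) * (r * (b / lam) * W) := by ring
          have h8 : 0 ≤ r * (b ^ 2 / lam) := by positivity
          linarith
    · -- case (b)
      push Not at hs
      have hz : r * b < lam * x := by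
        by_contra hcon
        push Not at hcon
        have h1 : lam * p1 ≤ lam * (x * p0) := by
          apply mul_le_mul_of_nonneg_left _ hl.le; linarith
        have h2 : lam * x * p0 ≤ r * b * p0 := by gcongr
        have h3 : 0 < w * (iD - b * i) := mul_pos hw (by linarith)
        linarith
      have hl2 := hiDl hz.le
      have hab : |iD - b * i| = iD - b * i := by rw [abs_of_pos]; linarith
      have c1 : r * (iD - b * i) ≤ (lam * x - r * b) * i := by linarith
      have c2 : iD - b * i ≤ b * i := by
        have : (lam * x - r * b) * i ≤ (r * b) * i := by gcongr; linarith
        have h2 : r * (iD - b * i) ≤ r * (b * i) := by linarith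
        exact le_of_mul_le_mul_left h2 hr
      have hx2 : x ≤ 2 * (r * b) / lam := by rw [le_div_iff₀ hl]; linarith
      refine ⟨hfin (4 * b) ?_ (by linarith), hIII, hIVfin _ (Or.inl ?_)⟩
      · rw [habs, hab]
        have h1 : r * (iD - b * i) * (lam * (x * q0)) ≤ (lam * x - r * b) * i * (lam * (x * q0)) := by gcongr
        have h2 : lam * x * (i * (lam * (x * q0) - r * b * q0)) ≤ lam * x * (i * E) := by gcongr
        have h3 : lam * x * (i * E) ≤ (2 * (r * b)) * 2 := by gcongr
        have h4 : r * ((iD - b * i) * (lam * (x * q0))) ≤ r * (4 * b) := by linarith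
        exact le_of_mul_le_mul_left h4 hr
      · rw [hab]
        have h3 : lam * (q1 - x * q0) ≤ E := by
          have : r * b * q0 ≤ lam * x * q0 := by gcongr
          linarith
        have h1 : 2 * lam * x * (iD - b * i) * (q1 - x * q0) ≤ 2 * lam * x * (b * i) * (q1 - x * q0) := by gcongr
        have h4 : 2 * x * b * (i * (lam * (q1 - x * q0))) ≤ 2 * x * b * (i * E) := by gcongr
        have h5 : 2 * x * b * (i * E) ≤ 2 * x * b * 2 := by gcongr
        have h6 : 4 * b * x ≤ 8 * r * (b ^ 2 / lam) := by
          have h7 : 4 * b * x ≤ 4 * b * (2 * (r * b) / lam) := by gcongr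
          have h8 : 4 * b * (2 * (r * b) / lam) = 8 * r * (b ^ 2 / lam) := by ring
          linarith
        have h9 : 0 ≤ 2 * r * (b ^ 2 / lam) * (r * (b / lam) * W) := by positivity
        linarith



noncomputable def vDer (α ν β x : ℝ) (H : ℝ → ℝ) : ℝ :=
  (α ^ 2 - β ^ 2) * Real.exp (-β * x) * ((β * vk α ν x + vkD α ν x) * vP α ν β x H
    - (viD α ν x - β * vi α ν x) * vQ α ν β x H)

lemma vR_bound {H : ℝ → ℝ} {L : ℝ} (hH : ∀ s t, |H s - H t| ≤ L * |s - t|) {x : ℝ} (hx : 0 < x) :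
    (∀ t, 0 < t → t ≤ x → |H t - H 0 - (H x - H 0) / x * t| ≤ 4 * L / x * (t * (x - t))) ∧
    (∀ t, x < t → |H t - H 0 - (H x - H 0) / x * t| ≤ 2 * L * (t - x)) ∧ |(H x - H 0) / x| ≤ L := by
  have hB : |(H x - H 0) / x| ≤ L := by
    rw [abs_div, abs_of_pos hx, div_le_iff₀ hx]
    have := hH x 0
    rwa [sub_zero, abs_of_pos hx] at this
  obtain ⟨B, hBB⟩ : ∃ B, B = (H x - H 0) / x := ⟨_, rfl⟩
  have hBx : H x - H 0 = B * x := by rw [hBB]; field_simp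
  rw [← hBB] at hB ⊢
  have hB' := abs_le.mp hB
  have hL : 0 ≤ L := (abs_nonneg _).trans hB
  refine ⟨?_, ?_, hB⟩
  · intro t ht htx
    have h1 : |H t - H 0 - B * t| ≤ 2 * L * t := by
      have := hH t 0
      rw [sub_zero, abs_of_pos ht] at this
      have h2 := abs_sub (H t - H 0) (B * t)
      have h3 : |B * t| ≤ L * t := by rw [abs_mul, abs_of_pos ht]; gcongr
      linarith
    have h2 : |H t - H 0 - B * t| ≤ 2 * L * (x - t) := by
      have e : H t - H 0 - B * t = (H t - H x) + B * (x - t) := by linarith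
      have := hH t x
      rw [abs_sub_comm t x, abs_of_nonneg (by linarith : 0 ≤ x - t)] at this
      have h2 := abs_add_le (H t - H x) (B * (x - t))
      have h3 : |B * (x - t)| ≤ L * (x - t) := by
        rw [abs_mul, abs_of_nonneg (by linarith : 0 ≤ x - t)]
        apply mul_le_mul_of_nonneg_right hB; linarith
      rw [e]; linarith
    have h0 : 0 ≤ x - t := by linarith
    rw [div_mul_eq_mul_div, le_div_iff₀ hx]
    have a1 : |H t - H 0 - B * t| * (x - t) ≤ 2 * L * t * (x - t) := by gcongr
    have a2 : |H t - H 0 - B * t| * t ≤ 2 * L * (x - t) * t := by gcongr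
    linarith
  · intro t htx
    have e : H t - H 0 - B * t = (H t - H x) - B * (t - x) := by linarith
    have := hH t x
    have h0 : 0 < t - x := by linarith
    rw [abs_of_pos h0] at this
    have h2 := abs_sub (H t - H x) (B * (t - x))
    have h3 : |B * (t - x)| ≤ L * (t - x) := by rw [abs_mul, abs_of_pos h0]; gcongr
    rw [e]; linarith

lemma lip_cont {H : ℝ → ℝ} {L : ℝ} (hH : ∀ s t, |H s - H t| ≤ L * |s - t|) : Continuous H := by
  have hL : 0 ≤ L := by
    have := (abs_nonneg _).trans (hH 1 0)
    simpa using this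
  have : LipschitzWith ⟨L, hL⟩ H := LipschitzWith.of_dist_le_mul (fun s t => by
    rw [Real.dist_eq, Real.dist_eq]; exact hH s t)
  exact this.continuous

lemma lip_growth {H : ℝ → ℝ} {L : ℝ} (hH : ∀ s t, |H s - H t| ≤ L * |s - t|) : LinGrowth H := by
  have hL : 0 ≤ L := by
    have := (abs_nonneg _).trans (hH 1 0)
    simpa using this
  refine ⟨lip_cont hH, |H 0| + L, fun t ht => ?_⟩
  have h1 := hH t 0
  rw [sub_zero, abs_of_pos ht] at h1
  have h2 := abs_sub_abs_le_abs_sub (H t) (H 0)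
  have h3 : |H t| ≤ |H 0| + L * t := by linarith
  have h4 := abs_nonneg (H 0)
  nlinarith [mul_nonneg h4 ht.le, mul_nonneg hL ht.le, mul_nonneg h4 (sq_nonneg t), mul_nonneg hL (sq_nonneg t)]

lemma vP_id {ν : ℝ} (hν : -(1/2) < ν) (α β x a b c : ℝ) {g : ℝ → ℝ} (hg : ∀ t, g t = a + b * t + c * t ^ 2) :
    vP α ν β x g = a * vP α ν β x (fun _ => 1) + b * vP α ν β x (fun t => t) + c * vP α ν β x (fun t => t ^ 2) := by
  have e : g = fun t => ((a * 1 + b * t) + c * t ^ 2) := by ext t; rw [hg]; ring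
  rw [e, vP_add hν α β x (g₁ := fun t => a * 1 + b * t) (g₂ := fun t => c * t ^ 2) (by fun_prop) (by fun_prop),
    vP_add hν α β x (g₁ := fun t => a * 1) (g₂ := fun t => b * t) (by fun_prop) (by fun_prop),
    vP_smul α ν β x a (fun _ => 1), vP_smul α ν β x b (fun t => t), vP_smul α ν β x c (fun t => t ^ 2)]

lemma vQ_id {ν : ℝ} (hν : -(1/2) < ν) {α β x : ℝ} (hβ : |β| < α) (hx : 0 ≤ x) (a b c : ℝ) {g : ℝ → ℝ} (hg : ∀ t, g t = a + b * t + c * t ^ 2) :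
    vQ α ν β x g = a * vQ α ν β x (fun _ => 1) + b * vQ α ν β x (fun t => t) + c * vQ α ν β x (fun t => t ^ 2) := by
  have e : g = fun t => ((a * 1 + b * t) + c * t ^ 2) := by ext t; rw [hg]; ring
  have l1 := linGrowth_one.smul a
  have l2 := linGrowth_id.smul b
  have l3 := linGrowth_sq.smul c
  rw [e, vQ_add hν hβ (l1.add l2) l3 hx, vQ_add hν hβ l1 l2 hx,
    vQ_smul α ν β x a (fun _ => 1), vQ_smul α ν β x b (fun t => t), vQ_smul α ν β x c (fun t => t ^ 2)]

/-- The decomposition bound, before inserting the algebraic bounds. -/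
lemma vDer_decomp {ν : ℝ} (hν : -(1/2) < ν) {α β : ℝ} (hβ : |β| < α) {x : ℝ} (hx : 0 < x)
    {H : ℝ → ℝ} {L m : ℝ} (hH : ∀ s t, |H s - H t| ≤ L * |s - t|) (hm : |H 0| ≤ L * m)
    {lam p0 p1 p2 q0 q1 Y III IV : ℝ} (hlam : lam = α ^ 2 - β ^ 2) (hl : 0 < lam)
    (hp0 : p0 = Real.exp (-β * x) * vP α ν β x (fun _ => 1))
    (hp1 : p1 = Real.exp (-β * x) * vP α ν β x (fun t => t))
    (hp2 : p2 = Real.exp (-β * x) * vP α ν β x (fun t => t ^ 2))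
    (hq0 : q0 = Real.exp (-β * x) * vQ α ν β x (fun _ => 1))
    (hq1 : q1 = Real.exp (-β * x) * vQ α ν β x (fun t => t))
    (hkk : 0 ≤ β * vk α ν x + vkD α ν x)
    (hA : (2 * ν + 1) * β * p0 - lam * p1 = x ^ (2 * ν + 1) * (β * vi α ν x - viD α ν x))
    (hB : (2 * ν + 1) * β * q0 - lam * q1 = -(x ^ (2 * ν + 1) * (β * vk α ν x + vkD α ν x)))
    (hY : |lam * x * ((β * vk α ν x + vkD α ν x) * p0 - (viD α ν x - β * vi α ν x) * q0)| ≤ Y)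
    (hIII : 4 * lam * (β * vk α ν x + vkD α ν x) * (x * p1 - p2) ≤ III)
    (hIV : 2 * lam * x * |viD α ν x - β * vi α ν x| * (q1 - x * q0) ≤ IV) :
    |x * vDer α ν β x H| ≤ L * ((m + (2 * ν + 1) * |β| / lam) * Y + III + IV) := by
  have hα : 0 < α := lt_of_le_of_lt (abs_nonneg β) hβ
  obtain ⟨hR1, hR2, hB0⟩ := vR_bound hH hx
  obtain ⟨B, hBB⟩ : ∃ B, B = (H x - H 0) / x := ⟨_, rfl⟩
  rw [← hBB] at hB0
  simp only [← hBB] at hR1 hR2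
  have hL : 0 ≤ L := (abs_nonneg _).trans hB0
  have hc := lip_cont hH
  have hg := lip_growth hH
  let R : ℝ → ℝ := fun t => H t - H 0 - B * t
  have hRc : Continuous R := by fun_prop
  have hRg : LinGrowth R := by
    have := (hg.add (linGrowth_one.smul (-H 0))).add (linGrowth_id.smul (-B))
    convert this using 2
    simp only [R]
    ring
  have hlg : LinGrowth (fun t => H 0 + B * t + 0 * t ^ 2) := by
    have := ((linGrowth_one.smul (H 0)).add (linGrowth_id.smul B)).add (linGrowth_sq.smul 0)
    convert this using 2
    ring
  have eH : H = fun t => (H 0 + B * t + 0 * t ^ 2) + R t := by ext t; simp only [R]; ring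
  obtain ⟨e, he⟩ : ∃ e, e = Real.exp (-β * x) := ⟨_, rfl⟩
  have he0 : 0 < e := by rw [he]; positivity
  rw [← he] at hp0 hp1 hp2 hq0 hq1
  obtain ⟨pR, hpR⟩ : ∃ pR, pR = e * vP α ν β x R := ⟨_, rfl⟩
  obtain ⟨qR, hqR⟩ : ∃ qR, qR = e * vQ α ν β x R := ⟨_, rfl⟩
  have ePH : e * vP α ν β x H = H 0 * p0 + B * p1 + pR := by
    rw [eH, vP_add hν α β x (g₁ := fun t => H 0 + B * t + 0 * t ^ 2) (by fun_prop) hRc,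
      vP_id hν α β x (H 0) B 0 (fun t => rfl), hp0, hp1, hpR]
    ring
  have eQH : e * vQ α ν β x H = H 0 * q0 + B * q1 + qR := by
    rw [eH, vQ_add hν hβ hlg hRg hx.le,
      vQ_id hν hβ hx.le (H 0) B 0 (fun t => rfl), hq0, hq1, hqR]
    ring
  have bP : |pR| ≤ 4 * L / x * (x * p1 - p2) := by
    have h1 := vP_abs hν hα β hx (g₁ := R) (g₂ := fun t => 4 * L / x * (t * (x - t))) hRc (by fun_prop) hR1
    rw [vP_id hν α β x 0 (4 * L / x * x) (-(4 * L / x)) (g := fun t => 4 * L / x * (t * (x - t))) (fun t => by ring)] at h1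
    rw [hpR, hp1, hp2, abs_mul, abs_of_pos he0]
    exact (mul_le_mul_of_nonneg_left h1 he0.le).trans (le_of_eq (by ring))
  have bQ : |qR| ≤ 2 * L * (q1 - x * q0) := by
    have hl2 : LinGrowth (fun t => 2 * L * (t - x)) := by
      have := (linGrowth_one.smul (-(2 * L * x))).add (linGrowth_id.smul (2 * L))
      convert this using 2
      ring
    have h1 := vQ_abs hν hβ (g₁ := R) (g₂ := fun t => 2 * L * (t - x)) hRg hl2 hx.le hR2
    rw [vQ_id hν hβ hx.le (-(2 * L * x)) (2 * L) 0 (g := fun t => 2 * L * (t - x)) (fun t => by ring)] at h1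
    rw [hqR, hq1, hq0, abs_mul, abs_of_pos he0]
    exact (mul_le_mul_of_nonneg_left h1 he0.le).trans (le_of_eq (by ring))
  obtain ⟨κ, hκ⟩ : ∃ κ, κ = β * vk α ν x + vkD α ν x := ⟨_, rfl⟩
  obtain ⟨ι, hι⟩ : ∃ ι, ι = viD α ν x - β * vi α ν x := ⟨_, rfl⟩
  obtain ⟨w, hw⟩ : ∃ w, w = x ^ (2 * ν + 1) := ⟨_, rfl⟩
  have hA' : (2 * ν + 1) * β * p0 - lam * p1 = -(w * ι) := by rw [hA, hι, hw]; ring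
  rw [← hκ, ← hw] at hB
  rw [← hκ] at hkk hIII
  rw [← hι] at hIV
  rw [← hκ, ← hι] at hY
  obtain ⟨Y0, hY0⟩ : ∃ Y0, Y0 = lam * x * (κ * p0 - ι * q0) := ⟨_, rfl⟩
  rw [← hY0] at hY
  have hp1' : p1 = ((2 * ν + 1) * β * p0 + w * ι) / lam := by
    rw [eq_div_iff hl.ne']; linarith
  have hq1' : q1 = ((2 * ν + 1) * β * q0 + w * κ) / lam := by
    rw [eq_div_iff hl.ne']; linarith
  have hY1 : lam * x * (κ * p1 - ι * q1) = ((2 * ν + 1) * β / lam) * Y0 := by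
    rw [hY0, hp1', hq1']
    field_simp
    ring
  have hxD : x * vDer α ν β x H = H 0 * Y0 + B * (((2 * ν + 1) * β / lam) * Y0) + lam * x * κ * pR - lam * x * ι * qR := by
    have e1 : x * vDer α ν β x H = lam * x * (κ * (e * vP α ν β x H) - ι * (e * vQ α ν β x H)) := by
      unfold vDer
      rw [hκ, hι, hlam, he]
      ring
    rw [e1, ePH, eQH, ← hY1, hY0]
    ring
  have t1 : |H 0 * Y0| ≤ L * m * Y := by
    rw [abs_mul]
    have := abs_nonneg (H 0)
    exact mul_le_mul hm hY (abs_nonneg _) (this.trans hm)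
  have hr : 0 < 2 * ν + 1 := by linarith
  have t2 : |B * (((2 * ν + 1) * β / lam) * Y0)| ≤ L * ((2 * ν + 1) * |β| / lam * Y) := by
    rw [abs_mul, abs_mul, abs_div, abs_mul, abs_of_pos hr, abs_of_pos hl]
    gcongr
  have t3 : |lam * x * κ * pR| ≤ L * III := by
    rw [abs_mul, abs_of_nonneg (by positivity : 0 ≤ lam * x * κ)]
    calc lam * x * κ * |pR| ≤ lam * x * κ * (4 * L / x * (x * p1 - p2)) := by gcongr
      _ = L * (4 * lam * κ * (x * p1 - p2)) := by field_simp
      _ ≤ L * III := by gcongr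
  have t4 : |lam * x * ι * qR| ≤ L * IV := by
    rw [abs_mul, abs_mul, abs_of_nonneg (by positivity : 0 ≤ lam * x)]
    calc lam * x * |ι| * |qR| ≤ lam * x * |ι| * (2 * L * (q1 - x * q0)) := by gcongr
      _ = L * (2 * lam * x * |ι| * (q1 - x * q0)) := by ring
      _ ≤ L * IV := by gcongr
  rw [hxD]
  have s1 := abs_sub (H 0 * Y0 + B * (((2 * ν + 1) * β / lam) * Y0) + lam * x * κ * pR) (lam * x * ι * qR)
  have s2 := abs_add_le (H 0 * Y0 + B * (((2 * ν + 1) * β / lam) * Y0)) (lam * x * κ * pR)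
  have s3 := abs_add_le (H 0 * Y0) (B * (((2 * ν + 1) * β / lam) * Y0))
  linarith

set_option maxHeartbeats 1000000 in
lemma vDer_bound {ν : ℝ} (hν : -(1/2) < ν) {α β : ℝ} (hβ : |β| < α) {x : ℝ} (hx : 0 < x)
    {H : ℝ → ℝ} {L m : ℝ} (hH : ∀ s t, |H s - H t| ≤ L * |s - t|) (hm : |H 0| ≤ L * m)
    {lam r b W : ℝ} (hlam : lam = α ^ 2 - β ^ 2) (hr : r = 2 * ν + 1) (hb : b = |β|)
    (hW : lam * vi0 α ν * vQ α ν β 0 (fun _ => 1) ≤ W) :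
    |x * vDer α ν β x H| ≤ L * ((m + r * b / lam) * (α / r * (2 * r + 3 + 4 * (b ^ 2 / lam))) +
      (4 + 16 * (b * α / lam)) + 2 * (3 + α ^ 2 / lam)) ∨
    |x * vDer α ν β x H| ≤ L * ((m + r * b / lam) * (α * (6 + 2 / r) + r * (b ^ 2 / lam) * W) +
      8 + (8 * r * (b ^ 2 / lam) + 2 * r * (b ^ 2 / lam) * (r * (b / lam) * W) + 4 * (1 + 4 * (α ^ 2 / lam) + 8 * (b * α / lam)))) := by
  have hα : 0 < α := lt_of_le_of_lt (abs_nonneg β) hβ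
  have hl : 0 < lam := by
    have := abs_lt.mp hβ
    rw [hlam]; nlinarith
  have hr0 : 0 < r := by rw [hr]; linarith
  obtain ⟨e, he⟩ : ∃ e, e = Real.exp (-β * x) := ⟨_, rfl⟩
  have he0 : 0 < e := by rw [he]; positivity
  have hee : e * Real.exp (β * x) = 1 := by rw [he, ← Real.exp_add]; simp
  obtain ⟨p0, hp0⟩ : ∃ p0, p0 = e * vP α ν β x (fun _ => 1) := ⟨_, rfl⟩
  obtain ⟨p1, hp1⟩ : ∃ p1, p1 = e * vP α ν β x (fun t => t) := ⟨_, rfl⟩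
  obtain ⟨p2, hp2⟩ : ∃ p2, p2 = e * vP α ν β x (fun t => t ^ 2) := ⟨_, rfl⟩
  obtain ⟨q0, hq0⟩ : ∃ q0, q0 = e * vQ α ν β x (fun _ => 1) := ⟨_, rfl⟩
  obtain ⟨q1, hq1⟩ : ∃ q1, q1 = e * vQ α ν β x (fun t => t) := ⟨_, rfl⟩
  obtain ⟨q2, hq2⟩ : ∃ q2, q2 = e * vQ α ν β x (fun t => t ^ 2) := ⟨_, rfl⟩
  obtain ⟨w, hw⟩ : ∃ w, w = x ^ (2 * ν + 1) := ⟨_, rfl⟩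
  have hw0 : 0 < w := by rw [hw]; positivity
  have scP : ∀ a b c : ℝ, ∀ g : ℝ → ℝ, (∀ t, g t = a + b * t + c * t ^ 2) →
      e * vP α ν β x g = a * p0 + b * p1 + c * p2 := by
    intro a b c g hg
    rw [vP_id hν α β x a b c hg, hp0, hp1, hp2]; ring
  have scQ : ∀ a b c : ℝ, ∀ g : ℝ → ℝ, (∀ t, g t = a + b * t + c * t ^ 2) →
      e * vQ α ν β x g = a * q0 + b * q1 + c * q2 := by
    intro a b c g hg
    rw [vQ_id hν hβ hx.le a b c hg, hq0, hq1, hq2]; ring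
  have zP : vP α ν β x (fun _ => 0) = 0 := by unfold vP; simp
  have zQ : vQ α ν β x (fun _ => 0) = 0 := by unfold vQ; simp
  have posP : ∀ a b c : ℝ, (∀ t, 0 < t → t ≤ x → 0 ≤ a + b * t + c * t ^ 2) → 0 ≤ a * p0 + b * p1 + c * p2 := by
    intro a b c h
    rw [← scP a b c (fun t => a + b * t + c * t ^ 2) (fun t => rfl)]
    have := vP_mono hν hα β hx (g₁ := fun _ => 0) (g₂ := fun t => a + b * t + c * t ^ 2) (by fun_prop) (by fun_prop) h
    rw [zP] at this
    positivity
  have posQ : ∀ a b c : ℝ, (∀ t, x < t → 0 ≤ a + b * t + c * t ^ 2) → 0 ≤ a * q0 + b * q1 + c * q2 := by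
    intro a b c h
    rw [← scQ a b c (fun t => a + b * t + c * t ^ 2) (fun t => rfl)]
    have g0 : LinGrowth (fun _ => (0:ℝ)) := by
      have := linGrowth_one.smul 0
      convert this using 2
      ring
    have g1 : LinGrowth (fun t => a + b * t + c * t ^ 2) := by
      have := ((linGrowth_one.smul a).add (linGrowth_id.smul b)).add (linGrowth_sq.smul c)
      convert this using 2
      ring
    have := vQ_mono hν hβ g0 g1 hx.le h
    rw [zQ] at this
    positivity
  have hA : r * β * p0 - lam * p1 = w * (β * vi α ν x - viD α ν x) := by
    have h1 := vP_A' hν α β hx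
    have h2 := scP (r * β) (-lam) 0 (fun t => (2 * ν + 1) * β - (α ^ 2 - β ^ 2) * t) (fun t => by rw [hr, hlam]; ring)
    rw [h1, ← hw] at h2
    have : e * (w * (Real.exp (β * x) * (β * vi α ν x - viD α ν x))) = w * (β * vi α ν x - viD α ν x) := by
      calc _ = (e * Real.exp (β * x)) * (w * (β * vi α ν x - viD α ν x)) := by ring
        _ = _ := by rw [hee, one_mul]
    linarith
  have hB : r * β * q0 - lam * q1 = -(w * (β * vk α ν x + vkD α ν x)) := by
    have h1 := vQ_B' hν hβ hx
    have h2 := scQ (r * β) (-lam) 0 (fun t => (2 * ν + 1) * β - (α ^ 2 - β ^ 2) * t) (fun t => by rw [hr, hlam]; ring)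
    rw [h1, ← hw] at h2
    have : e * -(w * (Real.exp (β * x) * (β * vk α ν x + vkD α ν x))) = -(w * (β * vk α ν x + vkD α ν x)) := by
      calc _ = (e * Real.exp (β * x)) * -(w * (β * vk α ν x + vkD α ν x)) := by ring
        _ = _ := by rw [hee, one_mul]
    linarith
  have hC : r * p0 + 2 * β * p1 + r * β * (p1 - x * p0) - lam * (p2 - x * p1) = w * vi α ν x := by
    have h1 := vP_C' hν α β hx
    have h2 := scP (r - r * β * x) (2 * β + r * β + lam * x) (-lam) (fun t => (2 * ν + 1) + 2 * β * t + ((2 * ν + 1) * β - (α ^ 2 - β ^ 2) * t) * (t - x))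
      (fun t => by rw [hr, hlam]; ring)
    rw [h1, ← hw] at h2
    have : e * (w * (Real.exp (β * x) * vi α ν x)) = w * vi α ν x := by
      calc _ = (e * Real.exp (β * x)) * (w * vi α ν x) := by ring
        _ = _ := by rw [hee, one_mul]
    linarith
  have hD : r * q0 + 2 * β * q1 + r * β * (q1 - x * q0) - lam * (q2 - x * q1) = -(w * vk α ν x) := by
    have h1 := vQ_D' hν hβ hx
    have h2 := scQ (r - r * β * x) (2 * β + r * β + lam * x) (-lam) (fun t => (2 * ν + 1) + 2 * β * t + ((2 * ν + 1) * β - (α ^ 2 - β ^ 2) * t) * (t - x))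
      (fun t => by rw [hr, hlam]; ring)
    rw [h1, ← hw] at h2
    have : e * -(w * (Real.exp (β * x) * vk α ν x)) = -(w * vk α ν x) := by
      calc _ = (e * Real.exp (β * x)) * -(w * vk α ν x) := by ring
        _ = _ := by rw [hee, one_mul]
    linarith
  have hE : r * p0 + β * p1 ≤ w * vi α ν x := by
    have h1 := vP_E' hν hα β hx
    have h2 := scP r β 0 (fun t => (2 * ν + 1) + β * t) (fun t => by rw [hr]; ring)
    have h3 := mul_le_mul_of_nonneg_left h1 he0.le
    rw [h2, ← hw] at h3
    have : e * (w * (Real.exp (β * x) * vi α ν x)) = w * vi α ν x := by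
      calc _ = (e * Real.exp (β * x)) * (w * vi α ν x) := by ring
        _ = _ := by rw [hee, one_mul]
    linarith
  have hF : r * (x * p0 - p1) - p1 + β * (x * p1 - p2) ≤ 0 := by
    have h1 := vP_F' hν hα β hx
    have h2 := scP (r * x) (-r - 1 + β * x) (-β) (fun t => (2 * ν + 1) * (x - t) - t + β * (t * (x - t))) (fun t => by rw [hr]; ring)
    have h3 := mul_le_mul_of_nonneg_left h1 he0.le
    rw [h2] at h3
    linarith
  have p0n : 0 ≤ p0 := by have := posP 1 0 0 (fun t _ _ => by norm_num); linarith
  have p1n : 0 ≤ p1 := by have := posP 0 1 0 (fun t ht _ => by linarith); linarith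
  have hV : 0 ≤ x * p0 - p1 := by have := posP x (-1) 0 (fun t _ ht => by linarith); linarith
  have hS : 0 ≤ x * p1 - p2 := by
    have := posP 0 x (-1) (fun t h1 h2 => by nlinarith)
    linarith
  have q0n : 0 ≤ q0 := by have := posQ 1 0 0 (fun t _ => by norm_num); linarith
  have hU : 0 ≤ q1 - x * q0 := by have := posQ (-x) 1 0 (fun t ht => by linarith); linarith
  have hZ : x * (q1 - x * q0) ≤ q2 - x * q1 := by
    have := posQ (x ^ 2) (-2 * x) 1 (fun t ht => by nlinarith [sq_nonneg (t - x)])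
    linarith
  have hi := vi_pos hν hα x
  have hiD := viD_nonneg hν hα hx.le
  have hk := vk_pos ν hα hx
  have hkD := vkD_ge hν hα hx
  have hWr := vWronsk hν hα hx
  rw [← hw] at hWr
  have hiDα : viD α ν x ≤ α * vi α ν x := by
    apply viD_le hν hα α hx
    intro t _ _
    rw [sub_self, zero_mul, sub_zero, ← hr]
    positivity
  have hiDx : r * viD α ν x ≤ α ^ 2 * x * vi α ν x := by
    have : viD α ν x ≤ (α ^ 2 * x / r) * vi α ν x := by
      apply viD_le hν hα _ hx
      intro t ht htx
      rw [← hr]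
      have e1 : r * (α ^ 2 * x / r) = α ^ 2 * x := by field_simp
      have e2 : 0 ≤ (α ^ 2 * x / r) ^ 2 * t := by positivity
      have e3 : α ^ 2 * t ≤ α ^ 2 * x := by gcongr
      linarith
    calc r * viD α ν x ≤ r * ((α ^ 2 * x / r) * vi α ν x) := by gcongr
      _ = _ := by field_simp
  have hbα : b < α := by rw [hb]; exact hβ
  have hbb : b ^ 2 = β ^ 2 := by rw [hb, sq_abs]
  have hkk : 0 ≤ β * vk α ν x + vkD α ν x := by
    have h1 : -(α * vk α ν x) ≤ β * vk α ν x := by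
      rw [← neg_mul]
      apply mul_le_mul_of_nonneg_right _ hk.le
      exact (abs_lt.mp hβ).1.le
    linarith
  rcases le_or_gt β 0 with hs | hs
  · left
    have hbe : β = -b := by rw [hb, abs_of_nonpos hs]; ring
    have hb0 : 0 ≤ b := by rw [hb]; positivity
    have key := alg_neg (p0 := p0) (p1 := p1) (p2 := p2) (q0 := q0) (q1 := q1) (q2 := q2) (x := x) (w := w) hr0 hα hb0 hbα (by rw [hlam, hbb]) hl hx hw0 hi hiD hk hkD hWr hiDα hiDx
      (by rw [← hbe]; exact hA) (by rw [← hbe]; exact hB) (by rw [← hbe]; exact hC) (by rw [← hbe]; exact hD)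
      (by rw [← hbe]; exact hF) p0n p1n hV hS q0n hU hZ
    rw [← hbe] at key
    have := vDer_decomp (p0 := p0) (p1 := p1) (p2 := p2) (q0 := q0) (q1 := q1) hν hβ hx hH hm hlam hl (by rw [← he]; exact hp0) (by rw [← he]; exact hp1) (by rw [← he]; exact hp2)
      (by rw [← he]; exact hq0) (by rw [← he]; exact hq1) hkk (by rw [← hw, ← hr]; exact hA) (by rw [← hw, ← hr]; exact hB) key.1 key.2.1 key.2.2
    rw [← hr, ← hb] at this
    exact this
  · right
    have hbe : β = b := by rw [hb, abs_of_pos hs]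
    have hQ0 : 0 ≤ vQ α ν β 0 (fun _ => 1) := by
      unfold vQ
      apply setIntegral_nonneg measurableSet_Ioi
      intro t ht
      have ht' : (0:ℝ) < t := ht
      have := vk_pos ν hα ht'
      positivity
    have hi0 := vi0_pos hν hα
    have hW0 : 0 ≤ W := le_trans (by positivity) hW
    have hJ : viD α ν x ≤ b * vi α ν x → lam * vi α ν x * q0 ≤ W := by
      intro hcase
      rw [← hbe] at hcase
      have h1 := vi_exp_le hν hs hβ hx hcase
      have h2 : vQ α ν β x (fun _ => 1) ≤ vQ α ν β 0 (fun _ => 1) := by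
        unfold vQ
        apply setIntegral_mono_set (vQ_int hν hβ linGrowth_one le_rfl)
        · refine (ae_restrict_iff' measurableSet_Ioi).mpr (Eventually.of_forall fun t ht => ?_)
          have ht' : (0:ℝ) < t := ht
          have := vk_pos ν hα ht'
          simp only [Pi.zero_apply]
          positivity
        · exact (Set.Ioi_subset_Ioi hx.le).eventuallyLE
      refine le_trans ?_ hW
      calc lam * vi α ν x * q0 = lam * (Real.exp (-β * x) * vi α ν x) * vQ α ν β x (fun _ => 1) := by rw [hq0, he]; ring
        _ ≤ lam * vi0 α ν * vQ α ν β x (fun _ => 1) := by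
            have : 0 ≤ vQ α ν β x (fun _ => 1) := by
              have h5 : 0 ≤ e * vQ α ν β x (fun _ => 1) := by rw [← hq0]; exact q0n
              exact nonneg_of_mul_nonneg_right h5 he0
            gcongr
        _ ≤ _ := by gcongr
    have hiDl : r * b ≤ lam * x → r * viD α ν x ≤ lam * x * vi α ν x := by
      intro hcase
      have : viD α ν x ≤ (lam * x / r) * vi α ν x := by
        apply viD_le hν hα _ hx
        intro t ht htx
        rw [← hr]
        have e1 : r * (lam * x / r) = lam * x := by field_simp
        have e0 : b ≤ lam * x / r := by rw [le_div_iff₀ hr0]; linarith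
        have e2 : b ^ 2 * t ≤ (lam * x / r) ^ 2 * t := by
          have : 0 ≤ b := by rw [← hbe]; exact hs.le
          gcongr
        have e3 : lam * t ≤ lam * x := by gcongr
        rw [hbb] at e2
        have e4 : (α ^ 2 - (lam * x / r) ^ 2) * t ≤ lam * t := by
          have : lam * t = α ^ 2 * t - β ^ 2 * t := by rw [hlam]; ring
          linarith
        linarith
      calc r * viD α ν x ≤ r * ((lam * x / r) * vi α ν x) := by gcongr
        _ = _ := by field_simp
    have key := alg_pos (p0 := p0) (p1 := p1) (p2 := p2) (q0 := q0) (q1 := q1) (q2 := q2) (x := x) (w := w) (W := W) hr0 hα (by rw [← hbe]; exact hs) hbα (by rw [hlam, hbb]) hl hx hw0 hi hiD hk hkD hWr hiDα hiDx hiDl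
      (by rw [← hbe]; exact hA) (by rw [← hbe]; exact hB) (by rw [← hbe]; exact hC) (by rw [← hbe]; exact hD)
      (by rw [← hbe]; exact hE) (by rw [← hbe]; exact hF) p0n p1n hV hS q0n hU hZ hW0 hJ
    have := vDer_decomp (p0 := p0) (p1 := p1) (p2 := p2) (q0 := q0) (q1 := q1)
      (Y := α * (6 + 2 / r) + r * (b ^ 2 / lam) * W) (III := 8)
      (IV := 8 * r * (b ^ 2 / lam) + 2 * r * (b ^ 2 / lam) * (r * (b / lam) * W) + 4 * (1 + 4 * (α ^ 2 / lam) + 8 * (b * α / lam))) hν hβ hx hH hm hlam hl (by rw [← he]; exact hp0) (by rw [← he]; exact hp1) (by rw [← he]; exact hp2)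
      (by rw [← he]; exact hq0) (by rw [← he]; exact hq1) hkk (by rw [← hw, ← hr]; exact hA) (by rw [← hw, ← hr]; exact hB)
      (by rw [hbe]; exact key.1) (by rw [hbe]; exact key.2.1) (by rw [hbe]; exact key.2.2)
    rw [← hr, ← hb] at this
    exact this



lemma vP_hasDerivAt {ν : ℝ} (hν : -(1/2) < ν) (α β : ℝ) {x : ℝ} (hx : 0 < x) {H : ℝ → ℝ} (hH : Continuous H) :
    HasDerivAt (fun y => vP α ν β y H) (x ^ (2 * ν) * (Real.exp (β * x) * vi α ν x * H x)) x := by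
  have hi := vi_cont hν α
  have hc : ContinuousOn (fun t : ℝ => t ^ (2 * ν) * (Real.exp (β * t) * vi α ν t * H t)) (Set.Ioi 0) := by
    apply ContinuousOn.mul
    · exact continuousOn_id.rpow_const (fun t ht => Or.inl (ne_of_gt ht))
    · apply Continuous.continuousOn
      fun_prop
  unfold vP
  apply intervalIntegral.integral_hasDerivAt_right
  · apply rpow_int hν
    fun_prop
  · exact hc.stronglyMeasurableAtFilter isOpen_Ioi x hx
  · exact hc.continuousAt (isOpen_Ioi.mem_nhds hx)

lemma vQ_hasDerivAt {ν : ℝ} (hν : -(1/2) < ν) {α β : ℝ} (hβ : |β| < α) {x : ℝ} (hx : 0 < x) {H : ℝ → ℝ} (hH : LinGrowth H) :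
    HasDerivAt (fun y => vQ α ν β y H) (-(x ^ (2 * ν) * (Real.exp (β * x) * vk α ν x * H x))) x := by
  have hα : 0 < α := lt_of_le_of_lt (abs_nonneg β) hβ
  have hk := vk_contOn ν hα
  have hc : ContinuousOn (fun t : ℝ => t ^ (2 * ν) * (Real.exp (β * t) * vk α ν t * H t)) (Set.Ioi 0) := by
    apply ContinuousOn.mul
    · exact continuousOn_id.rpow_const (fun t ht => Or.inl (ne_of_gt ht))
    · apply ContinuousOn.mul _ hH.1.continuousOn
      apply ContinuousOn.mul _ hk
      apply Continuous.continuousOn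
      fun_prop
  have hIntg := vQ_int hν hβ hH le_rfl
  have e : ∀ y, 0 < y → vQ α ν β y H = vQ α ν β 0 H - ∫ t in (0:ℝ)..y, t ^ (2 * ν) * (Real.exp (β * t) * vk α ν t * H t) := by
    intro y hy
    unfold vQ
    rw [intervalIntegral.integral_of_le hy.le, eq_sub_iff_add_eq, add_comm, ← setIntegral_union, Set.Ioc_union_Ioi_eq_Ioi hy.le]
    · exact Set.Ioc_disjoint_Ioi le_rfl
    · exact measurableSet_Ioi
    · exact hIntg.mono_set Set.Ioc_subset_Ioi_self
    · exact hIntg.mono_set (Set.Ioi_subset_Ioi hy.le)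
  have h1 : HasDerivAt (fun y => ∫ t in (0:ℝ)..y, t ^ (2 * ν) * (Real.exp (β * t) * vk α ν t * H t))
      (x ^ (2 * ν) * (Real.exp (β * x) * vk α ν x * H x)) x := by
    apply intervalIntegral.integral_hasDerivAt_right
    · rw [intervalIntegrable_iff_integrableOn_Ioc_of_le hx.le]
      exact hIntg.mono_set Set.Ioc_subset_Ioi_self
    · exact hc.stronglyMeasurableAtFilter isOpen_Ioi x hx
    · exact hc.continuousAt (isOpen_Ioi.mem_nhds hx)
  have h2 := h1.const_sub (vQ α ν β 0 H)
  refine h2.congr_of_eventuallyEq ?_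
  filter_upwards [isOpen_Ioi.mem_nhds hx] with y hy
  exact e y hy

noncomputable def vF (α ν β x : ℝ) (H : ℝ → ℝ) : ℝ :=
  -((α ^ 2 - β ^ 2) * Real.exp (-β * x) * (vk α ν x * vP α ν β x H + vi α ν x * vQ α ν β x H))

lemma vF_hasDerivAt {ν : ℝ} (hν : -(1/2) < ν) {α β : ℝ} (hβ : |β| < α) {x : ℝ} (hx : 0 < x) {H : ℝ → ℝ} (hH : LinGrowth H) :
    HasDerivAt (fun y => vF α ν β y H) (vDer α ν β x H) x := by
  have hα : 0 < α := lt_of_le_of_lt (abs_nonneg β) hβ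
  have h1 := vP_hasDerivAt hν α β hx hH.1
  have h2 := vQ_hasDerivAt hν hβ hx hH
  have h3 := vk_hasDerivAt ν hα hx
  have h4 := vi_hasDerivAt (show -1 < ν by linarith) α x
  have h5 : HasDerivAt (fun y => (α ^ 2 - β ^ 2) * Real.exp (-β * y)) ((α ^ 2 - β ^ 2) * (Real.exp (-β * x) * (-β * 1))) x :=
    (((hasDerivAt_id x).const_mul (-β)).exp).const_mul _
  have h := (h5.mul ((h3.mul h1).add (h4.mul h2))).neg
  refine h.congr_deriv ?_
  unfold vDer
  simp only [Pi.add_apply, Pi.mul_apply]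
  ring

noncomputable def vw (α ν β t : ℝ) : ℝ := Real.exp (β * t) * |t| ^ ν * besselK ν (α * |t|)

lemma vw_pos (ν : ℝ) {α : ℝ} (hα : 0 < α) (β : ℝ) {t : ℝ} (ht : 0 < t) :
    vw α ν β t = t ^ (2 * ν) * (Real.exp (β * t) * vk α ν t) := by
  unfold vw
  rw [abs_of_pos ht, vk_eq ν hα ht, two_mul, Real.rpow_add ht]
  ring

lemma vw_neg (α ν β t : ℝ) : vw α ν β (-t) = vw α ν (-β) t := by
  unfold vw
  rw [abs_neg]
  ring_nf

lemma vw_nonneg (α ν β t : ℝ) : 0 ≤ vw α ν β t := by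
  unfold vw
  have : 0 ≤ besselK ν (α * |t|) := by
    unfold besselK
    apply setIntegral_nonneg measurableSet_Ioi
    intro s _
    have := Real.cosh_pos (ν * s)
    positivity
  positivity

lemma vw_Ioi {ν : ℝ} (hν : -(1/2) < ν) {α β : ℝ} (hβ : |β| < α) {y : ℝ} (hy : 0 ≤ y) {H : ℝ → ℝ} (hH : LinGrowth H) :
    IntegrableOn (fun t => vw α ν β t * H t) (Set.Ioi y) ∧ ∫ t in Set.Ioi y, vw α ν β t * H t = vQ α ν β y H := by
  have hα : 0 < α := lt_of_le_of_lt (abs_nonneg β) hβ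
  have e : Set.EqOn (fun t => vw α ν β t * H t) (fun t => t ^ (2 * ν) * (Real.exp (β * t) * vk α ν t * H t)) (Set.Ioi y) := by
    intro t ht
    have ht' : 0 < t := lt_of_le_of_lt hy ht
    simp only [vw_pos ν hα β ht']
    ring
  constructor
  · exact (integrableOn_congr_fun e measurableSet_Ioi).mpr (vQ_int hν hβ hH hy)
  · unfold vQ
    exact setIntegral_congr_fun measurableSet_Ioi e

lemma vw_Iic {ν : ℝ} (hν : -(1/2) < ν) {α β : ℝ} (hβ : |β| < α) {y : ℝ} (hy : 0 ≤ y) {H : ℝ → ℝ} (hH : LinGrowth (fun t => H (-t))) :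
    IntegrableOn (fun t => vw α ν β t * H t) (Set.Iic (-y)) ∧ ∫ t in Set.Iic (-y), vw α ν β t * H t = vQ α ν (-β) y (fun t => H (-t)) := by
  have hβ' : |-β| < α := by rwa [abs_neg]
  obtain ⟨h1, h2⟩ := vw_Ioi hν hβ' hy hH
  have e : (fun t => vw α ν (-β) t * H (-t)) = fun t => (fun s => vw α ν β s * H s) (-t) := by
    ext t; simp only [vw_neg]
  rw [e] at h1 h2
  constructor
  · rw [integrableOn_Iic_iff_integrableOn_Iio]
    have h3 : IntegrableOn (fun t => (fun s => vw α ν β s * H s) (-t)) (Set.Ioi (- -y)) := by rwa [neg_neg]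
    have := h3.comp_neg_Iio
    simpa using this
  · rw [← h2]
    exact (integral_comp_neg_Ioi y (fun s => vw α ν β s * H s)).symm

lemma vw_int {ν : ℝ} (hν : -(1/2) < ν) {α β : ℝ} (hβ : |β| < α) {H : ℝ → ℝ} (h1 : LinGrowth H) (h2 : LinGrowth (fun t => H (-t))) :
    Integrable (fun t => vw α ν β t * H t) ∧ ∫ t, vw α ν β t * H t = vQ α ν β 0 H + vQ α ν (-β) 0 (fun t => H (-t)) := by
  obtain ⟨a1, a2⟩ := vw_Ioi hν hβ le_rfl h1
  obtain ⟨b1, b2⟩ := vw_Iic hν hβ le_rfl h2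
  rw [neg_zero] at b1 b2
  have hi : Integrable (fun t => vw α ν β t * H t) := by
    rw [← integrableOn_univ, ← Set.Iic_union_Ioi (a := (0:ℝ))]
    exact b1.union a1
  refine ⟨hi, ?_⟩
  rw [← a2, ← b2, add_comm]
  exact (intervalIntegral.integral_Iic_add_Ioi b1 a1).symm

noncomputable def vTot (α ν β : ℝ) : ℝ := Real.sqrt Real.pi / α * (α / 2) ^ (-ν) * (Real.Gamma (ν + 1/2) * (1 - β ^ 2 / α ^ 2) ^ (-(ν + 1/2)))

lemma vw_tot {ν : ℝ} (hν : -(1/2) < ν) {α β : ℝ} (hβ : |β| < α) :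
    Integrable (vw α ν β) ∧ ∫ t, vw α ν β t = vTot α ν β := by
  have hα : 0 < α := lt_of_le_of_lt (abs_nonneg β) hβ
  obtain ⟨h1, h2⟩ := vgTot hν hα hβ
  have e : vw α ν β =ᵐ[volume] fun t => 1 / 2 * (α / 2) ^ (-ν) * (Real.exp (β * t) * vgPsi (-ν) (α ^ 2 * t ^ 2 / 4)) := by
    have h0 : ∀ᵐ t : ℝ, t ≠ 0 := by simp [ae_iff]
    filter_upwards [h0] with t ht
    have hp : 0 < |t| := abs_pos.mpr ht
    have h := vk_symm ν hα hp
    have h' := vw_pos ν hα 0 hp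
    unfold vw at h' ⊢
    rw [zero_mul, Real.exp_zero, one_mul, one_mul, h, abs_abs] at h'
    rw [mul_assoc, h', sq_abs]
    ring
  constructor
  · exact (h1.const_mul _).congr e.symm
  · rw [integral_congr_ae e, integral_const_mul, h2]
    unfold vTot
    ring



lemma vQ_tendsto {ν : ℝ} (hν : -(1/2) < ν) {α β : ℝ} (hβ : |β| < α) {H : ℝ → ℝ} (hH : LinGrowth H) :
    Tendsto (fun x => vQ α ν β x H) (nhdsWithin 0 (Set.Ioi 0)) (nhds (vQ α ν β 0 H)) := by
  have := (vQ_int hν hβ hH le_rfl).continuousWithinAt_Ici_primitive_Ioi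
  exact this.mono_left (nhdsWithin_mono 0 Set.Ioi_subset_Ici_self)

lemma vQ_first_moment {ν : ℝ} (hν : -(1/2) < ν) {α β : ℝ} (hβ : |β| < α) :
    (α ^ 2 - β ^ 2) * (vQ α ν β 0 (fun t => t) + vQ α ν (-β) 0 (fun t => t)) =
      2 / vi0 α ν + (2 * ν + 1) * β * (vQ α ν β 0 (fun _ => 1) - vQ α ν (-β) 0 (fun _ => 1)) := by
  have hα : 0 < α := lt_of_le_of_lt (abs_nonneg β) hβ
  have hβ' : |-β| < α := by rwa [abs_neg]
  have key : ∀ x : ℝ, 0 < x → (α ^ 2 - β ^ 2) * (vQ α ν β x (fun t => t) + vQ α ν (-β) x (fun t => t)) =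
      (β * (Real.exp (β * x) - Real.exp (-β * x))) * (x ^ (2 * ν + 1) * vk α ν x)
      + (Real.exp (β * x) + Real.exp (-β * x)) * (x ^ (2 * ν + 1) * vkD α ν x)
      + (2 * ν + 1) * β * (vQ α ν β x (fun _ => 1) - vQ α ν (-β) x (fun _ => 1)) := by
    intro x hx
    have h1 := vQ_B' hν hβ hx
    have h2 := vQ_B' hν hβ' hx
    rw [vQ_id hν hβ hx.le ((2 * ν + 1) * β) (-(α ^ 2 - β ^ 2)) 0 (g := fun t => (2 * ν + 1) * β - (α ^ 2 - β ^ 2) * t)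
      (fun t => by ring)] at h1
    rw [vQ_id hν hβ' hx.le ((2 * ν + 1) * (-β)) (-(α ^ 2 - (-β) ^ 2)) 0 (g := fun t => (2 * ν + 1) * (-β) - (α ^ 2 - (-β) ^ 2) * t)
      (fun t => by ring)] at h2
    linarith
  have ex : ∀ c : ℝ, Tendsto (fun x : ℝ => Real.exp (c * x)) (nhdsWithin 0 (Set.Ioi 0)) (nhds 1) := by
    intro c
    have : ContinuousAt (fun x : ℝ => Real.exp (c * x)) 0 := by fun_prop
    have h := this.tendsto
    simp only [mul_zero, Real.exp_zero] at h
    exact h.mono_left nhdsWithin_le_nhds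
  have l1 := ((vQ_tendsto hν hβ linGrowth_id).add (vQ_tendsto hν hβ' linGrowth_id)).const_mul (α ^ 2 - β ^ 2)
  have g0 : Tendsto (fun x : ℝ => β * (Real.exp (β * x) - Real.exp (-β * x))) (nhdsWithin 0 (Set.Ioi 0)) (nhds 0) := by
    have := ((ex β).sub (ex (-β))).const_mul β
    simpa using this
  have l2 := ((vk_limit hν hα g0).add (((ex β).add (ex (-β))).mul (vkD_limit hν hα))).add
    (((vQ_tendsto hν hβ linGrowth_one).sub (vQ_tendsto hν hβ' linGrowth_one)).const_mul ((2 * ν + 1) * β))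
  have l3 := l2.congr' (f₂ := fun x => (α ^ 2 - β ^ 2) * (vQ α ν β x (fun t => t) + vQ α ν (-β) x (fun t => t))) (by
    filter_upwards [self_mem_nhdsWithin] with x hx
    exact (key x hx).symm)
  rw [tendsto_nhds_unique l1 l3]
  ring

/-- The reduced data attached to the VG parameters. -/
lemma vg_param {_r θ σ : ℝ} (hσ : 0 < σ) {α β : ℝ} (hα : α = Real.sqrt (θ ^ 2 + σ ^ 2) / σ ^ 2) (hβ : β = θ / σ ^ 2) :
    0 < α ∧ |β| < α ∧ α ^ 2 - β ^ 2 = 1 / σ ^ 2 := by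
  have hs : 0 < θ ^ 2 + σ ^ 2 := by positivity
  refine ⟨by rw [hα]; positivity, ?_, ?_⟩
  · rw [hα, hβ, abs_div, abs_of_pos (by positivity : 0 < σ ^ 2)]
    apply div_lt_div_of_pos_right _ (by positivity)
    rw [← Real.sqrt_sq_eq_abs]
    apply Real.sqrt_lt_sqrt (by positivity)
    have : 0 < σ ^ 2 := by positivity
    linarith
  · rw [hα, hβ, div_pow, div_pow, Real.sq_sqrt hs.le]
    field_simp
    ring

lemma vTot_pos {ν : ℝ} (hν : -(1/2) < ν) {α β : ℝ} (hβ : |β| < α) : 0 < vTot α ν β := by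
  have hα : 0 < α := lt_of_le_of_lt (abs_nonneg β) hβ
  have h1 : 0 < 1 - β ^ 2 / α ^ 2 := by
    rw [sub_pos, div_lt_one (by positivity)]
    rw [← sq_abs β]
    have := abs_nonneg β
    gcongr
  have h2 := Real.Gamma_pos_of_pos (show 0 < ν + 1 / 2 by linarith)
  unfold vTot
  positivity

lemma vTot_eq {r θ σ : ℝ} (hσ : 0 < σ) {α β ν : ℝ} (hα : α = Real.sqrt (θ ^ 2 + σ ^ 2) / σ ^ 2) (hβ : β = θ / σ ^ 2)
    (hν : ν = (r - 1) / 2) :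
    vTot α ν β = σ * Real.sqrt Real.pi * Real.Gamma (r / 2) * ((α / 2) ^ (-ν) * (σ * α) ^ (r - 1)) := by
  obtain ⟨h0, h1, h2⟩ := vg_param (_r := r) hσ hα hβ
  have e1 : 1 - β ^ 2 / α ^ 2 = (σ * α) ^ (-2 : ℝ) := by
    rw [Real.rpow_neg (by positivity), show (2:ℝ) = ((2:ℕ):ℝ) by norm_num, Real.rpow_natCast]
    have : β ^ 2 = α ^ 2 - 1 / σ ^ 2 := by linarith
    rw [this]
    field_simp
    ring
  unfold vTot
  rw [e1, ← Real.rpow_mul (by positivity), show -2 * -(ν + 1 / 2) = (r - 1) + 1 by rw [hν]; ring, Real.rpow_add (by positivity),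
    Real.rpow_one, show ν + 1 / 2 = r / 2 by rw [hν]; ring]
  field_simp

lemma vgDensity_eq {r θ σ : ℝ} (hσ : 0 < σ) {α β ν : ℝ} (hα : α = Real.sqrt (θ ^ 2 + σ ^ 2) / σ ^ 2) (hβ : β = θ / σ ^ 2)
    (hν : ν = (r - 1) / 2) (t : ℝ) :
    vgDensity r θ σ t = (vTot α ν β)⁻¹ * vw α ν β t := by
  obtain ⟨h0, h1, h2⟩ := vg_param (_r := r) hσ hα hβ
  rw [vTot_eq hσ hα hβ hν]
  unfold vgDensity vw
  have hs : Real.sqrt (θ ^ 2 + σ ^ 2) = σ ^ 2 * α := by rw [hα]; field_simp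
  rw [hs, ← hν, Real.div_rpow (abs_nonneg _) (by positivity), show σ ^ 2 * α * |t| / σ ^ 2 = α * |t| by field_simp,
    show θ * t / σ ^ 2 = β * t by rw [hβ]; ring]
  have e : (2 * (σ ^ 2 * α)) ^ ν = (α / 2) ^ (-ν) * (σ * α) ^ (r - 1) := by
    rw [show r - 1 = 2 * ν by rw [hν]; ring, Real.rpow_mul (by positivity), Real.rpow_neg (by positivity), ← Real.inv_rpow (by positivity),
      ← Real.mul_rpow (by positivity) (by positivity)]
    congr 1
    rw [show (2:ℝ) = ((2:ℕ):ℝ) by norm_num, Real.rpow_natCast]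
    push_cast
    field_simp
  rw [e]
  simp only [mul_inv, div_eq_mul_inv]
  ring

lemma lip_neg {H : ℝ → ℝ} {L : ℝ} (hH : ∀ s t, |H s - H t| ≤ L * |s - t|) : ∀ s t, |H (-s) - H (-t)| ≤ L * |s - t| := by
  intro s t
  have := hH (-s) (-t)
  rwa [show -s - -t = -(s - t) by ring, abs_neg] at this

lemma htilde_lip (r θ σ : ℝ) {h : ℝ → ℝ} {L : ℝ} (hlip : ∀ u v : ℝ, |h u - h v| ≤ L * |u - v|) : ∀ s t, |htilde r θ σ h s - htilde r θ σ h t| ≤ L * |s - t| := by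
  intro s t
  unfold htilde
  rw [sub_sub_sub_cancel_right]
  exact hlip s t

lemma htilde_eq {r θ σ : ℝ} (_hr : 0 < r) (hσ : 0 < σ) {α β ν : ℝ}
    (hα : α = Real.sqrt (θ ^ 2 + σ ^ 2) / σ ^ 2) (hβ : β = θ / σ ^ 2)
    (hν : ν = (r - 1) / 2) {h : ℝ → ℝ} {L : ℝ} (_hlip : ∀ u v : ℝ, |h u - h v| ≤ L * |u - v|) (t : ℝ) : htilde r θ σ h t = h t - (vTot α ν β)⁻¹ * ∫ s, vw α ν β s * h s := by
  unfold htilde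
  rw [← integral_const_mul]
  congr 2
  ext s
  rw [vgDensity_eq hσ hα hβ hν]
  ring

lemma htilde_zero {r θ σ : ℝ} (hr : 0 < r) (hσ : 0 < σ) {α β ν : ℝ}
    (hα : α = Real.sqrt (θ ^ 2 + σ ^ 2) / σ ^ 2) (hβ : β = θ / σ ^ 2)
    (hν : ν = (r - 1) / 2) {h : ℝ → ℝ} {L : ℝ} (hlip : ∀ u v : ℝ, |h u - h v| ≤ L * |u - v|) : ∫ t, vw α ν β t * htilde r θ σ h t = 0 := by
  obtain ⟨h0, h1, h2⟩ := vg_param (_r := r) hσ hα hβ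
  have hν' : -(1/2) < ν := by rw [hν]; linarith
  obtain ⟨i1, i2⟩ := vw_tot hν' h1
  have hp := vTot_pos hν' h1
  obtain ⟨i3, -⟩ := vw_int hν' h1 (lip_growth hlip) (lip_growth (lip_neg hlip))
  have e : (fun t => vw α ν β t * htilde r θ σ h t) = fun t => vw α ν β t * h t - ((vTot α ν β)⁻¹ * ∫ s, vw α ν β s * h s) * vw α ν β t := by
    ext t
    rw [htilde_eq hr hσ hα hβ hν hlip]
    ring
  rw [e, integral_sub i3 (i1.const_mul _), integral_const_mul, i2]
  field_simp
  ring

lemma htilde_at_zero {r θ σ : ℝ} (hr : 0 < r) (hσ : 0 < σ) {α β ν : ℝ}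
    (hα : α = Real.sqrt (θ ^ 2 + σ ^ 2) / σ ^ 2) (hβ : β = θ / σ ^ 2)
    (hν : ν = (r - 1) / 2) {h : ℝ → ℝ} {L : ℝ} (hlip : ∀ u v : ℝ, |h u - h v| ≤ L * |u - v|) : |htilde r θ σ h 0| ≤ L * ((vTot α ν β)⁻¹ * (vQ α ν β 0 (fun t => t) + vQ α ν (-β) 0 (fun t => t))) := by
  obtain ⟨h0, h1, h2⟩ := vg_param (_r := r) hσ hα hβ
  have hν' : -(1/2) < ν := by rw [hν]; linarith
  obtain ⟨i1, i2⟩ := vw_tot hν' h1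
  have hp := vTot_pos hν' h1
  obtain ⟨i3, -⟩ := vw_int hν' h1 (lip_growth hlip) (lip_growth (lip_neg hlip))
  have habs : LinGrowth (fun t : ℝ => |t|) := lip_growth (L := 1) (fun s t => by
    rw [one_mul]; exact abs_abs_sub_abs_le s t)
  have habs' : LinGrowth (fun t : ℝ => (fun s : ℝ => |s|) (-t)) := by simpa using habs
  obtain ⟨i4, i5⟩ := vw_int hν' h1 habs habs'
  have e1 : vQ α ν β 0 (fun t => |t|) = vQ α ν β 0 (fun t => t) := by
    unfold vQ
    apply setIntegral_congr_fun measurableSet_Ioi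
    intro t ht
    simp only [abs_of_pos (show (0:ℝ) < t from ht)]
  have e2 : vQ α ν (-β) 0 (fun t => (fun s : ℝ => |s|) (-t)) = vQ α ν (-β) 0 (fun t => t) := by
    unfold vQ
    apply setIntegral_congr_fun measurableSet_Ioi
    intro t ht
    simp only [abs_neg, abs_of_pos (show (0:ℝ) < t from ht)]
  rw [e1, e2] at i5
  have e3 : htilde r θ σ h 0 = (vTot α ν β)⁻¹ * ∫ t, (h 0 * vw α ν β t - vw α ν β t * h t) := by
    rw [htilde_eq hr hσ hα hβ hν hlip, integral_sub (i1.const_mul _) i3, integral_const_mul, i2]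
    field_simp
  rw [e3, abs_mul, abs_of_pos (inv_pos.mpr hp), ← i5, mul_left_comm]
  apply mul_le_mul_of_nonneg_left _ (inv_pos.mpr hp).le
  rw [← integral_const_mul]
  refine (abs_integral_le_integral_abs).trans ?_
  apply integral_mono ((i1.const_mul _).sub i3).abs (i4.const_mul _)
  intro t
  have hw := vw_nonneg α ν β t
  have := hlip 0 t
  rw [zero_sub, abs_neg] at this
  simp only [Pi.sub_apply]
  rw [show h 0 * vw α ν β t - vw α ν β t * h t = vw α ν β t * (h 0 - h t) by ring, abs_mul, abs_of_nonneg hw]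
  calc _ ≤ vw α ν β t * (L * |t|) := by gcongr
    _ = _ := by ring

lemma stein_pos {r θ σ : ℝ} (hr : 0 < r) (hσ : 0 < σ) {α β ν : ℝ}
    (hα : α = Real.sqrt (θ ^ 2 + σ ^ 2) / σ ^ 2) (hβ : β = θ / σ ^ 2)
    (hν : ν = (r - 1) / 2) {h : ℝ → ℝ} {L : ℝ} (hlip : ∀ u v : ℝ, |h u - h v| ≤ L * |u - v|) {x : ℝ} (hx : 0 < x) : steinSolution r θ σ h x = vF α ν β x (htilde r θ σ h) := by
  obtain ⟨h0, h1, h2⟩ := vg_param (_r := r) hσ hα hβ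
  have hν' : -(1/2) < ν := by rw [hν]; linarith
  have hxν : 0 < x ^ ν := by positivity
  obtain ⟨-, q⟩ := vw_Ioi hν' h1 hx.le (lip_growth (htilde_lip r θ σ hlip))
  have p : ∫ t in (0:ℝ)..x, Real.exp (β * t) * |t| ^ ν * besselI ν (α * |t|) * htilde r θ σ h t = vP α ν β x (htilde r θ σ h) := by
    unfold vP
    rw [intervalIntegral.integral_of_le hx.le, intervalIntegral.integral_of_le hx.le]
    apply setIntegral_congr_fun measurableSet_Ioc
    intro t ht
    have ht' : 0 < t := ht.1
    simp only
    rw [abs_of_pos ht', vi_eq ν h0 ht', two_mul, Real.rpow_add ht']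
    ring
  unfold vw at q
  unfold steinSolution
  rw [← hα, ← hβ, ← hν, p, q, abs_of_pos hx, vk_eq ν h0 hx, vi_eq ν h0 hx]
  unfold vF
  rw [h2]
  field_simp
  ring

lemma stein_neg {r θ σ : ℝ} (hr : 0 < r) (hσ : 0 < σ) {α β ν : ℝ}
    (hα : α = Real.sqrt (θ ^ 2 + σ ^ 2) / σ ^ 2) (hβ : β = θ / σ ^ 2)
    (hν : ν = (r - 1) / 2) {h : ℝ → ℝ} {L : ℝ} (hlip : ∀ u v : ℝ, |h u - h v| ≤ L * |u - v|) {y : ℝ} (hy : 0 < y) : steinSolution r θ σ h (-y) = -vF α ν (-β) y (fun t => htilde r θ σ h (-t)) := by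
  obtain ⟨h0, h1, h2⟩ := vg_param (_r := r) hσ hα hβ
  have hν' : -(1/2) < ν := by rw [hν]; linarith
  have hxν : 0 < y ^ ν := by positivity
  have hl := htilde_lip r θ σ hlip
  obtain ⟨j1, q⟩ := vw_Iic hν' h1 hy.le (lip_growth (lip_neg hl))
  obtain ⟨j2, -⟩ := vw_int hν' h1 (lip_growth hl) (lip_growth (lip_neg hl))
  have z := htilde_zero hr hσ hα hβ hν hlip
  rw [← intervalIntegral.integral_Iic_add_Ioi j1 j2.integrableOn, q] at z
  have q' : ∫ t in Set.Ioi (-y), vw α ν β t * htilde r θ σ h t = -vQ α ν (-β) y (fun t => htilde r θ σ h (-t)) := by linarith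
  have p : ∫ t in (0:ℝ)..(-y), Real.exp (β * t) * |t| ^ ν * besselI ν (α * |t|) * htilde r θ σ h t = -vP α ν (-β) y (fun t => htilde r θ σ h (-t)) := by
    unfold vP
    rw [intervalIntegral.integral_symm, neg_inj]
    have e := intervalIntegral.integral_comp_neg (a := 0) (b := y) (fun t => Real.exp (β * t) * |t| ^ ν * besselI ν (α * |t|) * htilde r θ σ h t)
    rw [neg_zero] at e
    rw [← e, intervalIntegral.integral_of_le hy.le, intervalIntegral.integral_of_le hy.le]
    apply setIntegral_congr_fun measurableSet_Ioc
    intro t ht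
    have ht' : 0 < t := ht.1
    simp only
    rw [abs_neg, abs_of_pos ht', vi_eq ν h0 ht', two_mul, Real.rpow_add ht', mul_neg, neg_mul]
    ring
  unfold vw at q'
  unfold steinSolution
  rw [← hα, ← hβ, ← hν, p, q', abs_neg, abs_of_pos hy, vk_eq ν h0 hy, vi_eq ν h0 hy]
  unfold vF
  rw [neg_sq, h2, neg_neg, mul_neg, neg_mul, neg_neg]
  field_simp
  ring



lemma gamma_half_le {s : ℝ} (hs : 0 < s) : Real.Gamma (s + 1/2) ≤ Real.sqrt s * Real.Gamma s := by
  have h := Real.Gamma_mul_add_mul_le_rpow_Gamma_mul_rpow_Gamma hs (show 0 < s + 1 by linarith) (show (0:ℝ) < 1/2 by norm_num) (show (0:ℝ) < 1/2 by norm_num) (by norm_num)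
  rw [Real.Gamma_add_one hs.ne', ← Real.sqrt_eq_rpow, ← Real.sqrt_eq_rpow, Real.sqrt_mul hs.le] at h
  have h2 := Real.mul_self_sqrt (Real.Gamma_pos_of_pos hs).le
  rw [show s + 1 / 2 = 1 / 2 * s + 1 / 2 * (s + 1) by ring]
  calc _ ≤ _ := h
    _ = Real.sqrt s * (Real.sqrt (Real.Gamma s) * Real.sqrt (Real.Gamma s)) := by ring
    _ = _ := by rw [h2]

lemma gamma_half_ge {s : ℝ} (hs : 0 < s) : s * Real.Gamma s ≤ Real.sqrt (s + 1/2) * Real.Gamma (s + 1/2) := by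
  have h := gamma_half_le (show 0 < s + 1/2 by linarith)
  rwa [show s + 1/2 + 1/2 = s + 1 by ring, Real.Gamma_add_one hs.ne'] at h

lemma gamma_small {s : ℝ} (hs : 0 < s) (hs1 : s < 1) : 1 ≤ s * (1 + s) * Real.Gamma s := by
  have h := Real.Gamma_mul_add_mul_le_rpow_Gamma_mul_rpow_Gamma (show 0 < s + 1 by linarith) (show 0 < s + 1 + 1 by linarith) hs (show 0 < 1 - s by linarith) (by ring)
  rw [show s * (s + 1) + (1 - s) * (s + 1 + 1) = 2 by ring, Real.Gamma_two, Real.Gamma_add_one (show s + 1 ≠ 0 by linarith)] at h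
  have hg := Real.Gamma_pos_of_pos (show 0 < s + 1 by linarith)
  rw [Real.mul_rpow (by linarith) hg.le, mul_left_comm, ← Real.rpow_add hg, show s + (1 - s) = 1 by ring, Real.rpow_one, Real.Gamma_add_one hs.ne'] at h
  have h3 : (s + 1) ^ (1 - s) ≤ (s + 1) ^ (1:ℝ) := Real.rpow_le_rpow_of_exponent_le (by linarith) (by linarith)
  rw [Real.rpow_one] at h3
  rw [Real.Gamma_add_one hs.ne'] at hg
  nlinarith

/-- The numerical comparison of the coefficient of the large term. -/
lemma num_T {r a F : ℝ} (hr : 0 < r) (ha : 1 ≤ a)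
    (hF1 : 1 ≤ r → 1 + 6 / (r + 1) + Real.sqrt (Real.pi * r / 2) * a ^ (r - 1) ≤ F)
    (hF2 : r < 1 → 3 + 6 / (r + 1) ≤ F) :
    2 * r * (a ^ 2 - 1) ≤ F * (1 + a ^ 2) ∧ 27/10 ≤ F ∧ (r < 2 → 9/2 ≤ F) := by
  have ha0 : 0 < a := by linarith
  have hu : 1 ≤ a ^ 2 := by nlinarith
  have hpi := Real.pi_gt_three
  rcases lt_or_ge r 1 with h1 | h1
  · have hF := hF2 h1
    have h6 : 3 ≤ 6 / (r + 1) := by rw [le_div_iff₀ (by linarith)]; linarith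
    refine ⟨by nlinarith, by linarith, fun _ => by linarith⟩
  have hF := hF1 h1
  have hq0 : 0 < 6 / (r + 1) := by positivity
  rcases le_or_gt 3 r with h3 | h3
  · have hs : 2 ≤ Real.sqrt (Real.pi * r / 2) := by
      apply Real.le_sqrt_of_sq_le; nlinarith
    have hb : 1 + (r - 1) / 2 * (a ^ 2 - 1) ≤ a ^ (r - 1) := by
      have := one_add_mul_self_le_rpow_one_add (s := a ^ 2 - 1) (by linarith) (p := (r - 1) / 2) (by linarith)
      rw [show 1 + (a ^ 2 - 1) = a ^ (2:ℝ) by norm_num, ← Real.rpow_mul ha0.le, show 2 * ((r - 1) / 2) = r - 1 by ring] at this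
      exact this
    have hb1 : 0 ≤ (r - 1) / 2 * (a ^ 2 - 1) := mul_nonneg (by linarith) (by linarith)
    have hm : 2 * (1 + (r - 1) / 2 * (a ^ 2 - 1)) ≤ Real.sqrt (Real.pi * r / 2) * a ^ (r - 1) := by
      apply mul_le_mul hs hb (by linarith) (by linarith)
    have hF3 : 1 + 2 * (1 + (r - 1) / 2 * (a ^ 2 - 1)) ≤ F := by linarith
    refine ⟨?_, by linarith, fun h => by linarith⟩
    have : (1 + 2 * (1 + (r - 1) / 2 * (a ^ 2 - 1))) * (1 + a ^ 2) ≤ F * (1 + a ^ 2) := by gcongr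
    nlinarith [mul_nonneg (show 0 ≤ a ^ 2 - 1 by linarith) (show 0 ≤ a ^ 2 - 1 by linarith), mul_nonneg (show 0 ≤ r by linarith) (mul_nonneg (show 0 ≤ a ^ 2 - 1 by linarith) (show 0 ≤ a ^ 2 - 1 by linarith))]
  · have hs : 3/4 + 45/100 * r ≤ Real.sqrt (Real.pi * r / 2) := by
      apply Real.le_sqrt_of_sq_le; nlinarith
    have hb : 1 ≤ a ^ (r - 1) := Real.one_le_rpow ha (by linarith)
    have h6 : 11/4 - 45/100 * r ≤ 6 / (r + 1) := by
      rw [le_div_iff₀ (by linarith)]; nlinarith [sq_nonneg (r - 23/9)]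
    have hsb : Real.sqrt (Real.pi * r / 2) * 1 ≤ Real.sqrt (Real.pi * r / 2) * a ^ (r - 1) := by gcongr
    have hF3 : 9/2 ≤ F := by linarith
    refine ⟨?_, by linarith, fun h => hF3⟩
    rcases le_or_gt (a ^ 2 - 1) 3 with hv | hv
    · nlinarith
    rcases le_or_gt r 2 with h2 | h2
    · nlinarith
    · have ha2 : 2 ≤ a := by nlinarith
      have hs2 : 7/4 ≤ Real.sqrt (Real.pi * r / 2) := by
        apply Real.le_sqrt_of_sq_le; nlinarith [Real.pi_gt_d2]
      have hb2 : a ^ (1:ℝ) ≤ a ^ (r - 1) := Real.rpow_le_rpow_of_exponent_le ha (by linarith)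
      rw [Real.rpow_one] at hb2
      have h6' : 3/2 ≤ 6 / (r + 1) := by
        rw [le_div_iff₀ (by linarith)]; linarith
      have : 7/4 * 2 ≤ Real.sqrt (Real.pi * r / 2) * a ^ (r - 1) := by
        apply mul_le_mul hs2 (by linarith) (by linarith) (by linarith)
      have hF4 : 6 ≤ F := by linarith
      nlinarith

lemma num_big {r u n F A X s e : ℝ} (hr : 2 ≤ r) (hu : 1 ≤ u) (hF : 27/10 ≤ F) (hA : 0 ≤ A) (hFA : 3 * u ≤ F * A) (hs : 2 ≤ s)
    (hX : 0 ≤ X) (hn : n ≤ Real.sqrt r) (hn0 : 0 ≤ n) (he : e ≤ u - 1/2) (he0 : 0 ≤ e) :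
    e * (4 * r + 22 + 8 * (u - 1)) + n * (2 + 3 / r + 4 * (u - 1) / r) + 10 + 2 * u ≤ F * (1 + (1 + u) * (6 + X + 2 * (s + r) * A)) ∧
    10 * r * (u - 1) + 12 + 16 * u + e * (12 * r + 36) + n * (6 + 2 / r) ≤ F * (1 + (1 + u) * (6 + X + 2 * (s + r) * A)) := by
  have hr0 : 0 < r := by linarith
  have hb : (1 + u) * (16 + (4 + 2 * r) * (3 * u)) ≤ F * (1 + (1 + u) * (6 + X + 2 * (s + r) * A)) := by
    have h1 : F * ((1 + u) * (6 + 2 * (2 + r) * A)) ≤ F * (1 + (1 + u) * (6 + X + 2 * (s + r) * A)) := by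
      have : (1 + u) * (6 + 2 * (2 + r) * A) ≤ (1 + u) * (6 + X + 2 * (s + r) * A) := by
        have : 2 * (2 + r) * A ≤ 2 * (s + r) * A := by gcongr
        apply mul_le_mul_of_nonneg_left _ (by linarith); linarith
      apply mul_le_mul_of_nonneg_left _ (by linarith); linarith
    have h2 : F * ((1 + u) * (6 + 2 * (2 + r) * A)) = (1 + u) * (6 * F + (4 + 2 * r) * (F * A)) := by ring
    refine le_trans ?_ h1
    rw [h2]
    apply mul_le_mul_of_nonneg_left _ (by linarith)
    have : (4 + 2 * r) * (3 * u) ≤ (4 + 2 * r) * (F * A) := by gcongr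
    linarith
  have hq : Real.sqrt r ≤ (r + 1) / 2 := by
    apply Real.sqrt_le_iff.mpr
    constructor
    · linarith
    · nlinarith [sq_nonneg (r - 1)]
  have hnr : n / r ≤ 1 := by
    rw [div_le_one hr0]
    linarith
  have e1 : n * (2 + 3 / r + 4 * (u - 1) / r) = 2 * n + (n / r) * (3 + 4 * (u - 1)) := by ring
  have e2 : n * (6 + 2 / r) = 6 * n + 2 * (n / r) := by ring
  have e3 : (n / r) * (3 + 4 * (u - 1)) ≤ 1 * (3 + 4 * (u - 1)) := by
    apply mul_le_mul_of_nonneg_right hnr; linarith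
  have e4 : e * (4 * r + 22 + 8 * (u - 1)) ≤ (u - 1/2) * (4 * r + 22 + 8 * (u - 1)) := by
    apply mul_le_mul_of_nonneg_right he; linarith
  have e5 : e * (12 * r + 36) ≤ (u - 1/2) * (12 * r + 36) := by
    apply mul_le_mul_of_nonneg_right he; linarith
  have hv : 0 ≤ u - 1 := by linarith
  constructor
  · refine le_trans ?_ hb
    rw [e1]
    nlinarith [mul_nonneg hv hv, mul_nonneg hr0.le hv, mul_nonneg hr0.le (mul_nonneg hv hv)]
  · refine le_trans ?_ hb
    rw [e2]
    nlinarith [mul_nonneg hv hv, mul_nonneg hr0.le hv, mul_nonneg hr0.le (sq_nonneg (u - 4/3))]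

lemma num_small {r u n F A X s e q : ℝ} (hr : 0 < r) (hr2 : r < 2) (hu : 1 ≤ u) (hF : 9/2 ≤ F) (hA : 12 * u / r ≤ A) (hq : q = Real.sqrt r) (hs : q ≤ s)
    (hX : 0 ≤ X) (hn : n ≤ q * u) (hn0 : 0 ≤ n) (he : e ≤ u - 1/2) (he0 : 0 ≤ e) :
    e * (4 * r + 22 + 8 * (u - 1)) + n * (2 + 3 / r + 4 * (u - 1) / r) + 10 + 2 * u ≤ F * (1 + (1 + u) * (6 + X + 2 * (s + r) * A)) ∧
    10 * r * (u - 1) + 12 + 16 * u + e * (12 * r + 36) + n * (6 + 2 / r) ≤ F * (1 + (1 + u) * (6 + X + 2 * (s + r) * A)) := by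
  have hq0 : 0 < q := by rw [hq]; positivity
  have hqq : q * q = r := by rw [hq]; exact Real.mul_self_sqrt hr.le
  have hq2 : q ≤ 3/2 := by nlinarith
  obtain ⟨y, hy⟩ : ∃ y, y = 1 / q := ⟨_, rfl⟩
  have hy0 : 0 < y := by rw [hy]; positivity
  have hyr : q / r = y := by rw [← hqq, hy]; field_simp
  have hb : 9/2 * ((1 + u) * (6 + 24 * u + 24 * (u * y))) ≤ F * (1 + (1 + u) * (6 + X + 2 * (s + r) * A)) := by
    have h1 : 24 * u + 24 * (u * y) ≤ 2 * (s + r) * A := by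
      calc 24 * u + 24 * (u * y) = 2 * (q + r) * (12 * u / r) := by rw [← hyr]; field_simp; ring
        _ ≤ 2 * (s + r) * A := by
          have : 0 ≤ 12 * u / r := by positivity
          have : 0 ≤ 2 * (s + r) := by linarith
          gcongr
    have h2 : (1 + u) * (6 + 24 * u + 24 * (u * y)) ≤ 1 + (1 + u) * (6 + X + 2 * (s + r) * A) := by
      have : (1 + u) * (6 + 24 * u + 24 * (u * y)) ≤ (1 + u) * (6 + X + 2 * (s + r) * A) := by
        apply mul_le_mul_of_nonneg_left _ (by linarith); linarith
      linarith
    have : 0 ≤ u * y := by positivity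
    apply mul_le_mul hF h2 (by positivity) (by linarith)
  have hnr : n / r ≤ y * u := by
    rw [← hyr, div_mul_eq_mul_div]
    gcongr
  have hn2 : n ≤ 3/2 * u := by nlinarith
  have e1 : n * (2 + 3 / r + 4 * (u - 1) / r) = 2 * n + (n / r) * (3 + 4 * (u - 1)) := by ring
  have e2 : n * (6 + 2 / r) = 6 * n + 2 * (n / r) := by ring
  have e3 : (n / r) * (3 + 4 * (u - 1)) ≤ (y * u) * (3 + 4 * (u - 1)) := by
    apply mul_le_mul_of_nonneg_right hnr; linarith
  have e4 : e * (4 * r + 22 + 8 * (u - 1)) ≤ u * (4 * 2 + 22 + 8 * (u - 1)) := by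
    apply mul_le_mul (by linarith) (by linarith) (by nlinarith) (by linarith)
  have e5 : e * (12 * r + 36) ≤ u * (12 * 2 + 36) := by
    apply mul_le_mul (by linarith) (by linarith) (by linarith) (by linarith)
  have e6 : 10 * r * (u - 1) ≤ 20 * (u - 1) := by nlinarith
  have huy : 0 ≤ u * y := by positivity
  have hv : 0 ≤ u - 1 := by linarith
  constructor
  · refine le_trans ?_ hb
    rw [e1]
    nlinarith [mul_nonneg hv hv, mul_nonneg huy hv]
  · refine le_trans ?_ hb
    rw [e2]
    nlinarith [mul_nonneg hv hv, mul_nonneg huy hv]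



/-- The bound in reduced variables. -/
lemma stein_reduced {r θ σ : ℝ} (hr : 0 < r) (hσ : 0 < σ) {h : ℝ → ℝ} {L : ℝ} (hL : 0 ≤ L)
    (hlip : ∀ u v : ℝ, |h u - h v| ≤ L * |u - v|) {x d : ℝ} (hx : x ≠ 0) (hd : HasDerivAt (steinSolution r θ σ h) d x)
    {a ε ω : ℝ} (ha : a = Real.sqrt (1 + θ ^ 2 / σ ^ 2)) (hε : ε = |θ| / σ)
    (hω : ω = Real.sqrt Real.pi * Real.Gamma (r / 2) / Real.Gamma ((r + 1) / 2) * a ^ (r - 1)) :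
    |x * d| ≤ L * (ε * a * (4 * r + 22 + 8 * ε ^ 2) + 2 * a / ω * (2 + 3 / r + 4 * ε ^ 2 / r) + 10 + 2 * a ^ 2) ∨
    |x * d| ≤ L * (4 * r * ε ^ 2 * (r * ε * ω) + (10 * r * ε ^ 2 + 12 + 16 * a ^ 2 + ε * a * (12 * r + 36) + 2 * a / ω * (6 + 2 / r))) := by
  obtain ⟨α, hα⟩ : ∃ α, α = Real.sqrt (θ ^ 2 + σ ^ 2) / σ ^ 2 := ⟨_, rfl⟩
  obtain ⟨β, hβ⟩ : ∃ β, β = θ / σ ^ 2 := ⟨_, rfl⟩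
  obtain ⟨ν, hν⟩ : ∃ ν, ν = (r - 1) / 2 := ⟨_, rfl⟩
  obtain ⟨h0, h1, h2⟩ := vg_param (_r := r) hσ hα hβ
  have hν' : -(1/2) < ν := by rw [hν]; linarith
  have haα : a = σ * α := by
    rw [ha, hα, show 1 + θ ^ 2 / σ ^ 2 = (θ ^ 2 + σ ^ 2) / σ ^ 2 by field_simp; ring, Real.sqrt_div (by positivity), Real.sqrt_sq hσ.le]
    field_simp
  have ha0 : 0 < a := by rw [haα]; positivity
  have hG1 := Real.Gamma_pos_of_pos (show 0 < r / 2 by linarith)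
  have hG2 := Real.Gamma_pos_of_pos (show 0 < (r + 1) / 2 by linarith)
  have hω0 : 0 < ω := by rw [hω]; positivity
  have hT0 := vTot_pos hν' h1
  have hi0 := vi0_pos hν' h0
  have hW : (1 / σ ^ 2) * vi0 α ν * vTot α ν β = ω / σ := by
    rw [vTot_eq hσ hα hβ hν, hω, haα]
    unfold vi0
    have : (α / 2) ^ ν * (α / 2) ^ (-ν) = 1 := by
      rw [← Real.rpow_add (by positivity)]; simp
    rw [show ν + 1 = (r + 1) / 2 by rw [hν]; ring]
    calc _ = ((α / 2) ^ ν * (α / 2) ^ (-ν)) * (Real.sqrt Real.pi * Real.Gamma (r / 2) / Real.Gamma ((r + 1) / 2) * (σ * α) ^ (r - 1)) / σ := by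
          field_simp
      _ = _ := by rw [this]; ring
  have hsum := vw_int hν' h1 linGrowth_one linGrowth_one
  have htot : vQ α ν β 0 (fun _ => 1) + vQ α ν (-β) 0 (fun _ => 1) = vTot α ν β := by
    rw [← hsum.2, ← (vw_tot hν' h1).2]
    simp
  have qn : ∀ b, 0 ≤ vQ α ν b 0 (fun _ => 1) := by
    intro b
    unfold vQ
    apply setIntegral_nonneg measurableSet_Ioi
    intro t ht
    have ht' : (0:ℝ) < t := ht
    have := vk_pos ν h0 ht'
    positivity
  have qA := qn β
  have qB := qn (-β)
  have hm := htilde_at_zero hr hσ hα hβ hν hlip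
  have hmom := vQ_first_moment hν' h1
  obtain ⟨M, hM⟩ : ∃ M, M = vQ α ν β 0 (fun t => t) + vQ α ν (-β) 0 (fun t => t) := ⟨_, rfl⟩
  rw [← hM] at hm hmom
  have hrν : r = 2 * ν + 1 := by rw [hν]; ring
  have hmb : (vTot α ν β)⁻¹ * M ≤ r * |θ| + 2 * σ / ω := by
    have e1 : M ≤ σ ^ 2 * (2 / vi0 α ν + r * |β| * vTot α ν β) := by
      have : M = σ ^ 2 * ((α ^ 2 - β ^ 2) * M) := by rw [h2]; field_simp
      rw [this, hmom, ← hrν]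
      have hh : β * (vQ α ν β 0 (fun _ => 1) - vQ α ν (-β) 0 (fun _ => 1)) ≤ |β| * vTot α ν β := by
        rw [← htot]
        refine (le_abs_self _).trans ?_
        rw [abs_mul]
        apply mul_le_mul_of_nonneg_left _ (abs_nonneg β)
        rw [abs_le]; constructor <;> linarith
      have hh2 := mul_le_mul_of_nonneg_left hh hr.le
      apply mul_le_mul_of_nonneg_left _ (by positivity)
      linarith
    have e2 : |β| * σ ^ 2 = |θ| := by
      rw [hβ, abs_div, abs_of_pos (by positivity : 0 < σ ^ 2)]; field_simp
    have e3 : σ / ω = σ ^ 2 / (vi0 α ν * vTot α ν β) := by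
      have : ω = σ * ((1 / σ ^ 2) * vi0 α ν * vTot α ν β) := by rw [hW]; field_simp
      rw [this]; field_simp
    calc (vTot α ν β)⁻¹ * M ≤ (vTot α ν β)⁻¹ * (σ ^ 2 * (2 / vi0 α ν + r * |β| * vTot α ν β)) := by gcongr
      _ = r * (|β| * σ ^ 2) + 2 * (σ ^ 2 / (vi0 α ν * vTot α ν β)) := by field_simp; ring
      _ = _ := by rw [e2, ← e3]; ring
  have hm' : |htilde r θ σ h 0| ≤ L * (r * |θ| + 2 * σ / ω) := hm.trans (by gcongr)
  have hl := htilde_lip r θ σ hlip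
  -- conversions
  have c1 : |β| ^ 2 / (1 / σ ^ 2) = ε ^ 2 := by
    rw [hε, hβ, abs_div, abs_of_pos (by positivity : 0 < σ ^ 2)]; field_simp
  have c2 : |β| * α / (1 / σ ^ 2) = ε * a := by
    rw [hε, hβ, haα, abs_div, abs_of_pos (by positivity : 0 < σ ^ 2)]; field_simp
  have c3 : α ^ 2 / (1 / σ ^ 2) = a ^ 2 := by rw [haα]; field_simp
  have c4 : |β| / (1 / σ ^ 2) = ε * σ := by
    rw [hε, hβ, abs_div, abs_of_pos (by positivity : 0 < σ ^ 2)]; field_simp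
  have c5 : |θ| = ε * σ := by rw [hε]; field_simp
  have c6 : α = a / σ := by rw [haα]; field_simp
  have main : ∀ β' : ℝ, |β'| = |β| → (vQ α ν β' 0 (fun _ => 1) ≤ vTot α ν β) → ∀ H : ℝ → ℝ, (∀ s t, |H s - H t| ≤ L * |s - t|) →
      |H 0| ≤ L * (r * |θ| + 2 * σ / ω) → ∀ y, 0 < y →
      |y * vDer α ν β' y H| ≤ L * (ε * a * (4 * r + 22 + 8 * ε ^ 2) + 2 * a / ω * (2 + 3 / r + 4 * ε ^ 2 / r) + 10 + 2 * a ^ 2) ∨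
      |y * vDer α ν β' y H| ≤ L * (4 * r * ε ^ 2 * (r * ε * ω) + (10 * r * ε ^ 2 + 12 + 16 * a ^ 2 + ε * a * (12 * r + 36) + 2 * a / ω * (6 + 2 / r))) := by
    intro β' hb hq H hH hH0 y hy
    have hsq : β' ^ 2 = β ^ 2 := by rw [← sq_abs, hb, sq_abs]
    have := vDer_bound hν' (show |β'| < α by rwa [hb]) hy hH hH0 (lam := 1 / σ ^ 2) (r := r) (b := |β|) (W := ω / σ)
      (by rw [hsq, h2]) hrν hb.symm (by rw [← hW]; gcongr)
    rw [mul_div_assoc r |β| (1 / σ ^ 2), c1, c2, c3, c4, c5] at this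
    rcases this with this | this
    · left
      refine this.trans (le_of_eq ?_)
      rw [c6]
      field_simp
      ring
    · right
      refine this.trans (le_of_eq ?_)
      rw [c6]
      field_simp
      ring
  rcases lt_or_gt_of_ne hx with hneg | hpos
  · obtain ⟨y, hy⟩ : ∃ y, y = -x := ⟨_, rfl⟩
    have hy0 : 0 < y := by linarith
    have hxy : x = -y := by linarith
    have hD := vF_hasDerivAt hν' (show |-β| < α by rwa [abs_neg]) hy0 (lip_growth (lip_neg hl))
    rw [hxy] at hd
    have hd2 : HasDerivAt (fun z => steinSolution r θ σ h (-z)) (d * (-1)) y :=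
      hd.comp y (hasDerivAt_neg y)
    have hd3 : HasDerivAt (fun z => -vF α ν (-β) z (fun t => htilde r θ σ h (-t))) (d * (-1)) y := (hd2.congr_of_eventuallyEq (by
      filter_upwards [isOpen_Ioi.mem_nhds hy0] with z hz
      exact (stein_neg hr hσ hα hβ hν hlip hz).symm))
    have e := hd3.unique hD.neg
    have e' : d = vDer α ν (-β) y (fun t => htilde r θ σ h (-t)) := by linarith
    rw [hxy, neg_mul, abs_neg, e']
    exact main (-β) (abs_neg β) (by linarith) _ (lip_neg hl) (by simpa using hm') y hy0
  · have hD := vF_hasDerivAt hν' h1 hpos (lip_growth hl)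
    have hd3 : HasDerivAt (fun z => vF α ν β z (htilde r θ σ h)) d x := (hd.congr_of_eventuallyEq (by
      filter_upwards [isOpen_Ioi.mem_nhds hpos] with z hz
      exact (stein_pos hr hσ hα hβ hν hlip hz).symm))
    rw [hd3.unique hD]
    exact main β rfl (by linarith) _ hl hm' x hpos

set_option maxHeartbeats 4000000 in
theorem stein_factor_xf'_lipschitz (r θ σ : ℝ) (hr : 0 < r) (hσ : 0 < σ)
    (h : ℝ → ℝ) (L : ℝ) (hL : 0 ≤ L) (hlip : ∀ u v : ℝ, |h u - h v| ≤ L * |u - v|) :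
    ∀ x : ℝ, x ≠ 0 → ∀ d : ℝ, HasDerivAt (steinSolution r θ σ h) d x →
      |x * d| ≤ (1 + 6 / (r + 1) + Bconst (r + 1) θ σ) *
          (1 + (2 + θ ^ 2 / σ ^ 2) * Cconst r θ σ) * L := by
  intro x hx d hd
  obtain ⟨a, ha⟩ : ∃ a, a = Real.sqrt (1 + θ ^ 2 / σ ^ 2) := ⟨_, rfl⟩
  obtain ⟨ε, hε⟩ : ∃ ε, ε = |θ| / σ := ⟨_, rfl⟩
  obtain ⟨ω, hω⟩ : ∃ ω, ω = Real.sqrt Real.pi * Real.Gamma (r / 2) / Real.Gamma ((r + 1) / 2) * a ^ (r - 1) := ⟨_, rfl⟩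
  have hred := stein_reduced hr hσ hL hlip hx hd ha hε hω
  have hG1 := Real.Gamma_pos_of_pos (show 0 < r / 2 by linarith)
  have hG2 := Real.Gamma_pos_of_pos (show 0 < (r + 1) / 2 by linarith)
  have ha2 : 1 + θ ^ 2 / σ ^ 2 = a ^ 2 := by rw [ha, Real.sq_sqrt (by positivity)]
  have hε2 : ε ^ 2 = a ^ 2 - 1 := by rw [← ha2, hε, div_pow, sq_abs]; ring
  have ha1 : 1 ≤ a := by
    rw [ha]
    apply Real.le_sqrt_of_sq_le
    have : 0 ≤ θ ^ 2 / σ ^ 2 := by positivity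
    linarith
  have ha0 : 0 < a := by linarith
  have hε0 : 0 ≤ ε := by rw [hε]; positivity
  have hω0 : 0 < ω := by rw [hω]; positivity
  have hapow : ∀ p : ℝ, (a ^ 2) ^ p = a ^ (2 * p) := by
    intro p
    rw [Real.rpow_mul ha0.le]
    norm_num
  have hu : 1 ≤ a ^ 2 := by nlinarith
  have he : ε * a ≤ a ^ 2 - 1/2 := by nlinarith [sq_nonneg (ε - a)]
  have he0 : 0 ≤ ε * a := by positivity
  -- bounds on ω
  have hn : 2 * a / ω ≤ Real.sqrt r * a ^ (2 - r) := by
    have hg := gamma_half_le (show 0 < r / 2 by linarith)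
    rw [show r / 2 + 1 / 2 = (r + 1) / 2 by ring] at hg
    have e : a ^ (2 - r) * a ^ (r - 1) = a := by
      rw [← Real.rpow_add ha0, show 2 - r + (r - 1) = 1 by ring, Real.rpow_one]
    have hpi : 2 * Real.sqrt (r / 2) ≤ Real.sqrt r * Real.sqrt Real.pi := by
      rw [← Real.sqrt_mul hr.le, show (2:ℝ) = Real.sqrt 4 by rw [show (4:ℝ) = 2 ^ 2 by norm_num, Real.sqrt_sq (by norm_num)], ← Real.sqrt_mul (by norm_num)]
      apply Real.sqrt_le_sqrt
      rw [show Real.sqrt 4 = 2 by rw [show (4:ℝ) = 2 ^ 2 by norm_num, Real.sqrt_sq (by norm_num)]]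
      nlinarith [Real.pi_gt_three]
    rw [div_le_iff₀ hω0, hω]
    have : 2 * Real.Gamma ((r + 1) / 2) ≤ Real.sqrt r * Real.sqrt Real.pi * Real.Gamma (r / 2) := by
      calc _ ≤ 2 * (Real.sqrt (r / 2) * Real.Gamma (r / 2)) := by gcongr
        _ = 2 * Real.sqrt (r / 2) * Real.Gamma (r / 2) := by ring
        _ ≤ _ := by gcongr
    calc 2 * a = 2 * Real.Gamma ((r + 1) / 2) / Real.Gamma ((r + 1) / 2) * a := by field_simp
      _ ≤ Real.sqrt r * Real.sqrt Real.pi * Real.Gamma (r / 2) / Real.Gamma ((r + 1) / 2) * a := by gcongr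
      _ = Real.sqrt r * Real.sqrt Real.pi * Real.Gamma (r / 2) / Real.Gamma ((r + 1) / 2) * (a ^ (2 - r) * a ^ (r - 1)) := by rw [e]
      _ = _ := by ring
  have hn0 : 0 ≤ 2 * a / ω := by positivity
  obtain ⟨T, hT⟩ : ∃ T, T = Real.sqrt (2 * Real.pi * (r + 1)) * ε * a ^ (r - 1) := ⟨_, rfl⟩
  have hT0 : 0 ≤ T := by rw [hT]; positivity
  have hTω : r * ε * ω ≤ T := by
    have hg := gamma_half_ge (show 0 < r / 2 by linarith)
    rw [show r / 2 + 1 / 2 = (r + 1) / 2 by ring] at hg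
    have e : Real.sqrt (2 * Real.pi * (r + 1)) = 2 * Real.sqrt Real.pi * Real.sqrt ((r + 1) / 2) := by
      rw [show 2 * Real.pi * (r + 1) = 2 ^ 2 * (Real.pi * ((r + 1) / 2)) by ring, Real.sqrt_mul (by norm_num), Real.sqrt_sq (by norm_num),
        Real.sqrt_mul Real.pi_pos.le]
      ring
    have : r * Real.Gamma (r / 2) / Real.Gamma ((r + 1) / 2) ≤ 2 * Real.sqrt ((r + 1) / 2) := by
      rw [div_le_iff₀ hG2]; linarith
    rw [hT, hω, e]
    calc _ = Real.sqrt Real.pi * ε * a ^ (r - 1) * (r * Real.Gamma (r / 2) / Real.Gamma ((r + 1) / 2)) := by ring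
      _ ≤ Real.sqrt Real.pi * ε * a ^ (r - 1) * (2 * Real.sqrt ((r + 1) / 2)) := by gcongr
      _ = _ := by ring
  -- constants
  obtain ⟨F, hF⟩ : ∃ F, F = 1 + 6 / (r + 1) + Bconst (r + 1) θ σ := ⟨_, rfl⟩
  have hF1 : 1 ≤ r → F = 1 + 6 / (r + 1) + Real.sqrt (Real.pi * r / 2) * a ^ (r - 1) := by
    intro h1
    rw [hF]
    unfold Bconst
    rw [if_pos (by linarith), ha2, hapow, show 2 * ((r + 1) / 2 - 1) = r - 1 by ring, show r + 1 - 1 = r by ring]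
  have hF2 : r < 1 → F = 3 + 6 / (r + 1) := by
    intro h1
    rw [hF]
    unfold Bconst
    rw [if_neg (by linarith)]
    ring
  obtain ⟨n1, n2, n3⟩ := num_T (F := F) hr ha1 (fun h => (hF1 h).ge) (fun h => (hF2 h).ge)
  have hC : Cconst r θ σ = 6 + 2 * Real.sqrt 2 / Real.sqrt r + 2 * T + 2 * (Real.sqrt (2 * r) + r) * Aconst r θ σ := by
    unfold Cconst
    rw [ha2, hapow, ← hε, hT, show 2 * ((r - 1) / 2) = r - 1 by ring]
    ring
  have hrest : ε * a * (4 * r + 22 + 8 * (a ^ 2 - 1)) + 2 * a / ω * (2 + 3 / r + 4 * (a ^ 2 - 1) / r) + 10 + 2 * a ^ 2 ≤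
      F * (1 + (1 + a ^ 2) * (6 + 2 * Real.sqrt 2 / Real.sqrt r + 2 * (Real.sqrt (2 * r) + r) * Aconst r θ σ)) ∧
      10 * r * (a ^ 2 - 1) + 12 + 16 * a ^ 2 + ε * a * (12 * r + 36) + 2 * a / ω * (6 + 2 / r) ≤
      F * (1 + (1 + a ^ 2) * (6 + 2 * Real.sqrt 2 / Real.sqrt r + 2 * (Real.sqrt (2 * r) + r) * Aconst r θ σ)) := by
    rcases le_or_gt 2 r with h2 | h2
    · have hA : Aconst r θ σ = 2 * Real.sqrt Real.pi / Real.sqrt (2 * r - 1) * a ^ r := by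
        unfold Aconst
        rw [if_pos h2, ha2, hapow, show 2 * (r / 2) = r by ring]
      have hA0 : 0 ≤ Aconst r θ σ := by rw [hA]; positivity
      apply num_big h2 hu n2 hA0 _ _ (by positivity) _ hn0 he he0
      · have hF3 : Real.sqrt (Real.pi * r / 2) * a ^ (r - 1) ≤ F := by
          rw [hF1 (by linarith)]
          have : 0 < 6 / (r + 1) := by positivity
          linarith
        have hP : 3 ≤ Real.sqrt (Real.pi * r / 2) * (2 * Real.sqrt Real.pi / Real.sqrt (2 * r - 1)) := by
          have hd0 : 0 < Real.sqrt (2 * r - 1) := Real.sqrt_pos.mpr (by linarith)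
          rw [← mul_div_assoc, le_div_iff₀ hd0]
          have s1 : Real.sqrt (2 * r - 1) ≤ Real.sqrt (2 * r) := Real.sqrt_le_sqrt (by linarith)
          have s2 : Real.sqrt (Real.pi * r / 2) * (2 * Real.sqrt Real.pi) = Real.pi * Real.sqrt (2 * r) := by
            rw [show Real.pi * r / 2 = Real.pi * ((2 * r) / 2 ^ 2) by ring, Real.sqrt_mul Real.pi_pos.le, Real.sqrt_div (by positivity),
              Real.sqrt_sq (by norm_num)]
            have := Real.mul_self_sqrt Real.pi_pos.le
            calc _ = (Real.sqrt Real.pi * Real.sqrt Real.pi) * Real.sqrt (2 * r) := by ring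
              _ = _ := by rw [this]
          rw [s2]
          have := Real.pi_gt_three
          gcongr
        have hp1 : 1 ≤ a ^ (r - 1) := Real.one_le_rpow ha1 (by linarith)
        have hp2 : a ^ (2:ℝ) ≤ a ^ r := Real.rpow_le_rpow_of_exponent_le ha1 h2
        rw [Real.rpow_two] at hp2
        calc 3 * a ^ 2 ≤ (Real.sqrt (Real.pi * r / 2) * (2 * Real.sqrt Real.pi / Real.sqrt (2 * r - 1))) * (1 * a ^ r) := by
              rw [one_mul]; gcongr
          _ ≤ (Real.sqrt (Real.pi * r / 2) * (2 * Real.sqrt Real.pi / Real.sqrt (2 * r - 1))) * (a ^ (r - 1) * a ^ r) := by gcongr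
          _ = (Real.sqrt (Real.pi * r / 2) * a ^ (r - 1)) * Aconst r θ σ := by rw [hA]; ring
          _ ≤ F * Aconst r θ σ := by gcongr
      · apply Real.le_sqrt_of_sq_le; linarith
      · refine hn.trans ?_
        have : a ^ (2 - r) ≤ 1 := Real.rpow_le_one_of_one_le_of_nonpos ha1 (by linarith)
        nlinarith [Real.sqrt_nonneg r]
    · have hA : Aconst r θ σ = 12 * Real.Gamma (r / 2) * a ^ 2 := by
        unfold Aconst
        rw [if_neg (by linarith), ha2]
      apply num_small hr h2 hu (n3 h2) _ rfl (Real.sqrt_le_sqrt (by linarith)) (by positivity) _ hn0 he he0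
      · rw [hA, div_le_iff₀ hr]
        have hg := gamma_small (show 0 < r / 2 by linarith) (by linarith)
        have hg2 : 1 ≤ r * Real.Gamma (r / 2) := by nlinarith [mul_pos hr hG1]
        nlinarith
      · refine hn.trans ?_
        have : a ^ (2 - r) ≤ a ^ (2:ℝ) := Real.rpow_le_rpow_of_exponent_le ha1 (by linarith)
        rw [Real.rpow_two] at this
        gcongr
  rw [← hF, hC, show 2 + θ ^ 2 / σ ^ 2 = 1 + a ^ 2 by rw [← ha2]; ring]
  rw [hε2] at hred
  obtain ⟨X, hX⟩ : ∃ X, X = 6 + 2 * Real.sqrt 2 / Real.sqrt r + 2 * (Real.sqrt (2 * r) + r) * Aconst r θ σ := ⟨_, rfl⟩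
  rw [← hX] at hrest
  have eX : F * (1 + (1 + a ^ 2) * (6 + 2 * Real.sqrt 2 / Real.sqrt r + 2 * T + 2 * (Real.sqrt (2 * r) + r) * Aconst r θ σ)) =
      F * (1 + (1 + a ^ 2) * X) + F * (1 + a ^ 2) * (2 * T) := by rw [hX]; ring
  rw [eX, mul_comm]
  have hTT : 0 ≤ F * (1 + a ^ 2) * (2 * T) := by
    have : 0 ≤ F := by linarith
    positivity
  rcases hred with hred | hred
  · rw [mul_comm]
    refine hred.trans ?_
    rw [mul_comm]
    apply mul_le_mul_of_nonneg_right _ hL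
    linarith [hrest.1]
  · rw [mul_comm]
    refine hred.trans ?_
    rw [mul_comm]
    apply mul_le_mul_of_nonneg_right _ hL
    have hv : 0 ≤ a ^ 2 - 1 := by linarith
    have t1 : 4 * r * (a ^ 2 - 1) * (r * ε * ω) ≤ 4 * r * (a ^ 2 - 1) * T := by gcongr
    have t2 : 2 * r * (a ^ 2 - 1) * (2 * T) ≤ F * (1 + a ^ 2) * (2 * T) := by gcongr
    linarith [hrest.2]
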